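/- arXiv:2301.00186 — 2 statements merged into one kernel-verified Lean document; each statement's English description precedes it below -/
import Mathlib

section
/- (Commutative case of Lemma 7.6.) Let (X, μ) be a σ-finite measure space, 1 < p < ∞, and let T : L^p(X, μ) → L^p(X, μ) be a linear isometry. Assume either 2 ≤ p < ∞, or 1 < p < 2 and T is positive. Then there exists a constant C depending only on p such that for every N ∈ ℕ, every strictly increasing finite sequence n_0 < n_1 < ⋯ < n_N of positive integers, and every x ∈ L^p(X, μ): ‖ ( ∑_{i=0}^{N-1} |M_{n_i}(T)x − M_{n_{i+1}}(T)x|^2 )^{1/2} ‖_{L^p(X,μ)} ≤ C ‖x‖_{L^p(X,μ)}. -/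
open MeasureTheory Finset ENNReal
open scoped ComplexOrder

/-- One-sided ergodic average `M_n(T) = (1/(n+1)) ∑_{k=0}^{n} T^k`. -/
noncomputable def ergAvg {X : Type*} [MeasurableSpace X] {μ : MeasureTheory.Measure X}
    {p : ℝ≥0∞} [Fact (1 ≤ p)]
    (T : Lp ℂ p μ →L[ℂ] Lp ℂ p μ) (n : ℕ) : Lp ℂ p μ →L[ℂ] Lp ℂ p μ :=
  ((n : ℂ) + 1)⁻¹ • ∑ k ∈ Finset.range (n + 1), T ^ k

/-- A bounded operator on `L^p(X, μ)` is positive if it maps a.e. nonnegative functions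
to a.e. nonnegative functions. -/
def IsPositiveOp {X : Type*} [MeasurableSpace X] {μ : MeasureTheory.Measure X}
    {p : ℝ≥0∞} [Fact (1 ≤ p)]
    (S : Lp ℂ p μ →L[ℂ] Lp ℂ p μ) : Prop :=
  ∀ f : Lp ℂ p μ, (∀ᵐ ω ∂μ, 0 ≤ (f : X → ℂ) ω) → (∀ᵐ ω ∂μ, 0 ≤ (S f : X → ℂ) ω)


namespace QME

lemma telescope_var {E : Type*} [SeminormedAddCommGroup E] (φ : ℕ → E) (n : ℕ → ℕ)
    (hn : Monotone n) (N : ℕ) :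
    ∑ i ∈ range N, ‖φ (n i) - φ (n (i+1))‖ ≤ ∑ l ∈ range (n N), ‖φ (l+1) - φ l‖ := by
  induction N with
  | zero => simp; exact Finset.sum_nonneg (fun _ _ => norm_nonneg _)
  | succ N ih =>
    rw [sum_range_succ]
    have h : n N ≤ n (N+1) := hn (Nat.le_succ N)
    have h2 := dist_le_Ico_sum_dist φ h
    rw [← sum_range_add_sum_Ico _ h]
    rw [dist_eq_norm] at h2
    refine add_le_add ih (h2.trans ?_)
    refine sum_le_sum fun l _ => ?_
    rw [dist_eq_norm, norm_sub_rev]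

/-- the map `z ↦ |z| z` -/
noncomputable def phi (z : ℂ) : ℂ := (‖z‖ : ℂ) * z

lemma phi_upper (z w : ℂ) : ‖phi z - phi w‖ ≤ (‖z‖ + ‖w‖) * ‖z - w‖ := by
  have : phi z - phi w = (‖z‖ : ℂ) * (z - w) + ((‖z‖ - ‖w‖ : ℝ) : ℂ) * w := by
    unfold phi; push_cast; ring
  rw [this]
  refine (norm_add_le _ _).trans ?_
  rw [norm_mul, norm_mul, Complex.norm_real, Complex.norm_real, norm_norm, Real.norm_eq_abs]
  have := abs_norm_sub_norm_le z w
  nlinarith [norm_nonneg w, norm_nonneg z]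

lemma phi_lower (z w : ℂ) : ‖z - w‖ ^ 2 ≤ 2 * ‖phi z - phi w‖ := by
  have h1 : ((phi z - phi w) * (starRingEnd ℂ) (z - w)).re
      ≤ ‖phi z - phi w‖ * ‖z - w‖ := by
    refine (Complex.re_le_norm _).trans ?_
    rw [norm_mul, Complex.norm_conj]
  have ez : ‖z‖ ^ 2 = z.re ^ 2 + z.im ^ 2 := by
    rw [Complex.sq_norm, Complex.normSq_apply]; ring
  have ew : ‖w‖ ^ 2 = w.re ^ 2 + w.im ^ 2 := by
    rw [Complex.sq_norm, Complex.normSq_apply]; ring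
  have ezw : ‖z - w‖ ^ 2 = (z.re - w.re) ^ 2 + (z.im - w.im) ^ 2 := by
    rw [Complex.sq_norm, Complex.normSq_apply]; simp; ring
  have h2 : ((phi z - phi w) * (starRingEnd ℂ) (z - w)).re
     = (‖z‖ * z.re - ‖w‖ * w.re) * (z.re - w.re)
      + (‖z‖ * z.im - ‖w‖ * w.im) * (z.im - w.im) := by
    simp [phi]
    ring
  have h3 : (‖z‖ + ‖w‖) * ‖z - w‖ ^ 2 / 2 ≤ ((phi z - phi w) * (starRingEnd ℂ) (z - w)).re := by
    rw [h2, ezw]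
    have : 0 ≤ (‖z‖ + ‖w‖) * (‖z‖ - ‖w‖) ^ 2 := by positivity
    have h6 : (‖z‖ * z.re - ‖w‖ * w.re) * (z.re - w.re)
        + (‖z‖ * z.im - ‖w‖ * w.im) * (z.im - w.im)
        - (‖z‖ + ‖w‖) * ((z.re - w.re) ^ 2 + (z.im - w.im) ^ 2) / 2
        = (‖z‖ + ‖w‖) * (‖z‖ - ‖w‖) ^ 2 / 2 := by
      linear_combination (-(‖z‖ - ‖w‖) / 2) * ez + ((‖z‖ - ‖w‖) / 2) * ew
    linarith
  have h4 := norm_sub_le z w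
  by_cases h0 : ‖z - w‖ = 0
  · rw [h0]; simp
  have hp : 0 < ‖z - w‖ := lt_of_le_of_ne (norm_nonneg _) (Ne.symm h0)
  have h5 : (‖z‖ + ‖w‖) * ‖z - w‖ / 2 ≤ ‖phi z - phi w‖ := by
    have := h3.trans h1
    by_contra hc
    push Not at hc
    nlinarith
  nlinarith

lemma jump_sq (u : ℕ → ℂ) (n : ℕ → ℕ) (hn : Monotone n) (N : ℕ) :
    ∑ i ∈ range N, ‖u (n i) - u (n (i+1))‖ ^ 2 ≤
      2 * ∑ l ∈ range (n N), (‖u (l+1)‖ + ‖u l‖) * ‖u (l+1) - u l‖ := by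
  calc _ ≤ ∑ i ∈ range N, 2 * ‖phi (u (n i)) - phi (u (n (i+1)))‖ :=
        sum_le_sum fun i _ => phi_lower _ _
    _ = 2 * ∑ i ∈ range N, ‖phi (u (n i)) - phi (u (n (i+1)))‖ := by rw [mul_sum]
    _ ≤ 2 * ∑ l ∈ range (n N), ‖phi (u (l+1)) - phi (u l)‖ := by
        gcongr; exact telescope_var (fun l => phi (u l)) n hn N
    _ ≤ _ := by gcongr; exact phi_upper _ _

/-- averages on the integers -/
noncomputable def av (n : ℕ) (g : ℤ → ℂ) (k : ℤ) : ℂ :=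
  ((n : ℂ) + 1)⁻¹ * ∑ j ∈ range (n + 1), g (k + j)

lemma nat_succ_ne (n : ℕ) : (n : ℂ) + 1 ≠ 0 := by exact_mod_cast Nat.succ_ne_zero n

/-- general recursion for averages -/
lemma avg_step (B : ℕ → ℂ) (l : ℕ) :
    (((l+1 : ℕ) : ℂ) + 1)⁻¹ * B (l+1) - ((l : ℂ) + 1)⁻¹ * B l =
      (((l+1 : ℕ) : ℂ) + 1)⁻¹ * ((B (l+1) - B l) - ((l : ℂ) + 1)⁻¹ * B l) := by
  have h1 := nat_succ_ne l
  have h2 := nat_succ_ne (l+1)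
  field_simp
  push_cast
  ring

noncomputable def ca (z : ℂ) (n : ℕ) : ℂ := ((n : ℂ) + 1)⁻¹ * ∑ j ∈ range (n + 1), z ^ j

lemma norm_inv_succ (n : ℕ) : ‖((n : ℂ) + 1)⁻¹‖ = ((n : ℝ) + 1)⁻¹ := by
  rw [norm_inv]
  congr 1
  have : ((n : ℂ) + 1) = ((n + 1 : ℝ) : ℂ) := by push_cast; rfl
  rw [this, Complex.norm_real, Real.norm_of_nonneg (by positivity)]

lemma ca_le_one (z : ℂ) (hz : ‖z‖ = 1) (n : ℕ) : ‖ca z n‖ ≤ 1 := by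
  unfold ca
  rw [norm_mul, norm_inv_succ]
  have : ‖∑ j ∈ range (n + 1), z ^ j‖ ≤ (n : ℝ) + 1 := by
    refine (norm_sum_le _ _).trans ?_
    simp [hz]
  rw [inv_mul_le_iff₀ (by positivity)]
  simpa using this

lemma ca_decay (z : ℂ) (hz : ‖z‖ = 1) (n : ℕ) : ((n : ℝ) + 1) * ‖1 - z‖ * ‖ca z n‖ ≤ 2 := by
  have h : ((n : ℂ) + 1) * (1 - z) * ca z n = 1 - z ^ (n+1) := by
    unfold ca
    have := mul_neg_geom_sum z (n+1)
    rw [← this]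
    field_simp [nat_succ_ne n]
  have h2 := congrArg norm h
  rw [norm_mul, norm_mul] at h2
  have e : ‖(n : ℂ) + 1‖ = (n : ℝ) + 1 := by
    have := norm_inv_succ n
    rw [norm_inv] at this
    exact inv_injective this
  rw [e] at h2
  rw [h2]
  refine (norm_sub_le _ _).trans ?_
  rw [norm_pow, hz]; norm_num

lemma ca_step (z : ℂ) (l : ℕ) :
    ca z (l+1) - ca z l = (((l+1 : ℕ) : ℂ) + 1)⁻¹ * (z ^ (l+1) - ca z l) := by
  have := avg_step (fun n => ∑ j ∈ range (n + 1), z ^ j) l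
  unfold ca
  rw [this, sum_range_succ _ (l+1)]
  ring

lemma ca_diff1 (z : ℂ) (hz : ‖z‖ = 1) (l : ℕ) :
    ((l : ℝ) + 2) * ‖ca z (l+1) - ca z l‖ ≤ 2 := by
  rw [ca_step, norm_mul, norm_inv_succ]
  have : ‖z ^ (l+1) - ca z l‖ ≤ 2 := by
    refine (norm_sub_le _ _).trans ?_
    rw [norm_pow, hz]; have := ca_le_one z hz l; norm_num; linarith
  push_cast
  rw [show (l : ℝ) + 1 + 1 = l + 2 by ring, ← mul_assoc, mul_inv_cancel₀ (by positivity)]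
  linarith

lemma pow_diff (z : ℂ) (hz : ‖z‖ = 1) (n j : ℕ) (h : j ≤ n) :
    ‖z ^ n - z ^ j‖ ≤ ((n : ℝ) - j) * ‖1 - z‖ := by
  induction n, h using Nat.le_induction with
  | base => simp
  | succ n hn ih =>
    have : z ^ (n+1) - z ^ j = (z ^ n - z ^ j) - z ^ n * (1 - z) := by ring
    rw [this]
    refine (norm_sub_le _ _).trans ?_
    rw [norm_mul, norm_pow, hz, one_pow]
    push_cast
    linarith

lemma ca_diff2 (z : ℂ) (hz : ‖z‖ = 1) (l : ℕ) :
    ‖ca z (l+1) - ca z l‖ ≤ ‖1 - z‖ := by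
  rw [ca_step, norm_mul, norm_inv_succ, inv_mul_le_iff₀ (by positivity)]
  have h : z ^ (l+1) - ca z l = ((l : ℂ) + 1)⁻¹ * ∑ j ∈ range (l + 1), (z ^ (l+1) - z ^ j) := by
    unfold ca
    rw [sum_sub_distrib]
    simp
    field_simp [nat_succ_ne l]
  rw [h, norm_mul, norm_inv_succ, inv_mul_le_iff₀ (by positivity)]
  refine (norm_sum_le _ _).trans ?_
  have : ∀ j ∈ range (l+1), ‖z ^ (l+1) - z ^ j‖ ≤ ((l : ℝ) + 2) * ‖1 - z‖ := by
    intro j hj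
    refine (pow_diff z hz (l+1) j (by simp at hj; omega)).trans ?_
    gcongr
    push_cast
    have : (0:ℝ) ≤ j := by positivity
    linarith
  refine (sum_le_sum this).trans ?_
  simp
  apply le_of_eq; ring

lemma ca_term (z : ℂ) (hz : ‖z‖ = 1) (l : ℕ) :
    (‖ca z (l+1)‖ + ‖ca z l‖) * ‖ca z (l+1) - ca z l‖ ≤
      20 * ((1 + l * ‖1 - z‖)⁻¹ - (1 + ((l+1 : ℕ) : ℝ) * ‖1 - z‖)⁻¹) := by
  set δ := ‖1 - z‖ with hδ
  have hδ0 : 0 ≤ δ := norm_nonneg _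
  have hl : (0:ℝ) ≤ l := by positivity
  set s := ‖ca z (l+1)‖ + ‖ca z l‖
  set d := ‖ca z (l+1) - ca z l‖
  have hd0 : 0 ≤ d := norm_nonneg _
  have hs0 : 0 ≤ s := by positivity
  have hs1 : s ≤ 2 := by have := ca_le_one z hz l; have := ca_le_one z hz (l+1); simp only [s]; linarith
  have hs2 : ((l : ℝ) + 1) * δ * s ≤ 4 := by
    have a1 := ca_decay z hz l
    have a2 := ca_decay z hz (l+1)
    push_cast at a2
    rw [← hδ] at a1 a2
    have : 0 ≤ δ * ‖ca z (l+1)‖ := by positivity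
    simp only [s]; nlinarith
  have hd1 : ((l : ℝ) + 2) * d ≤ 2 := ca_diff1 z hz l
  have hd2 : d ≤ δ := ca_diff2 z hz l
  have e : (1 + l * δ)⁻¹ - (1 + ((l+1 : ℕ) : ℝ) * δ)⁻¹ = δ / ((1 + l * δ) * (1 + (l+1) * δ)) := by
    push_cast
    field_simp
    ring
  rw [e, ← mul_div_assoc, le_div_iff₀ (by positivity)]
  have q1 : s * d ≤ 2 * δ := by nlinarith
  have q2 : (((l : ℝ) + 1) * δ * s) * (((l : ℝ) + 2) * d) ≤ 4 * 2 := by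
    apply mul_le_mul hs2 hd1 (by positivity) (by norm_num)
  have q3 : (1 + l * δ) * (1 + (l+1) * δ) ≤ 2 + 2 * ((l+1)*δ) * ((l+1) * δ) := by
    have : 0 ≤ l * δ := by positivity
    nlinarith [sq_nonneg ((l+1)*δ - 1)]
  have q4 : ((l+1)*δ) * ((l+1) * δ) * (s * d) ≤ 8 * δ := by
    have : ((l+1)*δ) * ((l+1) * δ) * (s * d) ≤ δ * ((((l : ℝ) + 1) * δ * s) * (((l : ℝ) + 2) * d)) := by
      have : 0 ≤ δ * ((l : ℝ) + 1) * δ * s * d := by positivity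
      nlinarith
    nlinarith
  calc s * d * ((1 + l * δ) * (1 + (l+1) * δ)) ≤ s * d * (2 + 2 * ((l+1)*δ) * ((l+1) * δ)) := by gcongr
    _ = 2 * (s * d) + 2 * (((l+1)*δ) * ((l+1) * δ) * (s * d)) := by ring
    _ ≤ 20 * δ := by linarith

lemma ca_jump (z : ℂ) (hz : ‖z‖ = 1) (n : ℕ → ℕ) (hn : Monotone n) (N : ℕ) :
    ∑ i ∈ range N, ‖ca z (n i) - ca z (n (i+1))‖ ^ 2 ≤ 40 := by
  refine (jump_sq (ca z) n hn N).trans ?_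
  have : ∑ l ∈ range (n N), (‖ca z (l+1)‖ + ‖ca z l‖) * ‖ca z (l+1) - ca z l‖ ≤ 20 := by
    refine (sum_le_sum fun l _ => ca_term z hz l).trans ?_
    rw [← mul_sum, sum_range_sub' (fun l : ℕ => (1 + (l:ℝ) * ‖1 - z‖)⁻¹)]
    have : 0 ≤ (1 + ((n N : ℕ):ℝ) * ‖1 - z‖)⁻¹ := by positivity
    simp only [Nat.cast_zero, zero_mul, add_zero, inv_one]
    linarith
  linarith

end QME


namespace QME

noncomputable def V (n : ℕ → ℕ) (N : ℕ) (g : ℤ → ℂ) (k : ℤ) : EuclideanSpace ℂ (Fin N) :=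
  WithLp.toLp 2 (fun i : Fin N => av (n i) g k - av (n (i+1)) g k)

lemma V_norm_sq (n : ℕ → ℕ) (N : ℕ) (g : ℤ → ℂ) (k : ℤ) :
    ‖V n N g k‖ ^ 2 = ∑ i ∈ range N, ‖av (n i) g k - av (n (i+1)) g k‖ ^ 2 := by
  rw [EuclideanSpace.norm_sq_eq, Finset.sum_range]
  rfl

lemma av_add (n : ℕ) (f g : ℤ → ℂ) (k : ℤ) : av n (f + g) k = av n f k + av n g k := by
  simp [av, sum_add_distrib, mul_add]

lemma V_add (n : ℕ → ℕ) (N : ℕ) (f g : ℤ → ℂ) (k : ℤ) :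
    V n N (f + g) k = V n N f k + V n N g k := by
  ext i
  simp [V, av_add]
  ring

abbrev 𝕋 := AddCircle (1:ℝ)

noncomputable def coefL (k : ℤ) : C(𝕋, ℂ) →ₗ[ℂ] ℂ where
  toFun f := fourierCoeff (f : 𝕋 → ℂ) k
  map_add' f g := by
    have hi (f : C(𝕋, ℂ)) : Integrable (f : 𝕋 → ℂ) AddCircle.haarAddCircle :=
      f.continuous.integrable_of_hasCompactSupport (HasCompactSupport.of_compactSpace f)
    have := fourierCoeff.add (hi f) (hi g)
    exact congrFun this k
  map_smul' c f := by
    have := fourierCoeff.const_smul (f : 𝕋 → ℂ) c k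
    exact this

lemma coefL_fourier (k l : ℤ) : coefL k (fourier l) = if k = l then 1 else 0 := by
  show fourierCoeff (fourier l : 𝕋 → ℂ) k = _
  rw [fourierCoeff_fourier, Pi.single_apply]

noncomputable def Phi (W : Finset ℤ) (g : ℤ → ℂ) : C(𝕋, ℂ) := ∑ l ∈ W, g l • fourier l

noncomputable def aM (m : ℕ) : C(𝕋, ℂ) :=
  ((m : ℂ) + 1)⁻¹ • ∑ j ∈ range (m+1), fourier (-(j:ℤ))

lemma coef_Phi (W : Finset ℤ) (g : ℤ → ℂ) (hW : ∀ k ∉ W, g k = 0) (k : ℤ) :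
    coefL k (Phi W g) = g k := by
  simp only [Phi, map_sum, map_smul, coefL_fourier, smul_eq_mul, mul_ite, mul_one, mul_zero]
  rw [Finset.sum_ite_eq]
  split_ifs with h
  · rfl
  · exact (hW k h).symm

lemma coef_aM_Phi (W : Finset ℤ) (g : ℤ → ℂ) (hW : ∀ k ∉ W, g k = 0) (m : ℕ) (k : ℤ) :
    coefL k (aM m * Phi W g) = av m g k := by
  have h1 : aM m * Phi W g = ((m : ℂ) + 1)⁻¹ • ∑ j ∈ range (m+1), ∑ l ∈ W,
      g l • fourier (-(j:ℤ) + l) := by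
    unfold aM Phi
    rw [smul_mul_assoc, sum_mul_sum]
    congr 1
    refine sum_congr rfl fun j _ => sum_congr rfl fun l _ => ?_
    rw [mul_smul_comm]
    congr 1
    ext x
    rw [ContinuousMap.mul_apply, fourier_add]
  rw [h1, map_smul, map_sum, av, smul_eq_mul]
  congr 1
  refine sum_congr rfl fun j _ => ?_
  simp only [map_sum, map_smul, coefL_fourier, smul_eq_mul, mul_ite, mul_one, mul_zero]
  have : ∀ l : ℤ, (k = -(j:ℤ) + l) ↔ (k + j = l) := fun l => by constructor <;> intro h <;> omega
  simp only [this]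
  rw [Finset.sum_ite_eq]
  split_ifs with h
  · rfl
  · exact (hW _ h).symm

lemma parseval (f : C(𝕋, ℂ)) :
    HasSum (fun k => ‖coefL k f‖ ^ 2) (∫ t, ‖f t‖ ^ 2 ∂(AddCircle.haarAddCircle : Measure 𝕋)) := by
  have h := hasSum_sq_fourierCoeff (ContinuousMap.toLp (E := ℂ) 2 (AddCircle.haarAddCircle (T := 1)) ℂ f)
  simp_rw [fourierCoeff_toLp] at h
  suffices e : ∫ t, ‖f t‖ ^ 2 ∂(AddCircle.haarAddCircle : Measure 𝕋) =
      ∫ t, ‖(ContinuousMap.toLp (E := ℂ) 2 (AddCircle.haarAddCircle (T := 1)) ℂ f) t‖ ^ 2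
        ∂(AddCircle.haarAddCircle : Measure 𝕋) by
    rw [e]; exact h
  refine integral_congr_ae ?_
  filter_upwards [ContinuousMap.coeFn_toLp (p := 2) (𝕜 := ℂ) (AddCircle.haarAddCircle (T := 1)) f] with t ht
  rw [ht]

lemma aM_apply (m : ℕ) (t : 𝕋) : aM m t = ca (fourier (-1) t) m := by
  unfold aM ca
  simp only [ContinuousMap.smul_apply, ContinuousMap.sum_apply, smul_eq_mul]
  congr 1
  refine sum_congr rfl fun j hj => ?_
  clear hj
  induction j with
  | zero => simp
  | succ j ih =>
    rw [pow_succ, ← ih, ← fourier_add]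
    congr 2
    push_cast; ring

lemma L2_bound (n : ℕ → ℕ) (hn : Monotone n) (N : ℕ) (g : ℤ → ℂ) (W : Finset ℤ)
    (hW : ∀ k ∉ W, g k = 0) (K : Finset ℤ) :
    ∑ k ∈ K, ‖V n N g k‖ ^ 2 ≤ 40 * ∑ k ∈ W, ‖g k‖ ^ 2 := by
  set F := Phi W g
  have hint (f : C(𝕋, ℂ)) : Integrable (fun t => ‖f t‖ ^ 2) (AddCircle.haarAddCircle : Measure 𝕋) := by
    have : Continuous (fun t => ‖f t‖ ^ 2) := by fun_prop
    exact this.integrable_of_hasCompactSupport (HasCompactSupport.of_compactSpace _)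
  have hg : ∑ k ∈ W, ‖g k‖ ^ 2 = ∫ t, ‖F t‖ ^ 2 ∂(AddCircle.haarAddCircle : Measure 𝕋) := by
    have := parseval F
    simp_rw [F, coef_Phi W g hW] at this
    refine HasSum.unique ?_ this
    apply hasSum_sum_of_ne_finset_zero
    intro k hk
    simp [hW k hk]
  simp_rw [V_norm_sq]
  rw [sum_comm, hg]
  calc ∑ i ∈ range N, ∑ k ∈ K, ‖av (n i) g k - av (n (i+1)) g k‖ ^ 2
      ≤ ∑ i ∈ range N, ∫ t, ‖((aM (n i) - aM (n (i+1))) * F) t‖ ^ 2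
          ∂(AddCircle.haarAddCircle : Measure 𝕋) := by
        refine sum_le_sum fun i _ => ?_
        have := parseval ((aM (n i) - aM (n (i+1))) * F)
        refine le_trans (le_of_eq ?_) (sum_le_hasSum K (fun _ _ => by positivity) this)
        refine sum_congr rfl fun k _ => ?_
        rw [sub_mul, map_sub, coef_aM_Phi W g hW, coef_aM_Phi W g hW]
    _ = ∫ t, ∑ i ∈ range N, ‖((aM (n i) - aM (n (i+1))) * F) t‖ ^ 2
          ∂(AddCircle.haarAddCircle : Measure 𝕋) := by
        rw [integral_finsetSum]
        intro i _
        exact hint _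
    _ ≤ ∫ t, 40 * ‖F t‖ ^ 2 ∂(AddCircle.haarAddCircle : Measure 𝕋) := by
        refine integral_mono (integrable_finsetSum _ fun i _ => hint _) ((hint F).const_mul 40) ?_
        intro t
        simp only [ContinuousMap.mul_apply, ContinuousMap.sub_apply, norm_mul, mul_pow, aM_apply]
        rw [← sum_mul]
        gcongr
        refine ca_jump _ ?_ n hn N
        rw [fourier_apply]; exact Circle.norm_coe _
    _ = _ := by rw [integral_const_mul]

end QME


namespace QME

/-- dyadic interval -/
noncomputable def D (Q : ℕ × ℤ) : Finset ℤ := Finset.Ico (Q.2 * 2 ^ Q.1) ((Q.2 + 1) * 2 ^ Q.1)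

/-- left-enlarged dyadic interval -/
noncomputable def Ds (Q : ℕ × ℤ) : Finset ℤ := Finset.Ico ((Q.2 - 1) * 2 ^ Q.1) ((Q.2 + 1) * 2 ^ Q.1)

def par (Q : ℕ × ℤ) : ℕ × ℤ := (Q.1 + 1, Q.2 / 2)

lemma mem_D (Q : ℕ × ℤ) (k : ℤ) : k ∈ D Q ↔ k / 2 ^ Q.1 = Q.2 := by
  have h : (0:ℤ) < 2 ^ Q.1 := by positivity
  rw [D, Finset.mem_Ico]
  constructor
  · rintro ⟨h1, h2⟩
    apply le_antisymm
    · exact Int.lt_add_one_iff.mp ((Int.ediv_lt_iff_lt_mul h).mpr h2)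
    · exact (Int.le_ediv_iff_mul_le h).mpr h1
  · intro e
    constructor
    · exact (Int.le_ediv_iff_mul_le h).mp e.ge
    · exact (Int.ediv_lt_iff_lt_mul h).mp (by omega)

lemma mem_D' (Q : ℕ × ℤ) (k : ℤ) : k ∈ D Q ↔ Q.2 * 2 ^ Q.1 ≤ k ∧ k < Q.2 * 2 ^ Q.1 + 2 ^ Q.1 := by
  rw [D, Finset.mem_Ico, add_mul, one_mul]

lemma mem_Ds (Q : ℕ × ℤ) (k : ℤ) :
    k ∈ Ds Q ↔ Q.2 * 2 ^ Q.1 - 2 ^ Q.1 ≤ k ∧ k < Q.2 * 2 ^ Q.1 + 2 ^ Q.1 := by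
  rw [Ds, Finset.mem_Ico, add_mul, sub_mul, one_mul]

lemma card_D (Q : ℕ × ℤ) : (D Q).card = 2 ^ Q.1 := by
  rw [D, Int.card_Ico, add_mul, one_mul, add_sub_cancel_left]
  have : ((2:ℤ) ^ Q.1) = ((2 ^ Q.1 : ℕ) : ℤ) := by push_cast; rfl
  rw [this, Int.toNat_natCast]

lemma card_Ds (Q : ℕ × ℤ) : (Ds Q).card = 2 * 2 ^ Q.1 := by
  rw [Ds, Int.card_Ico]
  have : ((Q.2 + 1) * (2:ℤ) ^ Q.1 - (Q.2 - 1) * 2 ^ Q.1) = ((2 * 2 ^ Q.1 : ℕ) : ℤ) := by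
    push_cast; ring
  rw [this, Int.toNat_natCast]

lemma D_nested {Q Q' : ℕ × ℤ} (h : Q.1 ≤ Q'.1) {k : ℤ} (hk : k ∈ D Q) (hk' : k ∈ D Q') :
    D Q ⊆ D Q' := by
  intro l hl
  rw [mem_D] at *
  obtain ⟨d, hd⟩ := Nat.exists_eq_add_of_le h
  rw [hd, pow_add, ← Int.ediv_ediv_of_nonneg (by positivity)] at hk' ⊢
  rw [hl, ← hk, hk']

lemma D_par (Q : ℕ × ℤ) : D Q ⊆ D (par Q) := by
  intro l hl
  rw [mem_D] at *
  simp only [par]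
  rw [pow_succ, ← Int.ediv_ediv_of_nonneg (by positivity), hl]

lemma D_nonempty (Q : ℕ × ℤ) : (D Q).Nonempty := by
  rw [← Finset.card_pos, card_D]; positivity

lemma D_inj_of_fst {Q Q' : ℕ × ℤ} (h : Q.1 = Q'.1) {k : ℤ} (hk : k ∈ D Q) (hk' : k ∈ D Q') :
    Q = Q' := by
  rw [mem_D] at *
  refine Prod.ext h ?_
  rw [← hk, ← hk', h]

lemma cz (f : ℤ → ℝ) (W : Finset ℤ) (hf : ∀ k, 0 ≤ f k) (hW : ∀ k ∉ W, f k = 0)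
    (t : ℝ) (ht : 0 < t) :
    ∃ 𝒬 : Finset (ℕ × ℤ),
      (∀ Q ∈ 𝒬, ∀ Q' ∈ 𝒬, ∀ k, k ∈ D Q → k ∈ D Q' → Q = Q') ∧
      (∀ Q ∈ 𝒬, t * 2 ^ Q.1 < ∑ k ∈ D Q, f k) ∧
      (∀ Q ∈ 𝒬, ∑ k ∈ D (par Q), f k ≤ t * 2 ^ (Q.1 + 1)) ∧
      (∀ Q, t * 2 ^ Q.1 < ∑ k ∈ D Q, f k → ∃ Q' ∈ 𝒬, D Q ⊆ D Q') := by
  classical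
  have hsum : ∀ A : Finset ℤ, ∑ k ∈ A, f k ≤ ∑ k ∈ W, f k := by
    intro A
    rw [← Finset.sum_filter_add_sum_filter_not A (· ∈ W)]
    have : ∑ x ∈ A with x ∉ W, f x = 0 := sum_eq_zero fun k hk => hW k (by simp at hk; exact hk.2)
    rw [this, add_zero]
    refine sum_le_sum_of_subset_of_nonneg ?_ (fun k _ _ => hf k)
    intro k hk; simp at hk; exact hk.2
  set P : ℕ × ℤ → Prop := fun Q => t * 2 ^ Q.1 < ∑ k ∈ D Q, f k
  have hfin : {Q | P Q}.Finite := by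
    obtain ⟨M, hM⟩ := exists_nat_gt ((∑ k ∈ W, f k) / t)
    refine Set.Finite.subset (((range M ×ˢ W).image fun x => (x.1, x.2 / 2 ^ x.1)).finite_toSet) ?_
    intro Q hQ
    have hQ' : t * 2 ^ Q.1 < ∑ k ∈ D Q, f k := hQ
    simp only [coe_image, Set.mem_image, mem_coe, mem_product, mem_range, Prod.exists]
    have : ∃ k ∈ D Q, k ∈ W := by
      by_contra hc
      push Not at hc
      have : ∑ k ∈ D Q, f k = 0 := sum_eq_zero fun k hk => hW k (hc k hk)
      have h2 : 0 < t * 2 ^ Q.1 := by positivity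
      linarith
    obtain ⟨k, hk, hkW⟩ := this
    refine ⟨Q.1, k, ⟨?_, hkW⟩, ?_⟩
    · have h1 := hQ'.trans_le (hsum _)
      rw [div_lt_iff₀ ht] at hM
      have h3 : (Q.1 : ℝ) < 2 ^ Q.1 := by exact_mod_cast Nat.lt_two_pow_self
      have : (Q.1 : ℝ) < M := by nlinarith
      exact_mod_cast this
    · rw [mem_D] at hk
      rw [hk]
  set F := hfin.toFinset
  have hF : ∀ Q, Q ∈ F ↔ P Q := fun Q => by simp [F]
  refine ⟨F.filter (fun Q => ∀ Q' ∈ F, D Q ⊆ D Q' → Q' = Q), ?_, ?_, ?_, ?_⟩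
  · intro Q hQ Q' hQ' k hk hk'
    rw [mem_filter] at hQ hQ'
    rcases le_total Q.1 Q'.1 with h | h
    · exact (hQ.2 Q' hQ'.1 (D_nested h hk hk')).symm
    · exact (hQ'.2 Q hQ.1 (D_nested h hk' hk))
  · intro Q hQ
    rw [mem_filter] at hQ
    exact (hF Q).1 hQ.1
  · intro Q hQ
    rw [mem_filter] at hQ
    by_contra hc
    push Not at hc
    have := hQ.2 (par Q) ((hF _).2 hc) (D_par Q)
    have := congrArg Prod.fst this
    simp [par] at this
  · intro Q hQ
    obtain ⟨Q', hQ', hmax⟩ := Finset.exists_max_image (F.filter (fun Q' => D Q ⊆ D Q')) (fun Q => Q.1)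
      ⟨Q, by rw [mem_filter]; exact ⟨(hF Q).2 hQ, subset_rfl⟩⟩
    rw [mem_filter] at hQ'
    refine ⟨Q', ?_, hQ'.2⟩
    rw [mem_filter]
    refine ⟨hQ'.1, fun Q'' h1 h2 => ?_⟩
    have h3 := hmax Q'' (by rw [mem_filter]; exact ⟨h1, hQ'.2.trans h2⟩)
    obtain ⟨k, hk⟩ := D_nonempty Q'
    have hk2 := h2 hk
    have hsub := D_nested h3 hk2 hk
    have hc : (D Q').card = (D Q'').card := by rw [subset_antisymm h2 hsub]
    rw [card_D, card_D] at hc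
    have := Nat.pow_right_injective (le_refl 2) hc
    exact D_inj_of_fst this.symm hk2 hk

lemma sum_le_of_supp (f : ℤ → ℝ) (W : Finset ℤ) (hf : ∀ k, 0 ≤ f k) (hW : ∀ k ∉ W, f k = 0)
    (A : Finset ℤ) : ∑ k ∈ A, f k ≤ ∑ k ∈ W, f k := by
  classical
  rw [← Finset.sum_filter_add_sum_filter_not A (· ∈ W)]
  have : ∑ x ∈ A with x ∉ W, f x = 0 := sum_eq_zero fun k hk => hW k (by simp at hk; exact hk.2)
  rw [this, add_zero]
  refine sum_le_sum_of_subset_of_nonneg ?_ (fun k _ _ => hf k)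
  intro k hk; simp at hk; exact hk.2

lemma sum_disj (f : ℤ → ℝ) (W : Finset ℤ) (hf : ∀ k, 0 ≤ f k) (hW : ∀ k ∉ W, f k = 0)
    (𝒬 : Finset (ℕ × ℤ)) (hd : ∀ Q ∈ 𝒬, ∀ Q' ∈ 𝒬, ∀ k, k ∈ D Q → k ∈ D Q' → Q = Q') :
    ∑ Q ∈ 𝒬, ∑ k ∈ D Q, f k ≤ ∑ k ∈ W, f k := by
  classical
  rw [← sum_biUnion]
  · exact sum_le_of_supp f W hf hW _
  · intro Q hQ Q' hQ' hne
    rw [Function.onFun, Finset.disjoint_left]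
    intro k hk hk'
    exact hne (hd Q hQ Q' hQ' k hk hk')

lemma sum_card (f : ℤ → ℝ) (W : Finset ℤ) (hf : ∀ k, 0 ≤ f k) (hW : ∀ k ∉ W, f k = 0)
    (𝒬 : Finset (ℕ × ℤ)) (hd : ∀ Q ∈ 𝒬, ∀ Q' ∈ 𝒬, ∀ k, k ∈ D Q → k ∈ D Q' → Q = Q')
    (t : ℝ) (h : ∀ Q ∈ 𝒬, t * 2 ^ Q.1 < ∑ k ∈ D Q, f k) :
    t * ∑ Q ∈ 𝒬, (2:ℝ) ^ Q.1 ≤ ∑ k ∈ W, f k := by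
  rw [mul_sum]
  exact (sum_le_sum fun Q hQ => (h Q hQ).le).trans (sum_disj f W hf hW 𝒬 hd)

/-- the bad set of the maximal function -/
def Bd (f : ℤ → ℝ) (t : ℝ) : Set ℤ :=
  {k | ∃ m : ℕ, t * 2 ^ m < ∑ l ∈ D (m, k / 2 ^ m), f l + ∑ l ∈ D (m, k / 2 ^ m + 1), f l}

lemma card_union_Ds (𝒬 : Finset (ℕ × ℤ)) (A : Finset ℤ) (hA : ∀ k ∈ A, ∃ Q ∈ 𝒬, k ∈ Ds Q) :
    (A.card : ℝ) ≤ 2 * ∑ Q ∈ 𝒬, (2:ℝ) ^ Q.1 := by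
  classical
  have h1 : A ⊆ 𝒬.biUnion Ds := fun k hk => by rw [mem_biUnion]; exact hA k hk
  have h2 := (card_le_card h1).trans card_biUnion_le
  simp_rw [card_Ds] at h2
  rw [mul_sum]
  exact_mod_cast h2

open Classical in
lemma Bd_card (f : ℤ → ℝ) (W : Finset ℤ) (hf : ∀ k, 0 ≤ f k) (hW : ∀ k ∉ W, f k = 0)
    (t : ℝ) (ht : 0 < t) (K : Finset ℤ) :
    t * ((K.filter (· ∈ Bd f t)).card : ℝ) ≤ 4 * ∑ k ∈ W, f k := by
  obtain ⟨𝒬, hd, h1, -, h3⟩ := cz f W hf hW (t/2) (by positivity)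
  have hs := sum_card f W hf hW 𝒬 hd _ h1
  have := card_union_Ds 𝒬 (K.filter (· ∈ Bd f t)) ?_
  · nlinarith
  intro k hk
  rw [mem_filter] at hk
  obtain ⟨m, hm⟩ := hk.2
  have hkD : k ∈ D (m, k / 2 ^ m) := by rw [mem_D]
  by_cases hc : t / 2 * 2 ^ m < ∑ l ∈ D (m, k / 2 ^ m), f l
  · obtain ⟨Q, hQ, hsub⟩ := h3 (m, k / 2 ^ m) hc
    refine ⟨Q, hQ, ?_⟩
    have := hsub hkD
    rw [mem_D'] at this
    rw [mem_Ds]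
    have : (0:ℤ) < 2 ^ Q.1 := by positivity
    omega
  · have hc' : t / 2 * 2 ^ m < ∑ l ∈ D (m, k / 2 ^ m + 1), f l := by linarith
    obtain ⟨Q, hQ, hsub⟩ := h3 (m, k / 2 ^ m + 1) hc'
    refine ⟨Q, hQ, ?_⟩
    have hcard := card_le_card hsub
    rw [card_D, card_D] at hcard
    simp only at hcard
    have h5 : ((2:ℤ) ^ m) ≤ 2 ^ Q.1 := by exact_mod_cast hcard
    have h6 : k + 2 ^ m ∈ D (m, k / 2 ^ m + 1) := by
      rw [mem_D]
      simp only
      rw [Int.add_ediv_of_dvd_right (dvd_refl _), Int.ediv_self (by positivity)]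
    have := hsub h6
    rw [mem_D'] at this
    rw [mem_Ds]
    have : (0:ℤ) < 2 ^ m := by positivity
    omega

end QME


namespace QME

lemma av_step (f : ℤ → ℂ) (k : ℤ) (l : ℕ) :
    av (l+1) f k - av l f k = (((l+1 : ℕ) : ℂ) + 1)⁻¹ * (f (k + (l+1 : ℕ)) - av l f k) := by
  have := avg_step (fun n => ∑ j ∈ range (n + 1), f (k + j)) l
  unfold av
  rw [this, sum_range_succ _ (l+1)]
  ring

lemma sum_shift_le (f : ℤ → ℂ) (W : Finset ℤ) (hW : ∀ k ∉ W, f k = 0) (k : ℤ) (A : Finset ℕ) :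
    ∑ l ∈ A, ‖f (k + l)‖ ≤ ∑ k ∈ W, ‖f k‖ := by
  have := sum_le_of_supp (fun k => ‖f k‖) W (fun _ => norm_nonneg _) (fun k hk => by simp [hW k hk])
    (A.map ⟨fun l : ℕ => k + (l:ℤ), fun a b h => by simpa using h⟩)
  rw [sum_map] at this
  exact this

lemma var_bound (f : ℤ → ℂ) (W : Finset ℤ) (hW : ∀ k ∉ W, f k = 0) (k : ℤ) (d : ℕ) (hd : 0 < d)
    (hf : ∀ l : ℤ, l < k + d → f l = 0) (M : ℕ) :
    ∑ l ∈ range M, ‖av (l+1) f k - av l f k‖ ≤ 2 * (∑ k ∈ W, ‖f k‖) / d := by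
  set β := ∑ k ∈ W, ‖f k‖
  have hβ : 0 ≤ β := sum_nonneg fun _ _ => norm_nonneg _
  have hd' : (0:ℝ) < d := by exact_mod_cast hd
  set ψ : ℕ → ℝ := fun l => (max ((l:ℝ)+1) d)⁻¹ with hψ
  have hav : ∀ l, ‖av l f k‖ ≤ ((l:ℝ)+1)⁻¹ * β := by
    intro l
    unfold av
    rw [norm_mul, norm_inv_succ]
    gcongr
    exact (norm_sum_le _ _).trans (sum_shift_le f W hW k _)
  have key : ∀ l ∈ range M, ‖av (l+1) f k - av l f k‖ ≤
      ‖f (k + (l+1 : ℕ))‖ / d + β * (ψ l - ψ (l+1)) := by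
    intro l _
    rw [av_step, norm_mul, norm_inv_succ]
    by_cases hl : l + 1 < d
    · have h1 : f (k + (l+1 : ℕ)) = 0 := hf _ (by omega)
      have h2 : av l f k = 0 := by
        unfold av
        rw [sum_eq_zero, mul_zero]
        intro j hj
        rw [mem_range] at hj
        exact hf _ (by omega)
      have h3 : ψ l - ψ (l+1) = 0 := by
        have : ((l+1:ℕ):ℝ) + 1 ≤ d := by exact_mod_cast hl
        simp only [ψ]
        rw [max_eq_right this, max_eq_right (by push_cast at this; linarith), sub_self]
      rw [h1, h2, h3]; simp
    · push Not at hl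
      have hl' : (d:ℝ) ≤ (l:ℝ) + 1 := by exact_mod_cast hl
      have h3 : ψ l - ψ (l+1) = ((l:ℝ)+1)⁻¹ - (((l+1:ℕ):ℝ)+1)⁻¹ := by
        simp only [ψ]
        rw [max_eq_left hl', max_eq_left (by push_cast; linarith)]
      rw [h3]
      have h4 : ‖f (k + (l+1 : ℕ)) - av l f k‖ ≤ ‖f (k + (l+1 : ℕ))‖ + ((l:ℝ)+1)⁻¹ * β :=
        (norm_sub_le _ _).trans (by gcongr; exact hav l)
      calc (((l+1:ℕ):ℝ)+1)⁻¹ * ‖f (k + (l+1 : ℕ)) - av l f k‖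
          ≤ (((l+1:ℕ):ℝ)+1)⁻¹ * (‖f (k + (l+1 : ℕ))‖ + ((l:ℝ)+1)⁻¹ * β) := by gcongr
        _ = (((l+1:ℕ):ℝ)+1)⁻¹ * ‖f (k + (l+1 : ℕ))‖ + β * ((((l+1:ℕ):ℝ)+1)⁻¹ * ((l:ℝ)+1)⁻¹) := by ring
        _ ≤ ‖f (k + (l+1 : ℕ))‖ / d + β * (((l:ℝ)+1)⁻¹ - (((l+1:ℕ):ℝ)+1)⁻¹) := by
          gcongr
          · rw [div_eq_inv_mul]
            gcongr
            push_cast; linarith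
          · apply le_of_eq
            push_cast
            field_simp
            ring
  refine (sum_le_sum key).trans ?_
  rw [sum_add_distrib, ← sum_div, ← mul_sum, sum_range_sub' ψ]
  have h1 : ∑ i ∈ range M, ‖f (k + (i+1 : ℕ))‖ ≤ β := by
    have := sum_shift_le f W hW (k+1) (range M)
    refine le_trans (le_of_eq ?_) this
    refine sum_congr rfl fun i _ => ?_
    congr 2; push_cast; ring
  have h2 : ψ 0 - ψ M ≤ 1 / d := by
    have : 0 ≤ ψ M := by positivity
    have : ψ 0 ≤ 1 / d := by
      simp only [ψ]
      rw [one_div]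
      gcongr
      exact le_max_right _ _
    linarith
  calc _ ≤ β / d + β * (1 / d) := by gcongr
    _ = 2 * β / d := by ring

lemma V_var (n : ℕ → ℕ) (hn : Monotone n) (N : ℕ) (f : ℤ → ℂ) (k : ℤ) :
    ‖V n N f k‖ ^ 2 ≤ (∑ l ∈ range (n N), ‖av (l+1) f k - av l f k‖) ^ 2 := by
  rw [V_norm_sq]
  refine (sum_sq_le_sq_sum_of_nonneg (fun i _ => norm_nonneg _)).trans ?_
  have h0 : 0 ≤ ∑ i ∈ range N, ‖av (n i) f k - av (n (i+1)) f k‖ :=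
    sum_nonneg fun _ _ => norm_nonneg _
  have := telescope_var (fun l => av l f k) n hn N
  gcongr

lemma V_far (n : ℕ → ℕ) (hn : Monotone n) (N : ℕ) (f : ℤ → ℂ) (Q : ℕ × ℤ)
    (hf : ∀ k ∉ D Q, f k = 0) (K : Finset ℤ) (hK : ∀ k ∈ K, k ∉ Ds Q) :
    ∑ k ∈ K, ‖V n N f k‖ ^ 2 ≤ 4 * (∑ k ∈ D Q, ‖f k‖) ^ 2 / 2 ^ Q.1 := by
  classical
  set β := ∑ k ∈ D Q, ‖f k‖
  set a : ℤ := Q.2 * 2 ^ Q.1 with ha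
  have hL : (0:ℤ) < 2 ^ Q.1 := by positivity
  set w : ℤ → ℝ := fun k => if k < a then 4 * β ^ 2 * ((((a - k).toNat : ℕ) : ℝ) ^ 2)⁻¹ else 0
  have h1 : ∀ k ∈ K, ‖V n N f k‖ ^ 2 ≤ w k := by
    intro k hk
    have hk' := hK k hk
    rw [mem_Ds] at hk'
    refine (V_var n hn N f k).trans ?_
    simp only [w]
    split_ifs with hka
    · have := var_bound f (D Q) hf k (a - k).toNat (by omega) (by
        intro l hl
        apply hf
        rw [mem_D']
        omega) (n N)
      have h0 : 0 ≤ ∑ l ∈ range (n N), ‖av (l+1) f k - av l f k‖ :=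
        sum_nonneg fun _ _ => norm_nonneg _
      calc _ ≤ (2 * β / ((a-k).toNat : ℝ)) ^ 2 := by gcongr
        _ = _ := by rw [div_pow]; ring
    · have hz : ∀ l, av l f k = 0 := by
        intro l
        unfold av
        rw [sum_eq_zero, mul_zero]
        intro j _
        apply hf
        rw [mem_D']
        omega
      simp [hz]
  refine (sum_le_sum h1).trans ?_
  rw [← sum_filter, ← mul_sum, mul_div_assoc]
  rw [div_eq_mul_inv, ← mul_assoc]
  gcongr
  set S := K.filter (· < a)
  have hinj : Set.InjOn (fun k : ℤ => (a - k).toNat) S := by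
    intro x hx y hy h
    simp only [S, coe_filter, Set.mem_ofPred_eq] at hx hy
    simp only at h
    omega
  rw [← sum_image (f := fun d : ℕ => ((d : ℝ) ^ 2)⁻¹) hinj]
  set T := S.image (fun k : ℤ => (a - k).toNat)
  have hT : ∀ d ∈ T, 2 ^ Q.1 < d := by
    intro d hd
    simp only [T, S, mem_image, mem_filter] at hd
    obtain ⟨k, ⟨hk, hka⟩, rfl⟩ := hd
    have := hK k hk
    rw [mem_Ds] at this
    have e : ((2 ^ Q.1 : ℕ) : ℤ) = 2 ^ Q.1 := by push_cast; rfl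
    zify
    rw [Int.toNat_of_nonneg (by omega)]
    omega
  set M := max (2 ^ Q.1) (T.sup id)
  have hsub : T ⊆ Finset.Ioc (2 ^ Q.1) M := by
    intro d hd
    rw [Finset.mem_Ioc]
    exact ⟨hT d hd, le_max_of_le_right (Finset.le_sup (f := id) hd)⟩
  refine (sum_le_sum_of_subset_of_nonneg hsub (fun _ _ _ => by positivity)).trans ?_
  have := sum_Ioc_inv_sq_le_sub (α := ℝ) (k := 2 ^ Q.1) (n := M) (by positivity) (le_max_left _ _)
  refine this.trans ?_
  push_cast
  have : (0:ℝ) ≤ ((max (2 ^ Q.1) (T.sup id) : ℕ) : ℝ)⁻¹ := by positivity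
  simp only [M]
  push_cast at this ⊢
  linarith

lemma av_sum {ι : Type*} (s : Finset ι) (n : ℕ) (f : ι → ℤ → ℂ) (k : ℤ) :
    av n (fun k => ∑ i ∈ s, f i k) k = ∑ i ∈ s, av n (f i) k := by
  unfold av
  rw [sum_comm, mul_sum]

/-- a function supported on `D Q` of mean zero only sees `k` with endpoint in `D Q`. -/
lemma av_zero (f : ℤ → ℂ) (Q : ℕ × ℤ) (hf : ∀ k ∉ D Q, f k = 0) (h0 : ∑ k ∈ D Q, f k = 0)
    (k : ℤ) (hk : k ∉ Ds Q) (t : ℕ) (ht : k + t ∉ D Q) : av t f k = 0 := by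
  unfold av
  have hL : (0:ℤ) < 2 ^ Q.1 := by positivity
  rw [mem_Ds] at hk
  rw [mem_D'] at ht
  by_cases hc : k < Q.2 * 2 ^ Q.1 ∧ Q.2 * 2 ^ Q.1 + 2 ^ Q.1 ≤ k + t
  · have : ∑ j ∈ range (t+1), f (k + j) = ∑ k ∈ D Q, f k := by
      refine (sum_map (range (t+1)) ⟨fun l : ℕ => k + (l:ℤ), fun a b h => by simpa using h⟩ f).symm.trans ?_
      symm
      apply sum_subset
      · intro l hl
        rw [mem_D'] at hl
        rw [mem_map]
        refine ⟨(l - k).toNat, ?_, ?_⟩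
        · rw [mem_range]; omega
        · show k + (((l - k).toNat : ℕ) : ℤ) = l
          omega
      · intro l _ hl
        exact hf l hl
    rw [this, h0, mul_zero]
  · rw [sum_eq_zero, mul_zero]
    intro j hj
    rw [mem_range] at hj
    apply hf
    rw [mem_D']
    omega

lemma sq_sum_two {ι : Type*} (s : Finset ι) (z : ι → ℂ) (p q : ι → Prop)
    (hp : ∀ i ∈ s, ∀ j ∈ s, p i → p j → i = j) (hq : ∀ i ∈ s, ∀ j ∈ s, q i → q j → i = j)
    (hz : ∀ i ∈ s, ¬ p i → ¬ q i → z i = 0) :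
    ‖∑ i ∈ s, z i‖ ^ 2 ≤ 2 * ∑ i ∈ s, ‖z i‖ ^ 2 := by
  classical
  set s' := s.filter (fun i => p i ∨ q i)
  have e : ∑ i ∈ s, z i = ∑ i ∈ s', z i := by
    symm
    apply sum_subset (filter_subset _ _)
    intro i hi h
    simp only [s', mem_filter, hi, true_and, not_or] at h
    exact hz i hi h.1 h.2
  have hc : (s'.card : ℝ) ≤ 2 := by
    have h1 : (s.filter p).card ≤ 1 := by
      rw [card_le_one]; intro a ha b hb; simp at ha hb; exact hp a ha.1 b hb.1 ha.2 hb.2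
    have h2 : (s.filter q).card ≤ 1 := by
      rw [card_le_one]; intro a ha b hb; simp at ha hb; exact hq a ha.1 b hb.1 ha.2 hb.2
    have : s'.card ≤ 2 := by
      simp only [s']
      rw [filter_or]
      exact (card_union_le _ _).trans (by omega)
    exact_mod_cast this
  rw [e]
  calc ‖∑ i ∈ s', z i‖ ^ 2 ≤ (∑ i ∈ s', ‖z i‖) ^ 2 := by gcongr; exact norm_sum_le _ _
    _ ≤ s'.card * ∑ i ∈ s', ‖z i‖ ^ 2 := sq_sum_le_card_mul_sum_sq
    _ ≤ 2 * ∑ i ∈ s, ‖z i‖ ^ 2 := by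
      gcongr
      exact filter_subset _ _

lemma V_bad (n : ℕ → ℕ) (N : ℕ) (𝒬 : Finset (ℕ × ℤ))
    (hd : ∀ Q ∈ 𝒬, ∀ Q' ∈ 𝒬, ∀ k, k ∈ D Q → k ∈ D Q' → Q = Q')
    (b : ℕ × ℤ → ℤ → ℂ) (hb : ∀ Q ∈ 𝒬, ∀ k ∉ D Q, b Q k = 0)
    (h0 : ∀ Q ∈ 𝒬, ∑ k ∈ D Q, b Q k = 0) (k : ℤ) (hk : ∀ Q ∈ 𝒬, k ∉ Ds Q) :
    ‖V n N (fun k => ∑ Q ∈ 𝒬, b Q k) k‖ ^ 2 ≤ 2 * ∑ Q ∈ 𝒬, ‖V n N (b Q) k‖ ^ 2 := by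
  simp_rw [V_norm_sq]
  rw [sum_comm, mul_sum]
  refine sum_le_sum fun i _ => ?_
  rw [av_sum, av_sum, ← sum_sub_distrib]
  refine sq_sum_two 𝒬 _ (fun Q => k + n i ∈ D Q) (fun Q => k + n (i+1) ∈ D Q) ?_ ?_ ?_
  · intro Q hQ Q' hQ' h1 h2; exact hd Q hQ Q' hQ' _ h1 h2
  · intro Q hQ Q' hQ' h1 h2; exact hd Q hQ Q' hQ' _ h1 h2
  · intro Q hQ h1 h2
    rw [av_zero (b Q) Q (hb Q hQ) (h0 Q hQ) k (hk Q hQ) _ h1,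
      av_zero (b Q) Q (hb Q hQ) (h0 Q hQ) k (hk Q hQ) _ h2, sub_zero]

end QME


namespace QME

open Classical in
lemma chebyshev (F : ℤ → ℝ) (K : Finset ℤ) (t c : ℝ) (ht : 0 < t)
    (h : ∑ k ∈ K, F k ^ 2 ≤ c) :
    t ^ 2 * ((K.filter (fun k => t < F k)).card : ℝ) ≤ c := by
  refine le_trans ?_ h
  have h1 : ∑ k ∈ K.filter (fun k => t < F k), t ^ 2 ≤ ∑ k ∈ K.filter (fun k => t < F k), F k ^ 2 := by
    refine sum_le_sum fun k hk => ?_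
    rw [mem_filter] at hk
    have := hk.2
    gcongr
  rw [sum_const, nsmul_eq_mul, mul_comm] at h1
  exact h1.trans (sum_le_sum_of_subset_of_nonneg (filter_subset _ _) (fun _ _ _ => by positivity))

open Classical in
lemma weak11 (n : ℕ → ℕ) (hn : Monotone n) (N : ℕ) (g : ℤ → ℂ) (W : Finset ℤ)
    (hW : ∀ k ∉ W, g k = 0) (K : Finset ℤ) (t : ℝ) (ht : 0 < t) :
    t * ((K.filter (fun k => t < ‖V n N g k‖)).card : ℝ) ≤ 1000 * ∑ k ∈ W, ‖g k‖ := by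
  set f : ℤ → ℝ := fun k => ‖g k‖ with hfdef
  have hf : ∀ k, 0 ≤ f k := fun k => norm_nonneg _
  have hfW : ∀ k ∉ W, f k = 0 := fun k hk => by simp [f, hW k hk]
  set G := ∑ k ∈ W, ‖g k‖ with hG
  obtain ⟨𝒬, hd, h1, h2, h3⟩ := cz f W hf hfW t ht
  have hcard := sum_card f W hf hfW 𝒬 hd t h1
  have hdisj := sum_disj f W hf hfW 𝒬 hd
  have hσ : ∀ Q ∈ 𝒬, ∑ k ∈ D Q, f k ≤ 2 * t * 2 ^ Q.1 := by
    intro Q hQ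
    refine (sum_le_sum_of_subset_of_nonneg (D_par Q) (fun k _ _ => hf k)).trans ((h2 Q hQ).trans ?_)
    rw [pow_succ]; apply le_of_eq; ring
  set av' : ℕ × ℤ → ℂ := fun Q => ((2:ℂ) ^ Q.1)⁻¹ * ∑ k ∈ D Q, g k with hav
  have hav' : ∀ Q, 2 ^ Q.1 * ‖av' Q‖ ≤ ∑ k ∈ D Q, f k := by
    intro Q
    simp only [av']
    rw [norm_mul, norm_inv, norm_pow, Complex.norm_ofNat, ← mul_assoc,
      mul_inv_cancel₀ (by positivity), one_mul]
    exact norm_sum_le _ _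
  set b : ℕ × ℤ → ℤ → ℂ := fun Q k => if k ∈ D Q then g k - av' Q else 0 with hb
  have hb0 : ∀ Q ∈ 𝒬, ∀ k ∉ D Q, b Q k = 0 := fun Q _ k hk => by simp [b, hk]
  have hbm : ∀ Q ∈ 𝒬, ∑ k ∈ D Q, b Q k = 0 := by
    intro Q _
    have : ∑ k ∈ D Q, b Q k = ∑ k ∈ D Q, (g k - av' Q) :=
      sum_congr rfl fun k hk => by simp [b, hk]
    rw [this, sum_sub_distrib, sum_const, card_D, nsmul_eq_mul]
    simp only [av']
    push_cast
    rw [← mul_assoc, mul_inv_cancel₀ (by positivity), one_mul, sub_self]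
  have hβ : ∀ Q, ∑ k ∈ D Q, ‖b Q k‖ ≤ 2 * ∑ k ∈ D Q, f k := by
    intro Q
    have : ∑ k ∈ D Q, ‖b Q k‖ ≤ ∑ k ∈ D Q, (f k + ‖av' Q‖) :=
      sum_le_sum fun k hk => by simp [b, hk]; exact norm_sub_le _ _
    rw [sum_add_distrib, sum_const, card_D, nsmul_eq_mul] at this
    have h5 := hav' Q
    push_cast at this
    linarith
  set B : ℤ → ℂ := fun k => ∑ Q ∈ 𝒬, b Q k with hB
  set h : ℤ → ℂ := fun k => g k - B k with hh
  have hin : ∀ Q ∈ 𝒬, ∀ k ∈ D Q, h k = av' Q := by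
    intro Q hQ k hk
    have : B k = b Q k := by
      simp only [B]
      apply sum_eq_single_of_mem Q hQ
      intro Q' hQ' hne
      apply hb0 Q' hQ'
      intro hk'
      exact hne (hd Q' hQ' Q hQ k hk' hk)
    simp only [h]
    rw [this]
    simp [b, hk]
  have hout : ∀ k, (∀ Q ∈ 𝒬, k ∉ D Q) → h k = g k := by
    intro k hk
    simp only [h, B]
    rw [sum_eq_zero, sub_zero]
    intro Q hQ
    exact hb0 Q hQ k (hk Q hQ)
  have hhle : ∀ k, ‖h k‖ ≤ 2 * t := by
    intro k
    by_cases hc : ∃ Q ∈ 𝒬, k ∈ D Q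
    · obtain ⟨Q, hQ, hk⟩ := hc
      rw [hin Q hQ k hk]
      have := (hav' Q).trans (hσ Q hQ)
      have h2p : (0:ℝ) < 2 ^ Q.1 := by positivity
      by_contra hcon
      push Not at hcon
      nlinarith
    · push Not at hc
      rw [hout k hc]
      by_contra hcon
      push Not at hcon
      have hk0 : k ∈ D (0, k) := by rw [mem_D]; simp
      have hD0 : D (0, k) = {k} := by
        ext l; rw [mem_D', mem_singleton]; simp; omega
      obtain ⟨Q, hQ, hsub⟩ := h3 (0, k) (by rw [hD0]; simp [f]; linarith)
      exact hc Q hQ (hsub hk0)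
  have hhle2 : ∀ k, ‖h k‖ ≤ ‖g k‖ + ∑ Q ∈ 𝒬, if k ∈ D Q then ‖av' Q‖ else 0 := by
    intro k
    have hnn : ∀ Q ∈ 𝒬, 0 ≤ if k ∈ D Q then ‖av' Q‖ else 0 := by
      intro Q _; split_ifs <;> simp
    by_cases hc : ∃ Q ∈ 𝒬, k ∈ D Q
    · obtain ⟨Q, hQ, hk⟩ := hc
      rw [hin Q hQ k hk]
      have := single_le_sum hnn hQ
      rw [if_pos hk] at this
      have := norm_nonneg (g k)
      linarith
    · push Not at hc
      rw [hout k hc]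
      have := sum_nonneg hnn
      linarith
  set W' := W ∪ 𝒬.biUnion D with hW'
  have hhW : ∀ k ∉ W', h k = 0 := by
    intro k hk
    simp only [W', mem_union, mem_biUnion, not_or, not_exists, not_and] at hk
    rw [hout k hk.2, hW k hk.1]
  have hh1 : ∑ k ∈ W', ‖h k‖ ≤ 2 * G := by
    calc ∑ k ∈ W', ‖h k‖ ≤ ∑ k ∈ W', (‖g k‖ + ∑ Q ∈ 𝒬, if k ∈ D Q then ‖av' Q‖ else 0) :=
          sum_le_sum fun k _ => hhle2 k
      _ = ∑ k ∈ W', ‖g k‖ + ∑ Q ∈ 𝒬, ∑ k ∈ W', if k ∈ D Q then ‖av' Q‖ else 0 := by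
          rw [sum_add_distrib, sum_comm]
      _ ≤ G + ∑ Q ∈ 𝒬, ∑ k ∈ D Q, f k := by
          gcongr with Q hQ
          · exact sum_le_of_supp f W hf hfW W'
          · rw [← sum_filter, sum_const, nsmul_eq_mul]
            refine le_trans ?_ (hav' Q)
            gcongr
            have : (W'.filter (· ∈ D Q)).card ≤ (D Q).card :=
              card_le_card (fun k hk => by rw [mem_filter] at hk; exact hk.2)
            rw [card_D] at this
            exact_mod_cast this
      _ ≤ 2 * G := by linarith
  have hh2 : ∑ k ∈ W', ‖h k‖ ^ 2 ≤ 4 * t * G := by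
    calc ∑ k ∈ W', ‖h k‖ ^ 2 ≤ ∑ k ∈ W', 2 * t * ‖h k‖ := by
          refine sum_le_sum fun k _ => ?_
          rw [sq]
          gcongr
          exact hhle k
      _ = 2 * t * ∑ k ∈ W', ‖h k‖ := by rw [mul_sum]
      _ ≤ 2 * t * (2 * G) := by gcongr
      _ = _ := by ring
  -- good part
  have hgood := chebyshev (fun k => ‖V n N h k‖) K (t/2) _ (by positivity)
    ((L2_bound n hn N h W' hhW K).trans (mul_le_mul_of_nonneg_left hh2 (by norm_num)))
  -- bad part
  set K' := K.filter (fun k => ∀ Q ∈ 𝒬, k ∉ Ds Q) with hK'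
  have hbad0 : ∑ k ∈ K', ‖V n N B k‖ ^ 2 ≤ 64 * t * G := by
    calc ∑ k ∈ K', ‖V n N B k‖ ^ 2 ≤ ∑ k ∈ K', 2 * ∑ Q ∈ 𝒬, ‖V n N (b Q) k‖ ^ 2 := by
          refine sum_le_sum fun k hk => ?_
          rw [mem_filter] at hk
          exact V_bad n N 𝒬 hd b hb0 hbm k hk.2
      _ = 2 * ∑ Q ∈ 𝒬, ∑ k ∈ K', ‖V n N (b Q) k‖ ^ 2 := by rw [← mul_sum, sum_comm]
      _ ≤ 2 * ∑ Q ∈ 𝒬, (32 * t) * ∑ k ∈ D Q, f k := by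
          gcongr with Q hQ
          refine (V_far n hn N (b Q) Q (hb0 Q hQ) K' ?_).trans ?_
          · intro k hk; rw [mem_filter] at hk; exact hk.2 Q hQ
          · have hs0 : 0 ≤ ∑ k ∈ D Q, f k := sum_nonneg fun k _ => hf k
            have hb1 : 0 ≤ ∑ k ∈ D Q, ‖b Q k‖ := sum_nonneg fun k _ => norm_nonneg _
            rw [div_le_iff₀ (by positivity)]
            have e1 : (∑ k ∈ D Q, ‖b Q k‖) ^ 2 ≤ (2 * ∑ k ∈ D Q, f k) ^ 2 := by
              have := hβ Q
              gcongr
            have e2 := mul_le_mul_of_nonneg_left (hσ Q hQ) hs0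
            nlinarith
      _ = 64 * t * ∑ Q ∈ 𝒬, ∑ k ∈ D Q, f k := by rw [← mul_sum]; ring
      _ ≤ 64 * t * G := by gcongr
  have hbad := chebyshev (fun k => ‖V n N B k‖) K' (t/2) _ (by positivity) hbad0
  have hexc := card_union_Ds 𝒬 (K.filter (fun k => ∃ Q ∈ 𝒬, k ∈ Ds Q))
    (fun k hk => by rw [mem_filter] at hk; exact hk.2)
  have hsub : K.filter (fun k => t < ‖V n N g k‖) ⊆
      (K.filter (fun k => t/2 < ‖V n N h k‖) ∪ K'.filter (fun k => t/2 < ‖V n N B k‖)) ∪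
        K.filter (fun k => ∃ Q ∈ 𝒬, k ∈ Ds Q) := by
    intro k hk
    rw [mem_filter] at hk
    simp only [mem_union, mem_filter, K']
    by_contra hcon
    push Not at hcon
    obtain ⟨⟨c1, c2⟩, c3⟩ := hcon
    have c1 := c1 hk.1
    have c3 := c3 hk.1
    have c2 := c2 ⟨hk.1, c3⟩
    have e : g = h + B := by ext k; simp [h]
    have := norm_add_le (V n N h k) (V n N B k)
    rw [← V_add, ← e] at this
    linarith [hk.2]
  have hc1 := (card_le_card hsub).trans ((card_union_le _ _).trans
    (Nat.add_le_add_right (card_union_le _ _) _))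
  have hc2 : ((K.filter (fun k => t < ‖V n N g k‖)).card : ℝ) ≤
      (K.filter (fun k => t/2 < ‖V n N h k‖)).card + (K'.filter (fun k => t/2 < ‖V n N B k‖)).card
      + (K.filter (fun k => ∃ Q ∈ 𝒬, k ∈ Ds Q)).card := by exact_mod_cast hc1
  have hG0 : 0 ≤ G := sum_nonneg fun _ _ => norm_nonneg _
  set x1 : ℝ := ((K.filter (fun k => t/2 < ‖V n N h k‖)).card : ℝ)
  set x2 : ℝ := ((K'.filter (fun k => t/2 < ‖V n N B k‖)).card : ℝ)
  set x3 : ℝ := ((K.filter (fun k => ∃ Q ∈ 𝒬, k ∈ Ds Q)).card : ℝ)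
  have y1 : t * x1 ≤ 640 * G := by
    by_contra hcon
    push Not at hcon
    nlinarith
  have y2 : t * x2 ≤ 256 * G := by
    by_contra hcon
    push Not at hcon
    nlinarith
  have y3 : t * x3 ≤ 2 * G := by
    have := mul_le_mul_of_nonneg_left hexc ht.le
    linarith
  nlinarith

end QME


namespace QME

lemma majorize (w x : ℕ → ℝ) (hw : Antitone w) (hw0 : ∀ l, 0 ≤ w l) (B : ℝ)
    (hx : ∀ s : ℕ, ∑ l ∈ range s, x l ≤ B * s) (M : ℕ) :
    ∑ l ∈ range M, w l * x l ≤ B * ∑ l ∈ range M, w l := by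
  have hS : ∀ s, ∑ l ∈ range s, (x l - B) ≤ 0 := by
    intro s
    rw [sum_sub_distrib, sum_const, card_range, nsmul_eq_mul]
    linarith [hx s]
  have key : ∀ M, ∑ l ∈ range M, w l * (x l - B) ≤ w M * ∑ l ∈ range M, (x l - B) := by
    intro M
    induction M with
    | zero => simp
    | succ M ih =>
      rw [sum_range_succ]
      have h1 := hS (M+1)
      have h2 := hw (Nat.le_succ M)
      have h3 := mul_le_mul_of_nonpos_right h2 h1
      refine le_trans ?_ h3
      rw [sum_range_succ, mul_add]
      linarith
  have h1 := (key M).trans (mul_nonpos_of_nonneg_of_nonpos (hw0 M) (hS M))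
  simp_rw [mul_sub] at h1
  rw [sum_sub_distrib, ← sum_mul] at h1
  linarith

lemma rpow_tele (c : ℝ) (hc : 0 < c) (hc1 : c ≤ 1) (y : ℝ) (hy : 0 < y) :
    c * (y ^ (-c) / (y + 1)) ≤ y ^ (-c) - (y + 1) ^ (-c) := by
  have h := _root_.rpow_one_add_le_one_add_mul_self (s := - (1 / (y+1))) (by
    have : 1 / (y+1) ≤ 1 := by rw [div_le_one (by positivity)]; linarith
    linarith) hc.le hc1
  have e1 : 1 + -(1/(y+1)) = y / (y+1) := by field_simp; ring
  rw [e1, Real.div_rpow hy.le (by positivity)] at h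
  have hyc : 0 < y ^ c := by positivity
  have hyc' : 0 < (y+1) ^ c := by positivity
  rw [Real.rpow_neg hy.le, Real.rpow_neg (by positivity)]
  have h2 : ((y+1)^c)⁻¹ = (y ^ c)⁻¹ * (y ^ c / (y+1)^c) := by field_simp
  rw [h2]
  have h3 := mul_le_mul_of_nonneg_left h (inv_nonneg.mpr hyc.le)
  have e : (y ^ c)⁻¹ * (1 + c * -(1/(y+1))) = (y^c)⁻¹ - c * ((y ^ c)⁻¹ / (y+1)) := by ring
  rw [e] at h3
  linarith

lemma w_sum (c : ℝ) (hc : 0 < c) (hc1 : c ≤ 1) (R : ℝ) (hR : 0 < R) (M : ℕ) :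
    ∑ l ∈ range M, R ^ c * (((l:ℝ) + R) ^ (-c) / ((l:ℝ) + R + 1)) ≤ 1 / c := by
  rw [le_div_iff₀ hc, sum_mul]
  have h1 : ∀ l ∈ range M, R ^ c * (((l:ℝ) + R) ^ (-c) / ((l:ℝ) + R + 1)) * c ≤
      R ^ c * ((l:ℝ) + R) ^ (-c) - R ^ c * (((l+1:ℕ):ℝ) + R) ^ (-c) := by
    intro l _
    have := rpow_tele c hc hc1 (l + R) (by positivity)
    have h2 := mul_le_mul_of_nonneg_left this (show 0 ≤ R ^ c by positivity)
    have e : (((l+1:ℕ):ℝ) + R) = l + R + 1 := by push_cast; ring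
    rw [e]
    linarith
  refine (sum_le_sum h1).trans ?_
  rw [sum_range_sub' (fun l : ℕ => R ^ c * ((l:ℝ) + R) ^ (-c))]
  have h3 : 0 ≤ R ^ c * (((M:ℕ):ℝ) + R) ^ (-c) := by positivity
  have h4 : R ^ c * ((((0:ℕ):ℝ)) + R) ^ (-c) = 1 := by
    rw [Nat.cast_zero, zero_add, ← Real.rpow_add hR]; simp
  linarith

lemma partial_sum_eq (h : ℤ → ℂ) (a k : ℤ) (hak : a ≤ k) (h0 : ∀ l < k, h l = 0) (t : ℕ) :
    ∑ j ∈ range t, h (k + j) = ∑ l ∈ Finset.Ico a (k + t), h l := by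
  induction t with
  | zero =>
    simp
    symm
    apply sum_eq_zero
    intro l hl
    rw [Finset.mem_Ico] at hl
    exact h0 l hl.2
  | succ t ih =>
    rw [sum_range_succ, ih]
    push_cast
    rw [← add_assoc, ← Finset.insert_Ico_right_eq_Ico_add_one (by omega), sum_insert (by simp)]
    ring

lemma shift_sum (f : ℤ → ℝ) (k : ℤ) (t : ℕ) :
    ∑ j ∈ range t, f (k + j) = ∑ l ∈ Finset.Ico k (k + t), f l := by
  induction t with
  | zero => simp
  | succ t ih =>
    rw [sum_range_succ, ih]
    push_cast
    rw [← add_assoc, ← Finset.insert_Ico_right_eq_Ico_add_one (by omega), sum_insert (by simp)]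
    ring

lemma far_wlog (n : ℕ → ℕ) (hn : Monotone n) (N : ℕ) (h : ℤ → ℂ) (a : ℤ) (R : ℕ) (hR : 0 < R)
    (m c : ℝ) (hm : 0 ≤ m) (hc : 0 < c) (hc1 : c ≤ 1)
    (h0 : ∀ l < a + 2 * R, h l = 0)
    (HJ : ∀ (s : ℕ) (J : Finset ℤ), R ≤ s → J ⊆ Finset.Ico a (a + s) →
      ∑ l ∈ J, ‖h l‖ ≤ 2 * m * (J.card : ℝ) ^ c * (s : ℝ) ^ (1 - c))
    (k k' : ℤ) (hak : a ≤ k) (hkk : k ≤ k') (hk' : k' < a + R) :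
    ‖V n N h k' - V n N h k‖ ^ 2 ≤ 384 * m ^ 2 / c := by
  set u : ℕ → ℂ := fun t => av t h k' - av t h k with hu
  have hRr : (0:ℝ) < R := by exact_mod_cast hR
  have hV : ‖V n N h k' - V n N h k‖ ^ 2 = ∑ i ∈ range N, ‖u (n i) - u (n (i+1))‖ ^ 2 := by
    rw [EuclideanSpace.norm_sq_eq, Finset.sum_range]
    refine sum_congr rfl fun i _ => ?_
    simp only [V, u, PiLp.sub_apply]
    congr 2
    ring
  have hu1 : ∀ t, u t = ((t:ℂ)+1)⁻¹ * ∑ l ∈ Finset.Ico (k + (t+1:ℕ)) (k' + (t+1:ℕ)), h l := by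
    intro t
    simp only [u, av]
    rw [← mul_sub, partial_sum_eq h a k hak (fun l hl => h0 l (by omega)),
      partial_sum_eq h a k' (by omega) (fun l hl => h0 l (by omega))]
    congr 1
    rw [sub_eq_iff_eq_add', ← Finset.sum_union (Finset.Ico_disjoint_Ico_consecutive _ _ _),
      Finset.Ico_union_Ico_eq_Ico (by omega) (by omega)]
  have hu0 : ∀ t, t + 1 ≤ R → u t = 0 := by
    intro t ht
    rw [hu1, sum_eq_zero, mul_zero]
    intro l hl
    rw [Finset.mem_Ico] at hl
    apply h0
    omega
  set v : ℕ → ℝ := fun t => (R:ℝ) ^ c * ((t:ℝ) + R) ^ (-c) with hv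
  have hv0 : ∀ t, 0 ≤ v t := fun t => by positivity
  have hva : Antitone v := by
    intro t t' htt
    simp only [v]
    have : (t:ℝ) ≤ t' := by exact_mod_cast htt
    apply mul_le_mul_of_nonneg_left _ (by positivity)
    apply Real.rpow_le_rpow_of_nonpos (by positivity) (by linarith) (by linarith)
  have hv1 : ∀ t, v t ≤ 1 := by
    intro t
    refine (hva (Nat.zero_le t)).trans ?_
    simp only [v]
    rw [Nat.cast_zero, zero_add, ← Real.rpow_add hRr]; simp
  have huv : ∀ t, ‖u t‖ ≤ 4 * m * v t := by
    intro t
    by_cases ht : t + 1 ≤ R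
    · rw [hu0 t ht, norm_zero]
      have := hv0 t
      positivity
    · push Not at ht
      rw [hu1, norm_mul, norm_inv_succ, inv_mul_le_iff₀ (by positivity)]
      have hcard : ((Finset.Ico (k + (t+1:ℕ)) (k' + (t+1:ℕ))).card : ℝ) ≤ R := by
        rw [Int.card_Ico]
        exact_mod_cast (by omega)
      have hJ := HJ (t + R) (Finset.Ico (k + (t+1:ℕ)) (k' + (t+1:ℕ))) (by omega) (by
        intro l hl
        rw [Finset.mem_Ico] at *
        push_cast at *
        omega)
      refine (norm_sum_le _ _).trans (hJ.trans ?_)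
      have e : (((t + R : ℕ) : ℝ)) ^ (1 - c) = ((t:ℝ) + R) * ((t:ℝ) + R) ^ (-c) := by
        push_cast
        rw [sub_eq_add_neg, Real.rpow_add (by positivity), Real.rpow_one]
      rw [e]
      have hpc : ((Finset.Ico (k + (t+1:ℕ)) (k' + (t+1:ℕ))).card : ℝ) ^ c ≤ (R:ℝ) ^ c :=
        Real.rpow_le_rpow (by positivity) hcard hc.le
      have htR : (R:ℝ) ≤ t := by exact_mod_cast (by omega)
      have hq : 0 ≤ ((t:ℝ) + R) ^ (-c) := by positivity
      calc _ ≤ 2 * m * (R:ℝ) ^ c * ((2 * (t + 1)) * ((t:ℝ) + R) ^ (-c)) := by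
            gcongr
            linarith
        _ = _ := by simp only [v]; ring
  set x : ℕ → ℝ := fun l => ‖h (k' + 1 + l)‖ + ‖h (k + 1 + l)‖ + ‖u l‖ with hxdef
  have hstep : ∀ l, ‖u (l+1) - u l‖ ≤ 2 * (x l / ((l:ℝ) + R + 1)) := by
    intro l
    have hx0 : 0 ≤ x l := by positivity
    by_cases hl : l + 2 ≤ R
    · rw [hu0 (l+1) (by omega), hu0 l (by omega)]
      simp only [sub_zero, norm_zero]
      positivity
    · push Not at hl
      have e : u (l+1) - u l = (((l+1 : ℕ) : ℂ) + 1)⁻¹ *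
          (h (k' + 1 + l) - h (k + 1 + l) - u l) := by
        have e1 := av_step h k' l
        have e2 := av_step h k l
        have e3 : k' + ((l+1:ℕ):ℤ) = k' + 1 + l := by push_cast; ring
        have e4 : k + ((l+1:ℕ):ℤ) = k + 1 + l := by push_cast; ring
        rw [e3] at e1
        rw [e4] at e2
        simp only [u]
        linear_combination e1 - e2
      rw [e, norm_mul, norm_inv_succ, inv_mul_le_iff₀ (by positivity)]
      have hx1 : ‖h (k' + 1 + l) - h (k + 1 + l) - u l‖ ≤ x l :=
        (norm_sub_le _ _).trans (add_le_add_left (norm_sub_le _ _) _)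
      refine hx1.trans ?_
      have hlR : (R:ℝ) ≤ l + 1 := by exact_mod_cast (by omega)
      rw [← mul_assoc, mul_div_assoc', le_div_iff₀ (by positivity)]
      push_cast
      nlinarith
  have hxs1 : ∀ (s : ℕ) (k : ℤ), a ≤ k → k < a + R → ∑ l ∈ range s, ‖h (k + 1 + l)‖ ≤ 4 * m * s := by
    intro s k hak hk
    rw [shift_sum (fun l => ‖h l‖)]
    by_cases hs : s ≤ R
    · rw [sum_eq_zero]
      · positivity
      · intro l hl
        rw [Finset.mem_Ico] at hl
        rw [h0 l (by omega), norm_zero]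
    · push Not at hs
      have hJ := HJ (s + R) (Finset.Ico (k+1) (k+1+s)) (by omega) (by
        intro l hl
        rw [Finset.mem_Ico] at *
        push_cast
        omega)
      refine hJ.trans ?_
      have hcard : ((Finset.Ico (k+1) (k+1+s)).card : ℝ) ≤ ((s + R : ℕ) : ℝ) := by
        rw [Int.card_Ico]
        exact_mod_cast (by omega)
      have hpc : ((Finset.Ico (k+1) (k+1+s)).card : ℝ) ^ c ≤ ((s + R : ℕ) : ℝ) ^ c :=
        Real.rpow_le_rpow (by positivity) hcard hc.le
      have hsR : (R:ℝ) ≤ s := by exact_mod_cast hs.le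
      have hsRp : (0:ℝ) < ((s + R : ℕ) : ℝ) := by push_cast; positivity
      calc _ ≤ 2 * m * ((s + R : ℕ) : ℝ) ^ c * ((s + R : ℕ) : ℝ) ^ (1 - c) := by gcongr
        _ = 2 * m * ((s + R : ℕ) : ℝ) := by
          rw [mul_assoc, ← Real.rpow_add hsRp]; simp
        _ ≤ _ := by push_cast; nlinarith
  have hxs : ∀ s : ℕ, ∑ l ∈ range s, x l ≤ 12 * m * s := by
    intro s
    simp only [x]
    rw [sum_add_distrib, sum_add_distrib]
    have h1 := hxs1 s k' (by omega) hk'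
    have h2 := hxs1 s k hak (by omega)
    have h3 : ∑ l ∈ range s, ‖u l‖ ≤ 4 * m * s := by
      have : ∑ l ∈ range s, ‖u l‖ ≤ ∑ l ∈ range s, 4 * m := by
        refine sum_le_sum fun l _ => (huv l).trans ?_
        have := hv1 l
        nlinarith
      rw [sum_const, card_range, nsmul_eq_mul] at this
      linarith
    linarith
  set w : ℕ → ℝ := fun l => (R:ℝ) ^ c * (((l:ℝ) + R) ^ (-c) / ((l:ℝ) + R + 1)) with hw
  have hwv : ∀ l, w l = v l / ((l:ℝ) + R + 1) := fun l => by simp only [w, v]; ring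
  have hw0 : ∀ l, 0 ≤ w l := fun l => by positivity
  have hwa : Antitone w := by
    intro l l' hll
    rw [hwv, hwv]
    have : (l:ℝ) ≤ l' := by exact_mod_cast hll
    have h2 := hva hll
    have h3 := hv0 l
    gcongr
  have hmaj := majorize w x hwa hw0 _ hxs (n N)
  have hws := w_sum c hc hc1 R hRr (n N)
  rw [hV]
  refine (jump_sq u n hn N).trans ?_
  have h5 : ∑ l ∈ range (n N), (‖u (l+1)‖ + ‖u l‖) * ‖u (l+1) - u l‖ ≤
      ∑ l ∈ range (n N), 16 * m * (w l * x l) := by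
    refine sum_le_sum fun l _ => ?_
    have e1 := huv (l+1)
    have e2 := huv l
    have e3 := hva (Nat.le_succ l)
    have e4 := hv0 l
    have hx0 : 0 ≤ x l := by positivity
    have e5 : ‖u (l+1)‖ + ‖u l‖ ≤ 8 * m * v l := by nlinarith
    calc _ ≤ (8 * m * v l) * (2 * (x l / ((l:ℝ) + R + 1))) := by
          gcongr
          exact hstep l
      _ = _ := by rw [hwv]; ring
  rw [← mul_sum] at h5
  have h6 : 16 * m * ∑ l ∈ range (n N), w l * x l ≤ 16 * m * (12 * m * (1 / c)) := by
    gcongr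
    refine hmaj.trans ?_
    gcongr
  calc _ ≤ 2 * (16 * m * (12 * m * (1 / c))) := by gcongr; exact h5.trans h6
    _ = _ := by ring

lemma far_bound (n : ℕ → ℕ) (hn : Monotone n) (N : ℕ) (h : ℤ → ℂ) (a : ℤ) (R : ℕ) (hR : 0 < R)
    (m c : ℝ) (hm : 0 ≤ m) (hc : 0 < c) (hc1 : c ≤ 1)
    (h0 : ∀ l < a + 2 * R, h l = 0)
    (HJ : ∀ (s : ℕ) (J : Finset ℤ), R ≤ s → J ⊆ Finset.Ico a (a + s) →
      ∑ l ∈ J, ‖h l‖ ≤ 2 * m * (J.card : ℝ) ^ c * (s : ℝ) ^ (1 - c))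
    (k k' : ℤ) (hk : a ≤ k ∧ k < a + R) (hk' : a ≤ k' ∧ k' < a + R) :
    ‖V n N h k' - V n N h k‖ ^ 2 ≤ 384 * m ^ 2 / c := by
  rcases le_total k k' with hkk | hkk
  · exact far_wlog n hn N h a R hR m c hm hc hc1 h0 HJ k k' hk.1 hkk hk'.2
  · rw [norm_sub_rev]
    exact far_wlog n hn N h a R hR m c hm hc hc1 h0 HJ k' k hk'.1 hkk hk.2

end QME


namespace QME

lemma V_zero (n : ℕ → ℕ) (N : ℕ) (g : ℤ → ℂ) (k : ℤ) (h : ∀ j, k ≤ j → g j = 0) :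
    V n N g k = 0 := by
  have : ∀ t, av t g k = 0 := by
    intro t
    unfold av
    rw [sum_eq_zero, mul_zero]
    intro j _
    exact h _ (by omega)
  ext i
  simp [V, this]

lemma holder (g : ℤ → ℂ) (r : ℝ) (hr : 1 < r) (m : ℝ) (hm : 0 ≤ m) (s : ℝ) (hs : 0 ≤ s)
    (J : Finset ℤ) (h : ∑ l ∈ J, ‖g l‖ ^ r ≤ 2 * m ^ r * s) :
    ∑ l ∈ J, ‖g l‖ ≤ 2 * m * (J.card : ℝ) ^ (1 - 1 / r) * s ^ (1 - (1 - 1 / r)) := by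
  have hr0 : 0 < r := by linarith
  have hconj := Real.HolderConjugate.conjExponent hr
  have h1 := Real.inner_le_Lp_mul_Lq J (fun l => ‖g l‖) (fun _ => (1:ℝ)) hconj
  simp only [mul_one, abs_norm, abs_one, Real.one_rpow, sum_const, nsmul_eq_mul] at h1
  have e1 : 1 / r.conjExponent = 1 - 1 / r := by
    have := hconj.inv_add_inv_eq_one
    rw [one_div, one_div]; linarith
  rw [e1] at h1
  refine h1.trans ?_
  have e2 : 1 - (1 - 1 / r) = 1 / r := by ring
  rw [e2]
  have h2 : (∑ l ∈ J, ‖g l‖ ^ r) ^ (1 / r) ≤ 2 * m * s ^ (1 / r) := by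
    refine (Real.rpow_le_rpow (sum_nonneg fun _ _ => by positivity) h (by positivity)).trans ?_
    rw [Real.mul_rpow (by positivity) hs, Real.mul_rpow (by norm_num) (by positivity),
      ← Real.rpow_mul hm, mul_one_div_cancel hr0.ne', Real.rpow_one]
    have h3 : (2:ℝ) ^ (1 / r) ≤ 2 := by
      calc (2:ℝ) ^ (1 / r) ≤ 2 ^ (1:ℝ) := by
            apply Real.rpow_le_rpow_of_exponent_le (by norm_num)
            rw [div_le_one hr0]; exact hr.le
        _ = 2 := by norm_num
    gcongr
  calc _ ≤ (2 * m * s ^ (1 / r)) * (J.card : ℝ) ^ (1 - 1 / r) := by gcongr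
    _ = _ := by ring

lemma H_of_not_Bd (f : ℤ → ℝ) (hf : ∀ k, 0 ≤ f k) (t : ℝ) (ht : 0 ≤ t) (k0 : ℤ) (hk0 : k0 ∉ Bd f t)
    (Q : ℕ × ℤ) (hQ : k0 ∈ D Q) (s : ℕ) (hs : 2 ^ Q.1 ≤ s) :
    ∑ l ∈ Finset.Ico (Q.2 * 2 ^ Q.1) (Q.2 * 2 ^ Q.1 + s), f l ≤ 2 * t * s := by
  classical
  set m := Nat.clog 2 s with hm
  have hs0 : 0 < s := lt_of_lt_of_le (by positivity) hs
  have h1 : s ≤ 2 ^ m := Nat.le_pow_clog (by norm_num) s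
  have h2 : 2 ^ m ≤ 2 * s := by
    by_cases hs1 : s = 1
    · simp [hm, hs1]
    · have h3 : 2 ^ (m - 1) < s := Nat.pow_pred_clog_lt_self (by norm_num) (by omega)
      have h4 : 0 < m := Nat.clog_pos (by norm_num) (by omega)
      obtain ⟨m', hm'⟩ : ∃ m', m = m' + 1 := ⟨m - 1, by omega⟩
      rw [hm'] at h3 ⊢
      rw [pow_succ]
      simp at h3
      omega
  have hQm : Q.1 ≤ m := (Nat.pow_le_pow_iff_right (by norm_num : 1 < 2)).mp (hs.trans h1)
  have hk0m : k0 ∈ D (m, k0 / 2 ^ m) := by rw [mem_D]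
  have hnest := D_nested (Q := Q) (Q' := (m, k0 / 2 ^ m)) hQm hQ hk0m
  have ha : Q.2 * 2 ^ Q.1 ∈ D (m, k0 / 2 ^ m) := by
    apply hnest
    rw [mem_D']
    have : (0:ℤ) < 2 ^ Q.1 := by positivity
    omega
  rw [mem_D'] at ha
  simp only at ha
  simp only [Bd, Set.mem_ofPred_eq, not_exists, not_lt] at hk0
  have hk := hk0 m
  have hsub : Finset.Ico (Q.2 * 2 ^ Q.1) (Q.2 * 2 ^ Q.1 + s) ⊆
      D (m, k0 / 2 ^ m) ∪ D (m, k0 / 2 ^ m + 1) := by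
    intro l hl
    rw [Finset.mem_Ico] at hl
    rw [mem_union, mem_D', mem_D']
    simp only [add_mul, one_mul]
    have : (s:ℤ) ≤ 2 ^ m := by exact_mod_cast h1
    omega
  have h5 := sum_le_sum_of_subset_of_nonneg (f := f) hsub (fun k _ _ => hf k)
  have h6 : ∑ l ∈ D (m, k0 / 2 ^ m) ∪ D (m, k0 / 2 ^ m + 1), f l ≤
      ∑ l ∈ D (m, k0 / 2 ^ m), f l + ∑ l ∈ D (m, k0 / 2 ^ m + 1), f l := by
    rw [← sum_union_inter]
    have : 0 ≤ ∑ l ∈ D (m, k0 / 2 ^ m) ∩ D (m, k0 / 2 ^ m + 1), f l := sum_nonneg fun k _ => hf k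
    linarith
  have h7 : t * 2 ^ m ≤ t * (2 * s) := by
    gcongr
    exact_mod_cast h2
  linarith

open Classical in
lemma good_lambda (n : ℕ → ℕ) (hn : Monotone n) (N : ℕ) (g : ℤ → ℂ) (S : Finset ℤ)
    (hS : ∀ k ∉ S, V n N g k = 0) (r : ℝ) (hr : 1 < r) (γ : ℝ) (hγ : 0 < γ)
    (hγ1 : 10000 * γ ≤ 1) (hγ2 : 384 * γ ^ 2 / (1 - 1 / r) ≤ 1) (t : ℝ) (ht : 0 < t) :
    ((S.filter (fun k => 4 * t < ‖V n N g k‖)).card : ℝ) ≤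
      ((S.filter (fun k => k ∈ Bd (fun l => ‖g l‖ ^ r) ((γ * t) ^ r))).card : ℝ)
      + 16000 * γ * ((S.filter (fun k => t < ‖V n N g k‖)).card : ℝ) := by
  set f : ℤ → ℝ := fun l => ‖g l‖ ^ r with hfdef
  have hf : ∀ k, 0 ≤ f k := fun k => by positivity
  set E := S.filter (fun k => t < ‖V n N g k‖) with hE
  set e : ℤ → ℝ := fun k => if k ∈ E then 1 else 0 with he
  have he0 : ∀ k, 0 ≤ e k := fun k => by simp only [e]; split_ifs <;> norm_num
  have heE : ∀ k ∉ E, e k = 0 := fun k hk => by simp [e, hk]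
  have hc0 : 0 < 1 - 1 / r := by
    have : 1 / r < 1 := by rw [div_lt_one (by linarith)]; exact hr
    linarith
  have hc1 : 1 - 1 / r ≤ 1 := by
    have : 0 < 1 / r := by positivity
    linarith
  obtain ⟨𝒬, hd, h1, h2, h3⟩ := cz e E he0 heE (1/2) (by norm_num)
  have hcard := sum_card e E he0 heE 𝒬 hd _ h1
  have hsumE : ∑ k ∈ E, e k = E.card := by
    rw [sum_congr rfl (fun k hk => show e k = 1 by simp [e, hk])]; simp
  rw [hsumE] at hcard
  set A := S.filter (fun k => 4 * t < ‖V n N g k‖ ∧ k ∉ Bd f ((γ * t) ^ r)) with hA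
  have claim : ∀ Q ∈ 𝒬, ((A.filter (· ∈ D Q)).card : ℝ) ≤ 8000 * γ * 2 ^ Q.1 := by
    intro Q hQ
    by_cases hne : (A.filter (· ∈ D Q)).Nonempty
    swap
    · rw [not_nonempty_iff_eq_empty] at hne
      rw [hne]; simp; positivity
    obtain ⟨k0, hk0⟩ := hne
    rw [mem_filter, hA, mem_filter] at hk0
    obtain ⟨⟨-, -, hkB⟩, hkQ⟩ := hk0
    set P := par Q with hP
    set R : ℕ := 2 ^ P.1 with hRdef
    set a : ℤ := P.2 * 2 ^ P.1 with ha
    have hR : 0 < R := by positivity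
    have hRi : ((R:ℕ):ℤ) = 2 ^ P.1 := by simp [hRdef]
    have hRr : ((R:ℕ):ℝ) = 2 * 2 ^ Q.1 := by simp [hRdef, hP, par, pow_succ]; ring
    have hmemP : ∀ k, k ∈ D P ↔ a ≤ k ∧ k < a + R := by
      intro k; rw [mem_D', hRi]
    have hH : ∀ (s : ℕ) (J : Finset ℤ), R ≤ s → J ⊆ Finset.Ico a (a + s) →
      ∑ l ∈ J, ‖g l‖ ≤ 2 * (γ * t) * (J.card : ℝ) ^ (1 - 1 / r) * (s : ℝ) ^ (1 - (1 - 1 / r)) := by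
      intro s J hs hJ
      apply holder g r hr (γ * t) (by positivity) s (by positivity) J
      exact (sum_le_sum_of_subset_of_nonneg hJ (fun k _ _ => hf k)).trans
        (H_of_not_Bd f hf _ (by positivity) k0 hkB P (D_par Q hkQ) s hs)
    set left : ℤ → ℂ := fun k => if k < a then g k else 0 with hleft
    set loc : ℤ → ℂ := fun k => if k ∈ Finset.Ico a (a + (2 * R : ℕ)) then g k else 0 with hloc
    set far : ℤ → ℂ := fun k => if k < a + (2 * R : ℕ) then 0 else g k with hfar
    have hsplit : g = left + loc + far := by
      ext k
      simp only [left, loc, far, Pi.add_apply, Finset.mem_Ico]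
      by_cases c1 : k < a
      · have c2 : ¬ (a ≤ k ∧ k < a + (2 * R : ℕ)) := by omega
        have c3 : k < a + (2 * R : ℕ) := by omega
        rw [if_pos c1, if_neg c2, if_pos c3]; ring
      · by_cases c3 : k < a + (2 * R : ℕ)
        · have c2 : (a ≤ k ∧ k < a + (2 * R : ℕ)) := by omega
          rw [if_neg c1, if_pos c2, if_pos c3]; ring
        · have c2 : ¬ (a ≤ k ∧ k < a + (2 * R : ℕ)) := by omega
          rw [if_neg c1, if_neg c2, if_neg c3]; ring
    have hVs : ∀ k, a ≤ k → V n N g k = V n N loc k + V n N far k := by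
      intro k hk
      conv_lhs => rw [hsplit]
      rw [V_add, V_add, V_zero n N left k, zero_add]
      intro j hj
      simp only [left]
      rw [if_neg (by omega)]
    have hfarb := far_bound n hn N far a R hR (γ * t) (1 - 1 / r) (by positivity) hc0 hc1 (by
        intro l hl
        simp only [far]
        rw [if_pos (by push_cast; omega)]) (by
        intro s J hs hJ
        refine le_trans (sum_le_sum fun l _ => ?_) (hH s J hs hJ)
        simp only [far]
        split_ifs
        · simp
        · exact le_rfl)
    have hfarb' : ∀ k k' : ℤ, k ∈ D P → k' ∈ D P → ‖V n N far k'‖ ≤ ‖V n N far k‖ + t := by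
      intro k k' hk hk'
      rw [hmemP] at hk hk'
      have h5 := hfarb k k' hk hk'
      have h6 : 384 * (γ * t) ^ 2 / (1 - 1 / r) = (384 * γ ^ 2 / (1 - 1 / r)) * t ^ 2 := by ring
      rw [h6] at h5
      have h7 : ‖V n N far k' - V n N far k‖ ^ 2 ≤ t ^ 2 := by nlinarith [sq_nonneg t]
      have h8 : ‖V n N far k' - V n N far k‖ ≤ t := by
        exact (sq_le_sq₀ (norm_nonneg _) ht.le).mp h7
      have h9 := norm_sub_norm_le (V n N far k') (V n N far k)
      linarith
    have hlocb := weak11 n hn N loc (Finset.Ico a (a + (2 * R : ℕ))) (fun k hk => by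
      simp only [loc]; rw [if_neg hk]) (D P) t ht
    have hlocs : ∑ k ∈ Finset.Ico a (a + (2 * R : ℕ)), ‖loc k‖ ≤ 2 * (γ * t) * (2 * R) := by
      have h5 := hH (2 * R) (Finset.Ico a (a + (2 * R : ℕ))) (by omega) (subset_refl _)
      have h6 : (Finset.Ico a (a + (2 * R : ℕ))).card = 2 * R := by
        rw [Int.card_Ico, add_sub_cancel_left, Int.toNat_natCast]
      rw [h6, mul_assoc, ← Real.rpow_add (by positivity), add_sub_cancel, Real.rpow_one] at h5
      refine le_trans (sum_le_sum fun l _ => ?_) (h5.trans (le_of_eq (by push_cast; ring)))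
      simp only [loc]
      split_ifs <;> simp
    set L := (D P).filter (fun k => t < ‖V n N loc k‖) with hL
    have hLc : (L.card : ℝ) ≤ 4000 * γ * R := by
      have h5 : t * (L.card : ℝ) ≤ t * (4000 * γ * R) := by
        refine hlocb.trans ?_
        linarith
      exact le_of_mul_le_mul_left h5 ht
    -- a good point
    have hEI : (((D P).filter (· ∈ E)).card : ℝ) ≤ 2 ^ Q.1 := by
      have h5 := h2 Q hQ
      simp only [e] at h5
      rw [← sum_filter, sum_const, nsmul_eq_mul, mul_one] at h5
      refine h5.trans (le_of_eq ?_)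
      rw [pow_succ]; ring
    obtain ⟨kb, hkbP, hkbE, hkbL⟩ : ∃ kb ∈ D P, kb ∉ E ∧ ‖V n N loc kb‖ ≤ t := by
      by_contra hcon
      push Not at hcon
      have hsub : D P ⊆ (D P).filter (· ∈ E) ∪ L := by
        intro k hk
        rw [mem_union]
        by_cases hkE : k ∈ E
        · exact Or.inl (mem_filter.mpr ⟨hk, hkE⟩)
        · exact Or.inr (mem_filter.mpr ⟨hk, hcon k hk hkE⟩)
      have h5 := (card_le_card hsub).trans (card_union_le _ _)
      rw [card_D] at h5
      have h6 : ((R:ℕ):ℝ) ≤ ((D P).filter (· ∈ E)).card + L.card := by exact_mod_cast h5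
      have h7 : (0:ℝ) < 2 ^ Q.1 := by positivity
      rw [hRr] at h6 hLc
      nlinarith
    have hFkb : ‖V n N g kb‖ ≤ t := by
      by_cases hkS : kb ∈ S
      · rw [hE, mem_filter] at hkbE
        by_contra hcon
        push Not at hcon
        exact hkbE ⟨hkS, hcon⟩
      · rw [hS kb hkS, norm_zero]; exact ht.le
    have hsub : A.filter (· ∈ D Q) ⊆ L := by
      intro k hk
      rw [mem_filter, hA, mem_filter] at hk
      obtain ⟨⟨-, h4, -⟩, hkQ⟩ := hk
      have hkP := D_par Q hkQ
      rw [hL, mem_filter]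
      refine ⟨hkP, ?_⟩
      have e1 := hVs k ((hmemP k).mp hkP).1
      have e2 := hVs kb ((hmemP kb).mp hkbP).1
      have e3 := hfarb' kb k hkbP hkP
      have e4 := norm_add_le (V n N loc k) (V n N far k)
      rw [← e1] at e4
      have e5 : ‖V n N far kb‖ ≤ ‖V n N g kb‖ + ‖V n N loc kb‖ := by
        have : V n N far kb = V n N g kb - V n N loc kb := by rw [e2]; abel
        rw [this]; exact norm_sub_le _ _
      linarith
    have h5 : ((A.filter (· ∈ D Q)).card : ℝ) ≤ L.card := by exact_mod_cast card_le_card hsub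
    rw [hRr] at hLc
    linarith
  have hAsub : A ⊆ 𝒬.biUnion (fun Q => A.filter (· ∈ D Q)) := by
    intro k hk
    have hk' := hk
    rw [hA, mem_filter] at hk'
    have hkE : k ∈ E := by rw [hE, mem_filter]; exact ⟨hk'.1, by linarith [hk'.2.1]⟩
    have hD0 : D (0, k) = {k} := by
      ext l; rw [mem_D', mem_singleton]; simp; omega
    obtain ⟨Q, hQ, hsub⟩ := h3 (0, k) (by rw [hD0]; simp [e, hkE]; norm_num)
    rw [mem_biUnion]
    refine ⟨Q, hQ, ?_⟩
    rw [mem_filter]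
    exact ⟨hk, hsub (by rw [hD0]; simp)⟩
  have hAc : (A.card : ℝ) ≤ 16000 * γ * E.card := by
    have h5 := (card_le_card hAsub).trans card_biUnion_le
    have h6 : (A.card : ℝ) ≤ ∑ Q ∈ 𝒬, ((A.filter (· ∈ D Q)).card : ℝ) := by exact_mod_cast h5
    have h7 := h6.trans (sum_le_sum claim)
    rw [← mul_sum] at h7
    have h8 : 8000 * γ * ∑ Q ∈ 𝒬, (2:ℝ) ^ Q.1 ≤ 8000 * γ * (2 * E.card) := by
      gcongr
      linarith
    linarith
  have hsub : S.filter (fun k => 4 * t < ‖V n N g k‖) ⊆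
      S.filter (fun k => k ∈ Bd f ((γ * t) ^ r)) ∪ A := by
    intro k hk
    rw [mem_filter] at hk
    rw [mem_union, hA, mem_filter, mem_filter]
    by_cases hB : k ∈ Bd f ((γ * t) ^ r)
    · exact Or.inl ⟨hk.1, hB⟩
    · exact Or.inr ⟨hk.1, hk.2, hB⟩
  have h5 := (card_le_card hsub).trans (card_union_le _ _)
  have h6 : ((S.filter (fun k => 4 * t < ‖V n N g k‖)).card : ℝ) ≤
      ((S.filter (fun k => k ∈ Bd f ((γ * t) ^ r))).card : ℝ) + A.card := by exact_mod_cast h5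
  linarith

end QME


namespace QME

noncomputable def lc (q a x : ℝ) : ℝ := if x < a then q * x ^ (q - 1) else 0

lemma lc_int (q a : ℝ) (hq : 0 < q) (ha : 0 ≤ a) :
    IntegrableOn (lc q a) (Set.Ioi 0) ∧ ∫ x in Set.Ioi 0, lc q a x = a ^ q := by
  have e : lc q a = (Set.Iio a).indicator (fun x => q * x ^ (q - 1)) := by
    ext x
    simp [lc, Set.indicator_apply]
  have hi : IntervalIntegrable (fun x : ℝ => q * x ^ (q-1)) volume 0 a :=
    (intervalIntegral.intervalIntegrable_rpow' (by linarith)).const_mul q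
  have hs : Set.Ioi 0 ∩ Set.Iio a = Set.Ioo 0 a := Set.Ioi_inter_Iio
  have hI : IntegrableOn (fun x : ℝ => q * x ^ (q-1)) (Set.Ioo 0 a) := by
    rw [intervalIntegrable_iff_integrableOn_Ioo_of_le ha] at hi
    exact hi
  constructor
  · rw [e, IntegrableOn, integrable_indicator_iff measurableSet_Iio, IntegrableOn,
      Measure.restrict_restrict measurableSet_Iio, Set.inter_comm, hs]
    exact hI
  · rw [e, setIntegral_indicator measurableSet_Iio, hs, ← integral_Ioc_eq_integral_Ioo,
      ← intervalIntegral.integral_of_le ha, intervalIntegral.integral_const_mul,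
      integral_rpow (Or.inl (by linarith))]
    rw [sub_add_cancel, Real.zero_rpow hq.ne', sub_zero]
    field_simp

open Classical in
lemma Bd_card' (f : ℤ → ℝ) (W : Finset ℤ) (hf : ∀ k, 0 ≤ f k) (hW : ∀ k ∉ W, f k = 0)
    (t : ℝ) (ht : 0 < t) (K : Finset ℤ) :
    ((K.filter (· ∈ Bd f t)).card : ℝ) ≤ ∑ k ∈ W, if t / 4 < f k then 8 * f k / t else 0 := by
  set f1 : ℤ → ℝ := fun k => if t / 4 < f k then f k else 0 with hf1
  have h0 : ∀ k, 0 ≤ f1 k := by intro k; simp only [f1]; split_ifs; exacts [hf k, le_rfl]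
  have h1 : ∀ k ∉ W, f1 k = 0 := by intro k hk; simp only [f1]; split_ifs; exacts [hW k hk, rfl]
  have h2 : ∀ k, f k ≤ f1 k + t / 4 := by
    intro k; simp only [f1]; split_ifs with h <;> linarith
  have h3 := Bd_card f1 W h0 h1 (t/2) (by positivity) K
  have hsub : K.filter (· ∈ Bd f t) ⊆ K.filter (· ∈ Bd f1 (t/2)) := by
    intro k hk
    rw [mem_filter] at *
    refine ⟨hk.1, ?_⟩
    obtain ⟨m, hm⟩ := hk.2
    refine ⟨m, ?_⟩
    have h4 : ∀ j : ℤ, ∑ l ∈ D (m, j), f l ≤ ∑ l ∈ D (m, j), f1 l + t / 4 * 2 ^ m := by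
      intro j
      refine (sum_le_sum fun l _ => h2 l).trans (le_of_eq ?_)
      rw [sum_add_distrib, sum_const, card_D, nsmul_eq_mul]
      push_cast
      ring
    have := h4 (k / 2 ^ m)
    have := h4 (k / 2 ^ m + 1)
    linarith
  have h5 : ((K.filter (· ∈ Bd f t)).card : ℝ) ≤ (K.filter (· ∈ Bd f1 (t/2))).card := by
    exact_mod_cast card_le_card hsub
  have h6 : ∑ k ∈ W, (if t / 4 < f k then 8 * f k / t else 0) = 8 / t * ∑ k ∈ W, f1 k := by
    rw [mul_sum]
    refine sum_congr rfl fun k _ => ?_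
    simp only [f1]
    split_ifs <;> ring
  rw [h6]
  refine h5.trans ?_
  rw [div_mul_eq_mul_div, le_div_iff₀ ht]
  linarith

open Classical in
lemma card_filter_eq (S : Finset ℤ) (F : ℤ → ℝ) (x : ℝ) :
    ((S.filter (fun k => x < F k)).card : ℝ) = ∑ k ∈ S, if x < F k then 1 else 0 := by
  rw [← sum_filter, sum_const, nsmul_eq_mul, mul_one]

lemma integrated (n : ℕ → ℕ) (hn : Monotone n) (N : ℕ) (g : ℤ → ℂ) (W : Finset ℤ)
    (hW : ∀ k ∉ W, g k = 0) (S : Finset ℤ)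
    (hS : ∀ k ∉ S, V n N g k = 0) (p r : ℝ) (hr : 1 < r) (hrp : r < p) (γ : ℝ) (hγ : 0 < γ)
    (hγ1 : 10000 * γ ≤ 1) (hγ2 : 384 * γ ^ 2 / (1 - 1 / r) ≤ 1) :
    ∑ k ∈ S, (‖V n N g k‖ / 4) ^ p ≤
      (∑ k ∈ W, (8 * γ ^ (-r) * p / (p - r)) * ‖g k‖ ^ r * (4 * ‖g k‖ / γ) ^ (p - r))
      + 16000 * γ * ∑ k ∈ S, ‖V n N g k‖ ^ p := by
  classical
  have hp : 0 < p := by linarith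
  have hpr : 0 < p - r := by linarith
  have A1 : ∀ k, ∫ x in Set.Ioi 0, lc p (‖V n N g k‖ / 4) x = (‖V n N g k‖ / 4) ^ p :=
    fun k => (lc_int p _ hp (by positivity)).2
  have A2 : ∀ k, ∫ x in Set.Ioi 0, lc p (‖V n N g k‖) x = (‖V n N g k‖) ^ p :=
    fun k => (lc_int p _ hp (by positivity)).2
  have A3 : ∀ k, ∫ x in Set.Ioi 0, lc (p-r) (4 * ‖g k‖ / γ) x = (4 * ‖g k‖ / γ) ^ (p-r) :=
    fun k => (lc_int (p-r) _ hpr (by positivity)).2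
  have B1 : ∀ k, IntegrableOn (lc p (‖V n N g k‖ / 4)) (Set.Ioi 0) :=
    fun k => (lc_int p _ hp (by positivity)).1
  have B2 : ∀ k, IntegrableOn (lc p (‖V n N g k‖)) (Set.Ioi 0) :=
    fun k => (lc_int p _ hp (by positivity)).1
  have B3 : ∀ k, IntegrableOn (lc (p-r) (4 * ‖g k‖ / γ)) (Set.Ioi 0) :=
    fun k => (lc_int (p-r) _ hpr (by positivity)).1
  simp_rw [← A1, ← A2, ← A3]
  simp_rw [← integral_const_mul]
  rw [← integral_finsetSum _ (fun k _ => B1 k), ← integral_finsetSum _ (fun k _ => B2 k),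
    ← integral_finsetSum _ (fun k _ => (B3 k).const_mul _), ← integral_const_mul,
    ← integral_add (integrable_finset_sum _ (fun k _ => (B3 k).const_mul _))
      ((integrable_finset_sum _ (fun k _ => B2 k)).const_mul _)]
  apply setIntegral_mono_on (integrable_finset_sum _ (fun k _ => B1 k))
    ((integrable_finset_sum _ (fun k _ => (B3 k).const_mul _)).add
      ((integrable_finset_sum _ (fun k _ => B2 k)).const_mul _)) measurableSet_Ioi
  intro x hx
  rw [Set.mem_Ioi] at hx
  have hgl := good_lambda n hn N g S hS r hr γ hγ hγ1 hγ2 x hx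
  have hB := Bd_card' (fun l => ‖g l‖ ^ r) W (fun k => by positivity)
    (fun k hk => by simp [hW k hk, Real.zero_rpow (by linarith : r ≠ 0)]) ((γ * x) ^ r)
    (by positivity) S
  rw [card_filter_eq, card_filter_eq] at hgl
  have hxp : 0 ≤ p * x ^ (p - 1) := by positivity
  have h1 := mul_le_mul_of_nonneg_left (hgl.trans (add_le_add_left hB _)) hxp
  have e1 : ∑ k ∈ S, lc p (‖V n N g k‖ / 4) x =
      p * x ^ (p - 1) * ∑ k ∈ S, (if 4 * x < ‖V n N g k‖ then 1 else 0) := by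
    rw [mul_sum]
    refine sum_congr rfl fun k _ => ?_
    have : x < ‖V n N g k‖ / 4 ↔ 4 * x < ‖V n N g k‖ := by
      rw [lt_div_iff₀ (by norm_num), mul_comm]
    simp only [lc, this]
    split_ifs <;> simp
  have e2 : ∑ k ∈ S, lc p (‖V n N g k‖) x =
      p * x ^ (p - 1) * ∑ k ∈ S, (if x < ‖V n N g k‖ then 1 else 0) := by
    rw [mul_sum]
    refine sum_congr rfl fun k _ => ?_
    simp only [lc]
    split_ifs <;> simp
  rw [e1]
  refine h1.trans ?_
  rw [mul_add]
  have e3 : p * x ^ (p - 1) * (16000 * γ * ∑ k ∈ S, (if x < ‖V n N g k‖ then (1:ℝ) else 0)) =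
      16000 * γ * ∑ k ∈ S, lc p (‖V n N g k‖) x := by rw [e2]; ring
  rw [e3]
  refine add_le_add_left ?_ _
  rw [mul_sum]
  refine sum_le_sum fun k _ => ?_
  have hγx : (γ * x) ^ r = γ ^ r * x ^ r := Real.mul_rpow hγ.le hx.le
  by_cases hc : (γ * x) ^ r / 4 < ‖g k‖ ^ r
  · have hlt : x < 4 * ‖g k‖ / γ := by
      have h4 : (γ * x) ^ r < (4 * ‖g k‖) ^ r := by
        rw [Real.mul_rpow (by norm_num) (norm_nonneg _)]
        have : (4:ℝ) ≤ 4 ^ r := by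
          calc (4:ℝ) = 4 ^ (1:ℝ) := by norm_num
            _ ≤ _ := Real.rpow_le_rpow_of_exponent_le (by norm_num) hr.le
        have h5 : 0 ≤ ‖g k‖ ^ r := by positivity
        nlinarith
      have h5 := (Real.rpow_lt_rpow_iff (by positivity) (by positivity) (by linarith)).mp h4
      rw [lt_div_iff₀ hγ]; linarith
    rw [if_pos hc, lc, if_pos hlt]
    apply le_of_eq
    have e5 : x ^ (p - r - 1) = x ^ (p - 1) / x ^ r := by
      rw [← Real.rpow_sub hx]; ring_nf
    rw [e5, hγx, Real.rpow_neg hγ.le]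
    have : 0 < γ ^ r := by positivity
    have : 0 < x ^ r := by positivity
    field_simp
  · rw [if_neg hc, mul_zero, lc]
    split_ifs
    · positivity
    · simp

theorem z_theorem (p : ℝ) (hp : 1 < p) : ∃ C : ℝ, 0 < C ∧ ∀ (n : ℕ → ℕ) (_ : Monotone n) (N : ℕ)
    (g : ℤ → ℂ) (W : Finset ℤ) (_ : ∀ k ∉ W, g k = 0) (K : Finset ℤ),
    ∑ k ∈ K, ‖V n N g k‖ ^ p ≤ C * ∑ k ∈ W, ‖g k‖ ^ p := by
  classical
  set r : ℝ := (1 + p) / 2 with hr'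
  have hr : 1 < r := by rw [hr']; linarith
  have hrp : r < p := by rw [hr']; linarith
  have hc0 : 0 < 1 - 1 / r := by
    have : 1 / r < 1 := by rw [div_lt_one (by linarith)]; exact hr
    linarith
  have h4p : (0:ℝ) < (4:ℝ) ^ (-p) := by positivity
  set γ : ℝ := min (min (1 / 10000) ((1 - 1 / r) / 384)) ((4:ℝ) ^ (-p) / 32000) with hγ'
  have hγ : 0 < γ := by
    rw [hγ']; refine lt_min (lt_min (by norm_num) (by positivity)) (by positivity)
  have g1 : γ ≤ 1 / 10000 := (min_le_left _ _).trans (min_le_left _ _)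
  have g2 : γ ≤ (1 - 1 / r) / 384 := (min_le_left _ _).trans (min_le_right _ _)
  have g3 : γ ≤ (4:ℝ) ^ (-p) / 32000 := min_le_right _ _
  have hγ1 : 10000 * γ ≤ 1 := by linarith
  have hγ2 : 384 * γ ^ 2 / (1 - 1 / r) ≤ 1 := by
    rw [div_le_one hc0]
    nlinarith
  set c : ℝ := (8 * γ ^ (-r) * p / (p - r)) * (4 / γ) ^ (p - r) with hc
  have hpr : 0 < p - r := by linarith
  have hcpos : 0 < c := by
    have : 0 < p := by linarith
    positivity
  refine ⟨2 * 4 ^ p * c, by positivity, ?_⟩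
  intro n hn N g W hW K
  set S : Finset ℤ := W.biUnion (fun w => (range (n N + 1)).image (fun j : ℕ => w - (j:ℤ))) with hSdef
  have hS : ∀ k ∉ S, V n N g k = 0 := by
    intro k hk
    have hz : ∀ j : ℕ, j ≤ n N → g (k + j) = 0 := by
      intro j hj
      apply hW
      intro hmem
      apply hk
      rw [hSdef, mem_biUnion]
      refine ⟨_, hmem, ?_⟩
      rw [mem_image]
      exact ⟨j, by rw [mem_range]; omega, by ring⟩
    have hav : ∀ t, t ≤ n N → av t g k = 0 := by
      intro t ht
      unfold av
      rw [sum_eq_zero, mul_zero]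
      intro j hj
      rw [mem_range] at hj
      exact hz j (by omega)
    ext i
    simp only [V, PiLp.zero_apply]
    rw [hav _ (hn (by have := i.2; omega)), hav _ (hn (by have := i.2; omega)), sub_zero]
  have hint := integrated n hn N g W hW S hS p r hr hrp γ hγ hγ1 hγ2
  have e1 : ∑ k ∈ S, (‖V n N g k‖ / 4) ^ p = 4 ^ (-p) * ∑ k ∈ S, ‖V n N g k‖ ^ p := by
    rw [mul_sum]
    refine sum_congr rfl fun k _ => ?_
    rw [Real.div_rpow (norm_nonneg _) (by norm_num), Real.rpow_neg (by norm_num)]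
    ring
  have e2 : (∑ k ∈ W, (8 * γ ^ (-r) * p / (p - r)) * ‖g k‖ ^ r * (4 * ‖g k‖ / γ) ^ (p - r)) =
      c * ∑ k ∈ W, ‖g k‖ ^ p := by
    rw [mul_sum]
    refine sum_congr rfl fun k _ => ?_
    have : 4 * ‖g k‖ / γ = (4 / γ) * ‖g k‖ := by ring
    rw [this, Real.mul_rpow (by positivity) (norm_nonneg _)]
    have e3 : ‖g k‖ ^ p = ‖g k‖ ^ r * ‖g k‖ ^ (p - r) := by
      rw [← Real.rpow_add_of_nonneg (norm_nonneg _) (by linarith) hpr.le]; ring_nf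
    rw [e3, hc]; ring
  rw [e1, e2] at hint
  have hX0 : 0 ≤ ∑ k ∈ S, ‖V n N g k‖ ^ p := sum_nonneg fun _ _ => by positivity
  have hle : ∑ k ∈ S, ‖V n N g k‖ ^ p ≤ 2 * 4 ^ p * c * ∑ k ∈ W, ‖g k‖ ^ p := by
    have e4 : (4:ℝ) ^ p * 4 ^ (-p) = 1 := by
      rw [← Real.rpow_add (by norm_num)]; simp
    have h5 : 16000 * γ * ∑ k ∈ S, ‖V n N g k‖ ^ p ≤ (4:ℝ) ^ (-p) / 2 * ∑ k ∈ S, ‖V n N g k‖ ^ p := by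
      apply mul_le_mul_of_nonneg_right _ hX0
      linarith
    have h6 : (4:ℝ) ^ (-p) * ∑ k ∈ S, ‖V n N g k‖ ^ p ≤ 2 * (c * ∑ k ∈ W, ‖g k‖ ^ p) := by linarith
    have h7 := mul_le_mul_of_nonneg_left h6 (show (0:ℝ) ≤ 4 ^ p by positivity)
    rw [← mul_assoc, e4, one_mul] at h7
    linarith
  refine le_trans ?_ hle
  apply sum_le_of_supp (fun k => ‖V n N g k‖ ^ p) S (fun _ => by positivity)
  intro k hk
  rw [hS k hk, norm_zero, Real.zero_rpow (by linarith)]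

end QME


namespace QME

section haar
variable {N : ℕ}

lemma haar_map (U : EuclideanSpace ℂ (Fin N) ≃ₗᵢ[ℂ] EuclideanSpace ℂ (Fin N)) :
    Measure.map U (Measure.addHaar : Measure (EuclideanSpace ℂ (Fin N))) = Measure.addHaar := by
  set μ : Measure (EuclideanSpace ℂ (Fin N)) := Measure.addHaar
  have h1 : Measure.IsAddHaarMeasure (Measure.map U μ) :=
    U.toContinuousLinearEquiv.isAddHaarMeasure_map μ
  have h2 := Measure.isAddLeftInvariant_eq_smul (Measure.map U μ) μ
  set c := Measure.addHaarScalarFactor (Measure.map U μ) μ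
  have hb : Measure.map U μ (Metric.closedBall 0 1) = μ (Metric.closedBall 0 1) := by
    rw [Measure.map_apply U.continuous.measurable measurableSet_closedBall]
    congr 1
    ext z
    simp
  rw [h2, Measure.smul_apply] at hb
  have h3 : μ (Metric.closedBall 0 1) ≠ 0 := (Metric.measure_closedBall_pos μ 0 one_pos).ne'
  have h4 : μ (Metric.closedBall 0 1) ≠ ∞ := measure_closedBall_lt_top.ne
  have h5 : c = 1 := by
    rw [ENNReal.smul_def, smul_eq_mul] at hb
    have := (ENNReal.mul_eq_right h3 h4).mp hb
    exact_mod_cast this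
  rw [h2, h5, one_smul]

noncomputable def bm (N : ℕ) : Measure (EuclideanSpace ℂ (Fin N)) :=
  (Measure.addHaar : Measure (EuclideanSpace ℂ (Fin N))).restrict (Metric.closedBall 0 1)

instance : IsFiniteMeasure (bm N) := by
  constructor
  rw [bm, Measure.restrict_apply_univ]
  exact measure_closedBall_lt_top

lemma bm_map (U : EuclideanSpace ℂ (Fin N) ≃ₗᵢ[ℂ] EuclideanSpace ℂ (Fin N)) :
    Measure.map U (bm N) = bm N := by
  have : U ⁻¹' (Metric.closedBall 0 1) = Metric.closedBall 0 1 := by ext z; simp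
  unfold bm
  conv_rhs => rw [← haar_map U, Measure.restrict_map U.continuous.measurable measurableSet_closedBall, this]

noncomputable def ph (q : ℝ) (a : EuclideanSpace ℂ (Fin N)) : ℝ≥0∞ :=
  ∫⁻ z, ‖(inner ℂ z a : ℂ)‖ₑ ^ q ∂(bm N)

lemma ph_unitary (q : ℝ) (U : EuclideanSpace ℂ (Fin N) ≃ₗᵢ[ℂ] EuclideanSpace ℂ (Fin N))
    (a : EuclideanSpace ℂ (Fin N)) : ph q (U a) = ph q a := by
  unfold ph
  conv_lhs => rw [← bm_map U]
  rw [lintegral_map (by fun_prop) U.continuous.measurable]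
  simp

lemma ph_smul (q : ℝ) (hq : 0 < q) (c : ℂ) (a : EuclideanSpace ℂ (Fin N)) :
    ph q (c • a) = ‖c‖ₑ ^ q * ph q a := by
  unfold ph
  rw [← lintegral_const_mul' _ _ (by simp [hq.le, ENNReal.rpow_eq_top_iff])]
  congr 1
  ext z
  rw [inner_smul_right, enorm_mul, ENNReal.mul_rpow_of_nonneg _ _ hq.le]

lemma exists_unitary (a b : EuclideanSpace ℂ (Fin N)) (ha : ‖a‖ = 1) (hb : ‖b‖ = 1) :
    ∃ U : EuclideanSpace ℂ (Fin N) ≃ₗᵢ[ℂ] EuclideanSpace ℂ (Fin N), U a = b := by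
  set L : (ℂ ∙ a) →ₗᵢ[ℂ] EuclideanSpace ℂ (Fin N) :=
    (LinearIsometry.toSpanSingleton ℂ (EuclideanSpace ℂ (Fin N)) hb).comp
      (LinearIsometryEquiv.toSpanUnitSingleton a ha).symm.toLinearIsometry with hL
  refine ⟨L.extend.toLinearIsometryEquiv rfl, ?_⟩
  have h1 := L.extend_apply ⟨a, Submodule.mem_span_singleton_self a⟩
  rw [LinearIsometry.coe_toLinearIsometryEquiv]
  refine h1.trans ?_
  have h2 : (LinearIsometryEquiv.toSpanUnitSingleton a ha).symm
      ⟨a, Submodule.mem_span_singleton_self a⟩ = (1:ℂ) := by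
    rw [LinearIsometryEquiv.symm_apply_eq]
    apply Subtype.ext
    simp
  simp [hL, h2]

lemma ph_eq (q : ℝ) (hq : 0 < q) (e a : EuclideanSpace ℂ (Fin N)) (he : ‖e‖ = 1) :
    ph q a = ‖a‖ₑ ^ q * ph q e := by
  by_cases ha : a = 0
  · rw [ha, ← zero_smul ℂ e, ph_smul q hq]; simp [hq]
  · have hn : ‖a‖ ≠ 0 := norm_ne_zero_iff.mpr ha
    set b : EuclideanSpace ℂ (Fin N) := ((‖a‖:ℂ)⁻¹) • a with hb
    have hb1 : ‖b‖ = 1 := by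
      rw [hb, norm_smul, norm_inv, Complex.norm_real, norm_norm, inv_mul_cancel₀ hn]
    obtain ⟨U, hU⟩ := exists_unitary e b he hb1
    have e1 : a = (‖a‖:ℂ) • b := by
      rw [hb, smul_smul, mul_inv_cancel₀ (by exact_mod_cast hn), one_smul]
    conv_lhs => rw [e1]
    rw [ph_smul q hq, ← hU, ph_unitary]
    congr 2
    rw [← ofReal_norm, ← ofReal_norm, Complex.norm_real, norm_norm]

lemma ph_ne_top (q : ℝ) (hq : 0 < q) (e : EuclideanSpace ℂ (Fin N)) (he : ‖e‖ = 1) :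
    ph q e ≠ ∞ := by
  have : ph q e ≤ ∫⁻ z, 1 ∂(bm N) := by
    unfold ph bm
    apply setLIntegral_mono' measurableSet_closedBall
    intro z hz
    rw [mem_closedBall_zero_iff] at hz
    apply ENNReal.rpow_le_one _ hq.le
    rw [← ofReal_norm]
    rw [ENNReal.ofReal_le_one]
    have := norm_inner_le_norm (𝕜 := ℂ) z e
    rw [he, mul_one] at this
    exact this.trans hz
  rw [lintegral_one] at this
  exact ne_top_of_le_ne_top (measure_ne_top _ _) this

lemma ph_ne_zero (q : ℝ) (hq : 0 < q) (e : EuclideanSpace ℂ (Fin N)) (he : ‖e‖ = 1) :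
    ph q e ≠ 0 := by
  unfold ph
  intro h
  rw [lintegral_eq_zero_iff (by fun_prop)] at h
  have hopen : IsOpen (Metric.ball (0 : EuclideanSpace ℂ (Fin N)) 1 ∩ {z | (inner ℂ z e : ℂ) ≠ 0}) := by
    refine Metric.isOpen_ball.inter (isOpen_ne_fun (by fun_prop) (by fun_prop))
  have hne : (Metric.ball (0 : EuclideanSpace ℂ (Fin N)) 1 ∩ {z | (inner ℂ z e : ℂ) ≠ 0}).Nonempty := by
    refine ⟨(1/2 : ℂ) • e, ?_, ?_⟩
    · rw [mem_ball_zero_iff, norm_smul, he]; norm_num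
    · rw [Set.mem_ofPred_eq, inner_smul_left, inner_self_eq_norm_sq_to_K, he]; norm_num
  have hpos := hopen.measure_pos Measure.addHaar hne
  refine hpos.ne' ?_
  have h2 : bm N {z | (inner ℂ z e : ℂ) ≠ 0} = 0 := by
    refine measure_mono_null ?_ (ae_iff.mp h)
    intro z hz
    rw [Set.mem_ofPred_eq] at *
    simp only [Pi.zero_apply]
    intro h0
    rw [ENNReal.rpow_eq_zero_iff_of_pos hq, enorm_eq_zero] at h0
    exact hz h0
  unfold bm at h2
  rw [Measure.restrict_apply' measurableSet_closedBall] at h2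
  refine measure_mono_null ?_ h2
  rw [Set.inter_comm]
  exact Set.inter_subset_inter_right _ Metric.ball_subset_closedBall

end haar

/-- vector of representatives -/
noncomputable def vec {X : Type*} {N : ℕ} (f : Fin N → X → ℂ) (ω : X) : EuclideanSpace ℂ (Fin N) :=
  WithLp.toLp 2 (fun i => f i ω)

lemma joint_meas {X : Type*} [MeasurableSpace X] {N : ℕ} (v : X → EuclideanSpace ℂ (Fin N))
    (hv : Measurable v) (q : ℝ) :
    Measurable (Function.uncurry fun (ω : X) (z : EuclideanSpace ℂ (Fin N)) =>
      ‖(inner ℂ z (v ω) : ℂ)‖ₑ ^ q) := by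
  have h1 : Measurable (fun x : X × EuclideanSpace ℂ (Fin N) => v x.1) := hv.comp measurable_fst
  have h2 : Measurable (fun x : X × EuclideanSpace ℂ (Fin N) => (inner ℂ x.2 (v x.1) : ℂ)) :=
    Measurable.inner measurable_snd h1
  exact h2.enorm.pow_const q

lemma l2_ext {X : Type*} [MeasurableSpace X] {μ : Measure X} [SigmaFinite μ] {p : ℝ≥0∞}
    [Fact (1 ≤ p)] (hp0 : p ≠ 0) (hp' : p ≠ ∞) (S : Lp ℂ p μ →L[ℂ] Lp ℂ p μ) (hS : ∀ x, ‖S x‖ = ‖x‖)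
    (N : ℕ) (f : Fin N → Lp ℂ p μ) :
    ∫⁻ ω, ‖vec (fun i => (f i : X → ℂ)) ω‖ₑ ^ p.toReal ∂μ =
      ∫⁻ ω, ‖vec (fun i => (S (f i) : X → ℂ)) ω‖ₑ ^ p.toReal ∂μ := by
  have hq : 0 < p.toReal := ENNReal.toReal_pos hp0 hp'
  rcases Nat.eq_zero_or_pos N with hN | hN
  · subst hN
    congr 1
    ext ω
    congr 2
    exact Subsingleton.elim _ _
  set e : EuclideanSpace ℂ (Fin N) := EuclideanSpace.single ⟨0, hN⟩ 1 with he'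
  have he : ‖e‖ = 1 := by simp [he']
  have hm : ∀ f : Fin N → Lp ℂ p μ, Measurable (vec (fun i => (f i : X → ℂ))) := by
    intro f
    unfold vec
    have : Measurable (fun ω => fun i => (f i : X → ℂ) ω) :=
      measurable_pi_lambda _ fun i => (Lp.stronglyMeasurable (f i)).measurable
    exact (PiLp.continuous_toLp 2 (fun _ : Fin N => ℂ)).measurable.comp this
  have key : ∀ f : Fin N → Lp ℂ p μ,
      (∫⁻ ω, ‖vec (fun i => (f i : X → ℂ)) ω‖ₑ ^ p.toReal ∂μ) * ph p.toReal e =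
      ∫⁻ z, ‖∑ i, (starRingEnd ℂ (z i)) • f i‖ₑ ^ p.toReal ∂(bm N) := by
    intro f
    rw [← lintegral_mul_const' _ _ (ph_ne_top _ hq e he)]
    simp_rw [← ph_eq p.toReal hq e _ he]
    unfold ph
    rw [lintegral_lintegral_swap]
    · congr 1
      ext z
      rw [Lp.enorm_def, eLpNorm_eq_lintegral_rpow_enorm_toReal hp0 hp', ← ENNReal.rpow_mul,
        one_div_mul_cancel hq.ne', ENNReal.rpow_one]
      apply lintegral_congr_ae
      have h1 : ((∑ i, (starRingEnd ℂ (z i)) • f i : Lp ℂ p μ) : X → ℂ) =ᵐ[μ]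
          fun ω => ∑ i, (starRingEnd ℂ (z i)) * (f i : X → ℂ) ω := by
        refine (Lp.coeFn_finsetSum _ _).trans ?_
        have h2 : ∀ᵐ ω ∂μ, ∀ i, (((starRingEnd ℂ (z i)) • f i : Lp ℂ p μ) : X → ℂ) ω =
            (starRingEnd ℂ (z i)) * (f i : X → ℂ) ω := by
          rw [ae_all_iff]
          intro i
          filter_upwards [Lp.coeFn_smul (starRingEnd ℂ (z i)) (f i)] with ω h
          rw [h]; simp
        filter_upwards [h2] with ω h
        simp [h]
      filter_upwards [h1] with ω h
      rw [h]
      simp [vec, PiLp.inner_apply, mul_comm]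
    · exact (joint_meas _ (hm f) p.toReal).aemeasurable
  have h3 : (∫⁻ ω, ‖vec (fun i => (f i : X → ℂ)) ω‖ₑ ^ p.toReal ∂μ) * ph p.toReal e =
      (∫⁻ ω, ‖vec (fun i => (S (f i) : X → ℂ)) ω‖ₑ ^ p.toReal ∂μ) * ph p.toReal e := by
    rw [key, key]
    refine lintegral_congr fun z => ?_
    have : ∑ i, (starRingEnd ℂ (z i)) • S (f i) = S (∑ i, (starRingEnd ℂ (z i)) • f i) := by
      rw [map_sum]; simp
    rw [this, ← ofReal_norm, ← ofReal_norm, hS]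
  exact (ENNReal.mul_left_inj (ph_ne_zero _ hq e he) (ph_ne_top _ hq e he)).mp h3

end QME

namespace QME

section transfer
variable {X : Type*} [MeasurableSpace X] {μ : Measure X} {p : ℝ≥0∞} [Fact (1 ≤ p)]

lemma pow_isom (T : Lp ℂ p μ →L[ℂ] Lp ℂ p μ) (hT : ∀ x, ‖T x‖ = ‖x‖) (k : ℕ) (x : Lp ℂ p μ) :
    ‖(T ^ k) x‖ = ‖x‖ := by
  induction k with
  | zero => simp
  | succ k ih => rw [pow_succ', ContinuousLinearMap.mul_apply, hT, ih]

/-- orbit of a point -/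
noncomputable def orb (T : Lp ℂ p μ →L[ℂ] Lp ℂ p μ) (x : Lp ℂ p μ) (L : ℕ) (ω : X) (k : ℤ) : ℂ :=
  if k ∈ Finset.Ico (0:ℤ) L then ((T ^ k.toNat) x : X → ℂ) ω else 0

lemma orb_nat (T : Lp ℂ p μ →L[ℂ] Lp ℂ p μ) (x : Lp ℂ p μ) (L : ℕ) (ω : X) (k : ℕ) (hk : k < L) :
    orb T x L ω k = ((T ^ k) x : X → ℂ) ω := by
  unfold orb
  rw [if_pos (by rw [Finset.mem_Ico]; omega), Int.toNat_natCast]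

lemma erg_pow (T : Lp ℂ p μ →L[ℂ] Lp ℂ p μ) (x : Lp ℂ p μ) (n k : ℕ) :
    (T ^ k) (ergAvg T n x) = ((n:ℂ)+1)⁻¹ • ∑ j ∈ range (n+1), (T ^ (k + j)) x := by
  unfold ergAvg
  rw [ContinuousLinearMap.smul_apply, map_smul, ContinuousLinearMap.sum_apply, map_sum]
  congr 1
  refine sum_congr rfl fun j _ => ?_
  rw [pow_add, ContinuousLinearMap.mul_apply]

lemma erg_ae (T : Lp ℂ p μ →L[ℂ] Lp ℂ p μ) (x : Lp ℂ p μ) (n k L : ℕ) (hL : k + n < L) :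
    ∀ᵐ ω ∂μ, ((T ^ k) (ergAvg T n x) : X → ℂ) ω = av n (orb T x L ω) k := by
  rw [erg_pow]
  filter_upwards [Lp.coeFn_smul (((n:ℂ)+1)⁻¹) (∑ j ∈ range (n+1), (T ^ (k + j)) x),
    Lp.coeFn_finsetSum (range (n+1)) (fun j => (T ^ (k + j)) x)] with ω h1 h2
  rw [h1, Pi.smul_apply, h2, av, smul_eq_mul, Finset.sum_apply]
  congr 1
  refine sum_congr rfl fun j hj => ?_
  rw [mem_range] at hj
  have : (k:ℤ) + (j:ℤ) = ((k + j : ℕ) : ℤ) := by push_cast; ring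
  rw [this, orb_nat T x L ω (k+j) (by omega)]

lemma vec_ae (T : Lp ℂ p μ →L[ℂ] Lp ℂ p μ) (x : Lp ℂ p μ) (n : ℕ → ℕ) (hn : Monotone n) (N k L : ℕ)
    (hL : k + n N < L) :
    ∀ᵐ ω ∂μ, vec (fun i : Fin N =>
      ((T ^ k) (ergAvg T (n i) x - ergAvg T (n (i+1)) x) : X → ℂ)) ω = V n N (orb T x L ω) k := by
  have h1 : ∀ᵐ ω ∂μ, ∀ i : Fin N,
      ((T ^ k) (ergAvg T (n i) x - ergAvg T (n (i+1)) x) : X → ℂ) ω =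
        av (n i) (orb T x L ω) k - av (n (i+1)) (orb T x L ω) k := by
    rw [ae_all_iff]
    intro i
    have b1 : n i ≤ n N := hn (by have := i.2; omega)
    have b2 : n (i+1) ≤ n N := hn (by have := i.2; omega)
    rw [map_sub]
    filter_upwards [erg_ae T x (n i) k L (by omega), erg_ae T x (n (i+1)) k L (by omega),
      Lp.coeFn_sub ((T ^ k) (ergAvg T (n i) x)) ((T ^ k) (ergAvg T (n (i+1)) x))] with ω h1 h2 h3
    rw [h3, Pi.sub_apply, h1, h2]
  filter_upwards [h1] with ω h
  ext i
  simp only [vec, V, h]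

lemma enorm_rpow {E : Type*} [SeminormedAddCommGroup E] (v : E) (q : ℝ) (hq : 0 ≤ q) :
    ‖v‖ₑ ^ q = ENNReal.ofReal (‖v‖ ^ q) := by
  rw [← ofReal_norm, ENNReal.ofReal_rpow_of_nonneg (norm_nonneg _) hq]

lemma lint_Lp (hp0 : p ≠ 0) (hp' : p ≠ ∞) (x : Lp ℂ p μ) :
    ∫⁻ ω, ‖(x : X → ℂ) ω‖ₑ ^ p.toReal ∂μ = ‖x‖ₑ ^ p.toReal := by
  have hq : 0 < p.toReal := ENNReal.toReal_pos hp0 hp'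
  rw [Lp.enorm_def, eLpNorm_eq_lintegral_rpow_enorm_toReal hp0 hp', ← ENNReal.rpow_mul,
        one_div_mul_cancel hq.ne', ENNReal.rpow_one]

lemma transfer [SigmaFinite μ] (hp0 : p ≠ 0) (hp' : p ≠ ∞) (C : ℝ) (hC : 0 < C)
    (T : Lp ℂ p μ →L[ℂ] Lp ℂ p μ) (hT : ∀ x, ‖T x‖ = ‖x‖) (n : ℕ → ℕ) (hn : Monotone n) (N : ℕ)
    (hz : ∀ (g : ℤ → ℂ) (W : Finset ℤ) (_ : ∀ k ∉ W, g k = 0) (K : Finset ℤ),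
      ∑ k ∈ K, ‖V n N g k‖ ^ p.toReal ≤ C * ∑ k ∈ W, ‖g k‖ ^ p.toReal) (x : Lp ℂ p μ) :
    ∫⁻ ω, ‖vec (fun i : Fin N => ((ergAvg T (n i) x - ergAvg T (n (i+1)) x : Lp ℂ p μ) : X → ℂ)) ω‖ₑ
      ^ p.toReal ∂μ ≤ ENNReal.ofReal (2 * C) * ‖x‖ₑ ^ p.toReal := by
  have hq : 0 < p.toReal := ENNReal.toReal_pos hp0 hp'
  set A := ∫⁻ ω, ‖vec (fun i : Fin N => ((ergAvg T (n i) x - ergAvg T (n (i+1)) x : Lp ℂ p μ) : X → ℂ)) ω‖ₑ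
      ^ p.toReal ∂μ with hA
  set K : ℕ := n N + 1 with hK
  set L : ℕ := 2 * K with hL
  have h1 : ∀ k ∈ range K, A = ∫⁻ ω, ‖vec (fun i : Fin N =>
      ((T ^ k) (ergAvg T (n i) x - ergAvg T (n (i+1)) x) : X → ℂ)) ω‖ₑ ^ p.toReal ∂μ :=
    fun k _ => l2_ext hp0 hp' (T ^ k) (pow_isom T hT k) N
      (fun i => ergAvg T (n i) x - ergAvg T (n (i+1)) x)
  have hm : ∀ k : ℕ, Measurable (fun ω => ‖vec (fun i : Fin N =>
      ((T ^ k) (ergAvg T (n i) x - ergAvg T (n (i+1)) x) : X → ℂ)) ω‖ₑ ^ p.toReal) := by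
    intro k
    have h2 : Measurable (fun ω => fun i : Fin N =>
      ((T ^ k) (ergAvg T (n i) x - ergAvg T (n (i+1)) x) : X → ℂ) ω) :=
      measurable_pi_lambda _ fun i => (Lp.stronglyMeasurable _).measurable
    have h3 := (PiLp.continuous_toLp 2 (fun _ : Fin N => ℂ)).measurable.comp h2
    exact h3.enorm.pow_const _
  have h2 : (K:ℝ≥0∞) * A = ∫⁻ ω, ∑ k ∈ range K, ‖vec (fun i : Fin N =>
      ((T ^ k) (ergAvg T (n i) x - ergAvg T (n (i+1)) x) : X → ℂ)) ω‖ₑ ^ p.toReal ∂μ := by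
    rw [lintegral_finsetSum _ (fun k _ => hm k), ← sum_congr rfl h1]
    simp
  have h3 : ∀ᵐ ω ∂μ, ∀ k ∈ range K, vec (fun i : Fin N =>
      ((T ^ k) (ergAvg T (n i) x - ergAvg T (n (i+1)) x) : X → ℂ)) ω = V n N (orb T x L ω) k := by
    refine (Filter.eventually_all_finset (range K)).mpr ?_
    intro k hk
    rw [mem_range] at hk
    exact vec_ae T x n hn N k L (by omega)
  have h4 : (K:ℝ≥0∞) * A ≤ ∫⁻ ω, ENNReal.ofReal C * ∑ k ∈ range L, ‖((T ^ k) x : X → ℂ) ω‖ₑ ^ p.toReal ∂μ := by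
    rw [h2]
    apply lintegral_mono_ae
    filter_upwards [h3] with ω hω
    rw [sum_congr rfl (fun k hk => by rw [hω k hk])]
    simp_rw [enorm_rpow _ _ hq.le]
    rw [← ENNReal.ofReal_sum_of_nonneg (fun _ _ => by positivity),
      ← ENNReal.ofReal_sum_of_nonneg (fun _ _ => by positivity), ← ENNReal.ofReal_mul hC.le]
    apply ENNReal.ofReal_le_ofReal
    have h5 := hz (orb T x L ω) (Finset.Ico (0:ℤ) L) (fun k hk => by unfold orb; rw [if_neg hk])
      ((range K).map Nat.castEmbedding)
    rw [sum_map] at h5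
    refine h5.trans (le_of_eq ?_)
    congr 1
    have h6 : Finset.Ico (0:ℤ) L = (range L).map Nat.castEmbedding := by
      ext k
      simp only [Finset.mem_Ico, mem_map, mem_range, Nat.castEmbedding_apply]
      constructor
      · intro h; exact ⟨k.toNat, by omega, by omega⟩
      · rintro ⟨a, ha, rfl⟩; omega
    rw [h6, sum_map]
    refine sum_congr rfl fun k hk => ?_
    rw [mem_range] at hk
    rw [Nat.castEmbedding_apply, orb_nat T x L ω k hk]
  have h5 : ∫⁻ ω, ENNReal.ofReal C * ∑ k ∈ range L, ‖((T ^ k) x : X → ℂ) ω‖ₑ ^ p.toReal ∂μ =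
      ENNReal.ofReal C * (L * ‖x‖ₑ ^ p.toReal) := by
    rw [lintegral_const_mul' _ _ ENNReal.ofReal_ne_top, lintegral_finsetSum _ (fun k _ =>
      (Lp.stronglyMeasurable _).measurable.enorm.pow_const _)]
    congr 1
    have : ∀ k ∈ range L, ∫⁻ ω, ‖((T ^ k) x : X → ℂ) ω‖ₑ ^ p.toReal ∂μ = ‖x‖ₑ ^ p.toReal := by
      intro k _
      rw [lint_Lp hp0 hp', ← ofReal_norm, ← ofReal_norm, pow_isom T hT]
    rw [sum_congr rfl this]
    simp
  rw [h5] at h4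
  have hK0 : (K:ℝ≥0∞) ≠ 0 := Nat.cast_ne_zero.mpr (by omega)
  have h6 : (K:ℝ≥0∞) * A ≤ (K:ℝ≥0∞) * (ENNReal.ofReal (2 * C) * ‖x‖ₑ ^ p.toReal) := by
    refine h4.trans (le_of_eq ?_)
    rw [ENNReal.ofReal_mul (by norm_num), hL]
    push_cast
    rw [ENNReal.ofReal_ofNat]
    ring
  exact (ENNReal.mul_le_mul_iff_right hK0 (ENNReal.natCast_ne_top K)).mp h6

end transfer

end QME


/-- Commutative case of Lemma 7.6: quantitative mean ergodic inequality for isometries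
of `L^p` (for `2 ≤ p < ∞`, or `1 < p < 2` with positivity). -/
theorem quantitative_mean_ergodic_isometry
    (p : ℝ≥0∞) [Fact (1 ≤ p)] (hp : 1 < p) (hp' : p ≠ ∞) :
    ∃ C : ℝ, 0 < C ∧
      ∀ (X : Type) [MeasurableSpace X] (μ : Measure X) [SigmaFinite μ]
        (T : Lp ℂ p μ →L[ℂ] Lp ℂ p μ),
        (∀ x : Lp ℂ p μ, ‖T x‖ = ‖x‖) →
        (2 ≤ p ∨ (p < 2 ∧ IsPositiveOp T)) →
        ∀ (N : ℕ) (n : ℕ → ℕ), StrictMono n → (∀ i, 0 < n i) →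
        ∀ x : Lp ℂ p μ,
          eLpNorm
            (fun ω => (∑ i ∈ Finset.range N,
                ‖(ergAvg T (n i) x) ω - (ergAvg T (n (i + 1)) x) ω‖ ^ 2 : ℝ)
              ^ (1 / 2 : ℝ)) p μ
          ≤ ENNReal.ofReal (C * ‖x‖) := by
  have hp0 : p ≠ 0 := (lt_trans one_pos hp).ne'
  have hq : 0 < p.toReal := ENNReal.toReal_pos hp0 hp'
  have hq1 : 1 < p.toReal := by
    rw [← ENNReal.toReal_one]
    exact (ENNReal.toReal_lt_toReal ENNReal.one_ne_top hp').mpr hp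
  obtain ⟨C, hC, hz⟩ := QME.z_theorem p.toReal hq1
  refine ⟨(2 * C) ^ (1 / p.toReal), by positivity, ?_⟩
  intro X _ μ _ T hT _ N n hn _ x
  have key := QME.transfer hp0 hp' C hC T hT n hn.monotone N (hz n hn.monotone N) x
  have hae : (fun ω => (∑ i ∈ Finset.range N,
      ‖(ergAvg T (n i) x) ω - (ergAvg T (n (i + 1)) x) ω‖ ^ 2 : ℝ) ^ (1 / 2 : ℝ)) =ᵐ[μ]
      fun ω => ‖QME.vec (fun i : Fin N =>
        ((ergAvg T (n i) x - ergAvg T (n (i+1)) x : Lp ℂ p μ) : X → ℂ)) ω‖ := by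
    have h1 : ∀ᵐ ω ∂μ, ∀ i : Fin N,
        ((ergAvg T (n i) x - ergAvg T (n (i+1)) x : Lp ℂ p μ) : X → ℂ) ω =
        (ergAvg T (n i) x) ω - (ergAvg T (n (i + 1)) x) ω := by
      rw [ae_all_iff]
      intro i
      filter_upwards [Lp.coeFn_sub (ergAvg T (n i) x) (ergAvg T (n (i+1)) x)] with ω h
      rw [h, Pi.sub_apply]
    filter_upwards [h1] with ω h
    rw [EuclideanSpace.norm_eq, Real.sqrt_eq_rpow, Finset.sum_range]
    simp only [QME.vec, h]
  rw [eLpNorm_congr_ae hae, eLpNorm_norm, eLpNorm_eq_lintegral_rpow_enorm_toReal hp0 hp']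
  refine (ENNReal.rpow_le_rpow key (by positivity)).trans (le_of_eq ?_)
  rw [ENNReal.mul_rpow_of_nonneg _ _ (by positivity), ← ENNReal.rpow_mul,
    mul_one_div_cancel hq.ne', ENNReal.rpow_one,
    ENNReal.ofReal_rpow_of_nonneg (by positivity) (by positivity), ← ofReal_norm,
    ← ENNReal.ofReal_mul (by positivity)]
end

section
/- (Commutative strengthening of the Avigad–Rute inequality, cf. Remark (ii) after Theorem 1.3.) Let (X, μ) be a σ-finite measure space, 2 ≤ p < ∞, and let T : L^p(X, μ) → L^p(X, μ) be an invertible bounded linear operator with K := sup_{k∈ℤ} ‖T^k‖ < ∞. Then there exists a constant C depending only on p and K such that for every N ∈ ℕ, every strictly increasing finite sequence n_0 < n_1 < ⋯ < n_N of positive integers, and every x ∈ L^p(X, μ): ∑_{i=0}^{N-1} ‖ M_{n_i}(T)x − M_{n_{i+1}}(T)x ‖_{L^p(X,μ)}^p ≤ C^p ‖x‖_{L^p(X,μ)}^p. (This follows from the square function inequality of Theorem 1.1 together with the pointwise estimate ∑_i |g_i|^p ≤ (∑_i |g_i|^2)^{p/2} valid for p ≥ 2.) -/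
open MeasureTheory Finset ENNReal

section Abstract
variable {E : Type*} [AddCommGroup E] [Module ℝ E]

noncomputable def avA (T : E →ₗ[ℝ] E) (x : E) (n : ℕ) : E :=
  (n : ℝ)⁻¹ • ∑ k ∈ Finset.range n, (T ^ k) x

noncomputable def avB (a : ℕ → ℝ) : ℕ → ℝ
  | 0 => a 0
  | k + 1 => 3 / 4 * avB a k + a (k + 1)

lemma avA_smul (T : E →ₗ[ℝ] E) (x : E) (n : ℕ) :
    (n : ℝ) • avA T x n = ∑ k ∈ Finset.range n, (T ^ k) x := by
  rcases Nat.eq_zero_or_pos n with rfl | hn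
  · simp
  · have : (n : ℝ) ≠ 0 := by positivity
    rw [avA, smul_smul, mul_inv_cancel₀ this, one_smul]

lemma avS_add (T : E →ₗ[ℝ] E) (x : E) (n r : ℕ) :
    ∑ k ∈ Finset.range (n + r), (T ^ k) x =
      ∑ k ∈ Finset.range n, (T ^ k) x + (T ^ n) (∑ k ∈ Finset.range r, (T ^ k) x) := by
  rw [Finset.sum_range_add, map_sum]
  congr 1
  refine Finset.sum_congr rfl fun k _ => ?_
  rw [pow_add]; rfl

lemma avA_add (T : E →ₗ[ℝ] E) (x : E) (n r : ℕ) :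
    ((n : ℝ) + r) • avA T x (n + r) = (n : ℝ) • avA T x n + (r : ℝ) • (T ^ n) (avA T x r) := by
  rw [← map_smul, avA_smul, avA_smul, ← avS_add, ← avA_smul]; push_cast; rfl

lemma avA_sub (T : E →ₗ[ℝ] E) (x : E) (n r : ℕ) (hn : 0 < n) :
    avA T x n - avA T x (n + r) = ((r : ℝ) / (n + r)) • (avA T x n - (T ^ n) (avA T x r)) := by
  have h0 : ((n : ℝ) + r) ≠ 0 := by positivity
  have h := avA_add T x n r
  have h2 : avA T x (n + r) = ((n : ℝ) + r)⁻¹ • ((n : ℝ) • avA T x n + (r : ℝ) • (T ^ n) (avA T x r)) := by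
    rw [← h, smul_smul, inv_mul_cancel₀ h0, one_smul]
  rw [h2]
  match_scalars <;> field_simp
  ring

lemma avA_double (T : E →ₗ[ℝ] E) (x : E) (n : ℕ) (hn : 0 < n) :
    avA T x n - (T ^ n) (avA T x n) = (2 : ℝ) • (avA T x n - avA T x (2 * n)) := by
  have h0 : (n : ℝ) ≠ 0 := by positivity
  rw [two_mul, avA_sub T x n n hn, smul_smul]
  rw [show (2 : ℝ) * (n / (n + n)) = 1 by field_simp; ring, one_smul]

lemma avA_mid (T : E →ₗ[ℝ] E) (x : E) (n : ℕ) (hn : 0 < n) :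
    avA T x (2 * n) = (1 / 2 : ℝ) • (avA T x n + (T ^ n) (avA T x n)) := by
  have h := avA_double T x n hn
  have : (T ^ n) (avA T x n) = avA T x n - (2 : ℝ) • (avA T x n - avA T x (2 * n)) := by
    rw [← h]; abel
  rw [this]; module

lemma avA_comm (T : E →ₗ[ℝ] E) (x : E) (n j : ℕ) (hn : 0 < n) :
    avA T x n - (T ^ j) (avA T x n) = ((j : ℝ) / n) • (avA T x j - (T ^ n) (avA T x j)) := by
  have h0 : (n : ℝ) ≠ 0 := by positivity
  have h1 := avA_add T x n j
  have h2 := avA_add T x j n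
  rw [add_comm j n, add_comm (j : ℝ) n, h1] at h2
  have h3 : (n : ℝ) • (avA T x n - (T ^ j) (avA T x n)) =
      (j : ℝ) • (avA T x j - (T ^ n) (avA T x j)) := by
    rw [smul_sub, smul_sub, sub_eq_sub_iff_add_eq_add, h2]
  rw [div_eq_inv_mul, ← smul_smul, ← h3, smul_smul, inv_mul_cancel₀ h0, one_smul]

lemma avA_mul (T : E →ₗ[ℝ] E) (x : E) (n q : ℕ) (hn : 0 < n) :
    (q : ℝ) • avA T x (q * n) = ∑ j ∈ Finset.range q, (T ^ (j * n)) (avA T x n) := by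
  have h0 : (n : ℝ) ≠ 0 := by positivity
  induction q with
  | zero => simp
  | succ q ih =>
    rw [Finset.sum_range_succ, ← ih]
    have h := avA_add T x (q * n) n
    have : (n : ℝ) • (((q + 1 : ℕ) : ℝ) • avA T x ((q + 1) * n)) =
      (n : ℝ) • ((q : ℝ) • avA T x (q * n) + (T ^ (q * n)) (avA T x n)) := by
      rw [smul_add, smul_smul, smul_smul, add_mul, one_mul]
      convert h using 2
      · push_cast; ring
      · push_cast; ring_nf
    have h5 := congrArg (fun v => (n : ℝ)⁻¹ • v) this
    simpa only [smul_smul, inv_mul_cancel₀ h0, one_smul, ← mul_assoc, one_mul] using h5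

lemma N_pow {N : Seminorm ℝ E} {T : E →ₗ[ℝ] E} (hT : ∀ y, N (T y) = N y) (j : ℕ) (y : E) :
    N ((T ^ j) y) = N y := by
  induction j with
  | zero => simp
  | succ j ih => rw [pow_succ']; change N (T ((T ^ j) y)) = _; rw [hT, ih]

lemma N_tri (N : Seminorm ℝ E) (x y z : E) : N (x - z) ≤ N (x - y) + N (y - z) := by
  have := map_add_le_add N (x - y) (y - z)
  simpa using this

/-! weights -/
lemma avB_nonneg {a : ℕ → ℝ} (ha : ∀ k, 0 ≤ a k) (k : ℕ) : 0 ≤ avB a k := by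
  induction k with
  | zero => exact ha 0
  | succ k ih => have := ha (k + 1); simp only [avB]; linarith

lemma avB_step {a : ℕ → ℝ} (ha : ∀ k, 0 ≤ a k) (k : ℕ) : avB a k ≤ 4 / 3 * avB a (k + 1) := by
  have := ha (k + 1); simp only [avB]; linarith

lemma avB_ge {a : ℕ → ℝ} (ha : ∀ k, 0 ≤ a k) (k : ℕ) : a k ≤ avB a k := by
  cases k with
  | zero => exact le_refl _
  | succ k => have := avB_nonneg ha k; simp only [avB]; linarith

lemma avB_le {a : ℕ → ℝ} (ha : ∀ k, 0 ≤ a k) (l d : ℕ) :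
    avB a l ≤ (4 / 3) ^ d * avB a (l + d) := by
  induction d with
  | zero => simp
  | succ d ih =>
    have := avB_step ha (l + d)
    have h2 : (0 : ℝ) < (4 / 3) ^ d := by positivity
    rw [pow_succ]
    have := mul_le_mul_of_nonneg_left this h2.le
    rw [← add_assoc]; linarith

lemma avB_sum {a : ℕ → ℝ} (ha : ∀ k, 0 ≤ a k) {p : ℝ} (hp : 1 ≤ p) (K : ℕ) :
    (∑ k ∈ Finset.range (K + 1), avB a k ^ p) / 4 + 3 / 4 * avB a K ^ p ≤
      4 ^ p * ∑ k ∈ Finset.range (K + 1), a k ^ p := by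
  have h4 : (1 : ℝ) ≤ 4 ^ p := Real.one_le_rpow (by norm_num) (by linarith)
  induction K with
  | zero =>
    have : 0 ≤ a 0 ^ p := Real.rpow_nonneg (ha 0) p
    simp [avB]; nlinarith
  | succ K ih =>
    rw [Finset.sum_range_succ, Finset.sum_range_succ (fun k => a k ^ p)]
    have key : avB a (K + 1) ^ p ≤ 3 / 4 * avB a K ^ p + 1 / 4 * (4 * a (K + 1)) ^ p := by
      have := (convexOn_rpow hp).2 (Set.mem_Ici.2 (avB_nonneg ha K))
        (Set.mem_Ici.2 (show 0 ≤ 4 * a (K + 1) by have := ha (K + 1); linarith))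
        (show (0 : ℝ) ≤ 3 / 4 by norm_num) (show (0 : ℝ) ≤ 1 / 4 by norm_num) (by norm_num)
      simp only [smul_eq_mul] at this
      have e : avB a (K + 1) = 3 / 4 * avB a K + 1 / 4 * (4 * a (K + 1)) := by
        simp only [avB]; ring
      rw [e]; exact this
    rw [Real.mul_rpow (by norm_num) (ha _)] at key
    have : 0 ≤ (4 : ℝ) ^ p * a (K + 1) ^ p := mul_nonneg (by linarith) (Real.rpow_nonneg (ha _) p)
    linarith

/-- Everything for a fixed vector. -/
lemma avB_dist (N : Seminorm ℝ E) (B : ℕ → E) (l d : ℕ) :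
    N (B l - B (l + d)) + N (B (l + d) - B (l + d + 1)) ≤
      (4 / 3) ^ d * avB (fun k => N (B k - B (k + 1))) (l + d) := by
  set a := fun k => N (B k - B (k + 1)) with haa
  have ha : ∀ k, 0 ≤ a k := fun k => apply_nonneg N _
  induction d with
  | zero => simpa using avB_ge ha l
  | succ d ih =>
    have h1 := N_tri N (B l) (B (l + d)) (B (l + d + 1))
    have h2 : (1 : ℝ) ≤ (4 / 3) ^ (d + 1) := one_le_pow₀ (by norm_num)
    have h3 := ha (l + d + 1)
    have h4 : avB a (l + (d + 1)) = 3 / 4 * avB a (l + d) + a (l + d + 1) := rfl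
    rw [h4, mul_add]
    have h5 : (4 / 3 : ℝ) ^ (d + 1) * (3 / 4 * avB a (l + d)) = (4 / 3) ^ d * avB a (l + d) := by
      rw [pow_succ]; ring
    rw [h5, ← add_assoc]
    change _ + a (l + d + 1) ≤ _
    nlinarith

lemma num1 (j : ℕ) : 3 / 2 * (4 / 3 : ℝ) ^ (j + 1) ≤ 2 ^ j + 1 := by
  induction j with
  | zero => norm_num
  | succ j ih =>
    have : (1 : ℝ) ≤ 2 ^ j := one_le_pow₀ (by norm_num)
    rw [pow_succ, pow_succ (2 : ℝ)]; linarith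

lemma num2 {k l r n : ℕ} (hr : r < 2 ^ (l + 1)) (hn : n = 2 ^ k + r) (d : ℕ) (hk : k = l + (d + 1)) :
    (r : ℝ) / n * (4 / 3) ^ (d + 1) ≤ 2 / 3 := by
  have h1 := num1 d
  have hr' : (r : ℝ) ≤ 2 ^ (l + 1) := by exact_mod_cast hr.le
  have hn0 : (0 : ℝ) < n := by subst hn; positivity
  have hnr : (n : ℝ) = 2 ^ (l + 1) * 2 ^ d + r := by subst hn hk; push_cast; ring
  rw [div_mul_eq_mul_div, div_le_iff₀ hn0, hnr]
  have : (0 : ℝ) ≤ 2 ^ d := by positivity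
  have hr0 : (0 : ℝ) ≤ r := by positivity
  nlinarith [mul_le_mul_of_nonneg_left h1 hr0, mul_le_mul_of_nonneg_right hr' this]

lemma g_bound (N : Seminorm ℝ E) (T : E →ₗ[ℝ] E) (hT : ∀ y, N (T y) = N y) (x : E)
    (b : ℕ → ℝ) (hb : b = avB (fun k => N (avA T x (2 ^ k) - avA T x (2 ^ (k + 1))))) (n : ℕ) (hn : 0 < n) :
    N (avA T x n - avA T x (2 ^ Nat.log 2 n)) ≤ 4 * b (Nat.log 2 n) := by
  set a := (fun k => N (avA T x (2 ^ k) - avA T x (2 ^ (k + 1)))) with haa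
  have ha : ∀ k, 0 ≤ a k := fun k => apply_nonneg N _
  have hb0 : ∀ k, 0 ≤ b k := fun k => hb ▸ avB_nonneg ha k
  induction n using Nat.strong_induction_on with
  | _ n ih =>
  set k := Nat.log 2 n with hk
  have h1 : 2 ^ k ≤ n := Nat.pow_log_le_self 2 hn.ne'
  have h2 : n < 2 ^ (k + 1) := Nat.lt_pow_succ_log_self (by norm_num) n
  obtain ⟨r, hr⟩ := Nat.exists_eq_add_of_le h1
  rcases Nat.eq_zero_or_pos r with h0 | hr0
  · have : n = 2 ^ k := by omega
    rw [← this]; simpa using hb0 k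
  have hrk : r < 2 ^ k := by rw [pow_succ] at h2; omega
  have hpk : 0 < 2 ^ k := by positivity
  have ihr := ih r (by omega) hr0
  set l := Nat.log 2 r with hl
  have hlr : 2 ^ l ≤ r := Nat.pow_log_le_self 2 hr0.ne'
  have hrl : r < 2 ^ (l + 1) := Nat.lt_pow_succ_log_self (by norm_num) r
  have hlk : l < k := by
    by_contra h
    have := Nat.pow_le_pow_right (show 0 < 2 by norm_num) (not_lt.1 h)
    omega
  obtain ⟨d, hd⟩ := Nat.exists_eq_add_of_lt hlk
  have hd' : k = l + (d + 1) := by omega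
  have e1 := avA_sub T x (2 ^ k) r hpk
  rw [← hr] at e1
  have e2 : N (avA T x n - avA T x (2 ^ k)) = (r : ℝ) / n * N (avA T x (2 ^ k) - (T ^ (2 ^ k)) (avA T x r)) := by
    rw [map_sub_rev, e1, map_smul_eq_mul, Real.norm_of_nonneg (by positivity)]
    congr 2
    rw [hr]; push_cast; ring
  have e3 : N (avA T x (2 ^ k) - (T ^ (2 ^ k)) (avA T x r)) ≤
      (4 / 3) ^ (d + 1) * (6 * b k) := by
    have t1 := N_tri N (avA T x (2 ^ k)) ((T ^ (2 ^ k)) (avA T x (2 ^ k))) ((T ^ (2 ^ k)) (avA T x r))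
    have t2 : N (avA T x (2 ^ k) - (T ^ (2 ^ k)) (avA T x (2 ^ k))) = 2 * a k := by
      rw [avA_double T x _ hpk, map_smul_eq_mul, haa]; simp [pow_succ' 2 k]
    have t3 : N ((T ^ (2 ^ k)) (avA T x (2 ^ k)) - (T ^ (2 ^ k)) (avA T x r)) =
        N (avA T x r - avA T x (2 ^ k)) := by
      rw [← map_sub, N_pow hT, map_sub_rev]
    have t4 := N_tri N (avA T x r) (avA T x (2 ^ l)) (avA T x (2 ^ k))
    have t5 := avB_dist N (fun k => avA T x (2 ^ k)) l (d + 1)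
    simp only [← hd'] at t5
    rw [← haa, ← hb] at t5
    have t6 := avB_le ha l (d + 1)
    rw [← hd', ← hb] at t6
    have t7 : a k ≤ (4 / 3) ^ (d + 1) * b k := by
      have h2 : (1 : ℝ) ≤ (4 / 3) ^ (d + 1) := one_le_pow₀ (by norm_num)
      have := avB_ge ha k
      rw [← hb] at this
      nlinarith [hb0 k]
    change N _ + a k ≤ _ at t5
    linarith
  rw [e2]
  have e4 := num2 hrl hr d hd'
  have e5 : (0 : ℝ) ≤ r / n := by positivity
  have := mul_le_mul_of_nonneg_left e3 e5
  have := mul_le_mul_of_nonneg_right e4 (show 0 ≤ 6 * b k by linarith [hb0 k])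
  linarith
lemma near_bound (N : Seminorm ℝ E) (T : E →ₗ[ℝ] E) (hT : ∀ y, N (T y) = N y) (x : E)
    (b : ℕ → ℝ) (hb : b = avB (fun k => N (avA T x (2 ^ k) - avA T x (2 ^ (k + 1)))))
    (k d n : ℕ) (hn : 0 < n) (hk : Nat.log 2 n + d = k) :
    N (avA T x n - avA T x (2 ^ k)) ≤ (4 / 3) ^ d * (5 * b k) := by
  have g := g_bound N T hT x b hb n hn
  set a := (fun k => N (avA T x (2 ^ k) - avA T x (2 ^ (k + 1)))) with haa
  have ha : ∀ k, 0 ≤ a k := fun k => apply_nonneg N _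
  have t4 := N_tri N (avA T x n) (avA T x (2 ^ Nat.log 2 n)) (avA T x (2 ^ k))
  have t5 := avB_dist N (fun k => avA T x (2 ^ k)) (Nat.log 2 n) d
  simp only [hk] at t5
  rw [← haa, ← hb] at t5
  have t6 := avB_le ha (Nat.log 2 n) d
  rw [hk, ← hb] at t6
  change N _ + a k ≤ _ at t5
  have := ha k
  linarith

lemma shift_bound (N : Seminorm ℝ E) (T : E →ₗ[ℝ] E) (hT : ∀ y, N (T y) = N y) (x : E)
    (b : ℕ → ℝ) (hb : b = avB (fun k => N (avA T x (2 ^ k) - avA T x (2 ^ (k + 1)))))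
    (k j : ℕ) (hj : j < 2 ^ k) :
    N (avA T x (2 ^ k) - (T ^ j) (avA T x (2 ^ k))) ≤ 24 * b k := by
  have near := near_bound N T hT x b hb
  set a := (fun k => N (avA T x (2 ^ k) - avA T x (2 ^ (k + 1)))) with haa
  have ha : ∀ k, 0 ≤ a k := fun k => apply_nonneg N _
  have hb0 : ∀ k, 0 ≤ b k := fun k => hb ▸ avB_nonneg ha k
  have hab : a k ≤ b k := hb ▸ avB_ge ha k
  have hpk : 0 < 2 ^ k := by positivity
  rcases Nat.eq_zero_or_pos j with rfl | hj0
  · have := hb0 k; simp; linarith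
  rw [avA_comm T x _ j hpk, map_smul_eq_mul, Real.norm_of_nonneg (by positivity)]
  have hl : Nat.log 2 j ≤ k := by
    have := (Nat.log_lt_iff_lt_pow (by norm_num) hj0.ne').2 hj
    omega
  obtain ⟨d, hd⟩ := Nat.exists_eq_add_of_le hl
  have n1 := near k d j hj0 hd.symm
  have hrl : j < 2 ^ (Nat.log 2 j + 1) := Nat.lt_pow_succ_log_self (by norm_num) j
  have t2 : N (avA T x (2 ^ k) - (T ^ (2 ^ k)) (avA T x (2 ^ k))) = 2 * a k := by
    rw [avA_double T x _ hpk, map_smul_eq_mul, haa]; simp [pow_succ' 2 k]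
  have t3 : N ((T ^ (2 ^ k)) (avA T x (2 ^ k)) - (T ^ (2 ^ k)) (avA T x j)) =
      N (avA T x j - avA T x (2 ^ k)) := by
    rw [← map_sub, N_pow hT, map_sub_rev]
  have u1 := N_tri N (avA T x j) (avA T x (2 ^ k)) ((T ^ (2 ^ k)) (avA T x j))
  have u2 := N_tri N (avA T x (2 ^ k)) ((T ^ (2 ^ k)) (avA T x (2 ^ k))) ((T ^ (2 ^ k)) (avA T x j))
  have h2 : (1 : ℝ) ≤ (4 / 3) ^ d := one_le_pow₀ (by norm_num)
  have u3 : N (avA T x j - (T ^ (2 ^ k)) (avA T x j)) ≤ (4 / 3) ^ d * (12 * b k) := by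
    nlinarith [hb0 k]
  have h3 : (j : ℝ) / ((2 ^ k : ℕ) : ℝ) * (4 / 3) ^ d ≤ 2 := by
    rw [div_mul_eq_mul_div, div_le_iff₀ (by positivity)]
    have v1 : (j : ℝ) ≤ 2 ^ (Nat.log 2 j + 1) := by exact_mod_cast hrl.le
    have v2 : (4 / 3 : ℝ) ^ d ≤ 2 ^ d := pow_le_pow_left₀ (by norm_num) (by norm_num) d
    have v3 : (((2 ^ k : ℕ)) : ℝ) = 2 ^ Nat.log 2 j * 2 ^ d := by
      rw [← pow_add, ← hd]; push_cast; rfl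
    rw [v3]
    calc (j : ℝ) * (4 / 3) ^ d ≤ 2 ^ (Nat.log 2 j + 1) * 2 ^ d := by gcongr
      _ = _ := by ring
  have h4 : (0 : ℝ) ≤ (j : ℝ) / ((2 ^ k : ℕ) : ℝ) := by positivity
  have := mul_le_mul_of_nonneg_left u3 h4
  have := mul_le_mul_of_nonneg_right h3 (show 0 ≤ 12 * b k by linarith [hb0 k])
  linarith

lemma long_bound (N : Seminorm ℝ E) (T : E →ₗ[ℝ] E) (hT : ∀ y, N (T y) = N y) {p : ℝ} (hp : 2 ≤ p)
    (hC : ∀ y z, N ((1 / 2 : ℝ) • (y + z)) ^ p + N ((1 / 2 : ℝ) • (y - z)) ^ p ≤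
      (N y ^ p + N z ^ p) / 2) (x : E)
    (b : ℕ → ℝ) (hb : b = avB (fun k => N (avA T x (2 ^ k) - avA T x (2 ^ (k + 1)))))
    (k d : ℕ) :
    ∃ u : ℝ, 0 ≤ u ∧ u ^ p ≤ 2 ^ p * (N (avA T x (2 ^ k)) ^ p - N (avA T x (2 ^ (k + d))) ^ p) ∧
      N (avA T x (2 ^ k) - avA T x (2 ^ (k + d))) ≤ u + 24 * b (k + d) := by
  have sh := shift_bound N T hT x b hb (k + d)
  have hpk : 0 < 2 ^ k := by positivity
  have hm := avA_mul T x (2 ^ k) (2 ^ d) hpk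
  rw [← pow_add, add_comm d k] at hm
  set z := avA T x (2 ^ (k + d)) with hz
  set y := avA T x (2 ^ k) with hy
  have hex : ∃ j ∈ Finset.range (2 ^ d), N z ≤ N ((1 / 2 : ℝ) • ((T ^ (j * 2 ^ k)) y + z)) := by
    by_contra hcon
    push Not at hcon
    have hne : (Finset.range (2 ^ d)).Nonempty := ⟨0, by simp⟩
    have h1 := Finset.sum_lt_sum_of_nonempty hne hcon
    have h2 : ∑ j ∈ Finset.range (2 ^ d), (1 / 2 : ℝ) • ((T ^ (j * 2 ^ k)) y + z) =
        ((2 ^ d : ℕ) : ℝ) • z := by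
      rw [← Finset.smul_sum, Finset.sum_add_distrib, ← hm, Finset.sum_const, Finset.card_range,
        ← Nat.cast_smul_eq_nsmul ℝ]
      module
    have h3 : N (∑ j ∈ Finset.range (2 ^ d), (1 / 2 : ℝ) • ((T ^ (j * 2 ^ k)) y + z)) ≤
        ∑ j ∈ Finset.range (2 ^ d), N ((1 / 2 : ℝ) • ((T ^ (j * 2 ^ k)) y + z)) :=
      Finset.le_sum_of_subadditive N (map_zero N).le (map_add_le_add N) _ _
    rw [h2, map_smul_eq_mul, Real.norm_of_nonneg (by positivity)] at h3
    rw [Finset.sum_const, Finset.card_range, nsmul_eq_mul] at h1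
    linarith
  obtain ⟨j, hj, hle⟩ := hex
  rw [Finset.mem_range] at hj
  have hji : j * 2 ^ k < 2 ^ (k + d) := by
    rw [pow_add, mul_comm]; exact Nat.mul_lt_mul_of_pos_left hj hpk
  refine ⟨N ((T ^ (j * 2 ^ k)) y - z), apply_nonneg N _, ?_, ?_⟩
  · have c := hC ((T ^ (j * 2 ^ k)) y) z
    rw [N_pow hT] at c
    have c2 : N z ^ p ≤ N ((1 / 2 : ℝ) • ((T ^ (j * 2 ^ k)) y + z)) ^ p :=
      Real.rpow_le_rpow (apply_nonneg N _) hle (by linarith)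
    have c3 : N ((T ^ (j * 2 ^ k)) y - z) = 2 * N ((1 / 2 : ℝ) • ((T ^ (j * 2 ^ k)) y - z)) := by
      rw [map_smul_eq_mul]; norm_num; ring
    rw [c3, Real.mul_rpow (by norm_num) (apply_nonneg N _)]
    have c4 : 0 ≤ N ((1 / 2 : ℝ) • ((T ^ (j * 2 ^ k)) y - z)) ^ p :=
      Real.rpow_nonneg (apply_nonneg N _) _
    refine mul_le_mul_of_nonneg_left ?_ (by positivity)
    linarith
  · have s1 := sh _ hji
    have s2 := N_tri N ((T ^ (j * 2 ^ k)) y) z ((T ^ (j * 2 ^ k)) z)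
    rw [← map_sub, N_pow hT] at s2
    linarith

lemma num3 {r m : ℝ} {k l d : ℕ} (hr0 : 0 ≤ r) (hr : r ≤ 2 ^ (l + 1)) (hm : 2 ^ k ≤ m) (hk : l + d = k) :
    r / m * (4 / 3) ^ d ≤ 3 / 2 * √(r / m) := by
  have hm0 : 0 < m := lt_of_lt_of_le (by positivity) hm
  have h0 : 0 ≤ r / m := by positivity
  have h1 : √(r / m) * (4 / 3) ^ d ≤ 3 / 2 := by
    have : r / m ≤ (3 / 2 * (3 / 4) ^ d) ^ 2 := by
      rw [div_le_iff₀ hm0]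
      have e1 : (2 : ℝ) ^ (l + 1) ≤ (3 / 2 * (3 / 4) ^ d) ^ 2 * 2 ^ k := by
        rw [← hk, mul_pow, ← pow_mul, mul_comm d 2, pow_mul, pow_add, pow_add]
        have : (1 : ℝ) ≤ ((3 / 4) ^ 2 * 2) ^ d := one_le_pow₀ (by norm_num)
        rw [mul_pow] at this
        have h2 : (0 : ℝ) < 2 ^ l := by positivity
        nlinarith
      refine hr.trans (e1.trans ?_)
      gcongr
    have h3 := Real.sqrt_le_sqrt this
    rw [Real.sqrt_sq (by positivity)] at h3
    calc √(r / m) * (4 / 3) ^ d ≤ (3 / 2 * (3 / 4) ^ d) * (4 / 3) ^ d := by gcongr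
      _ = 3 / 2 * ((3 / 4) * (4 / 3)) ^ d := by rw [mul_pow]; ring
      _ = 3 / 2 := by norm_num
  have h2 := Real.mul_self_sqrt h0
  calc r / m * (4 / 3) ^ d = √(r / m) * (√(r / m) * (4 / 3) ^ d) := by rw [← mul_assoc, h2]
    _ ≤ √(r / m) * (3 / 2) := by gcongr
    _ = _ := by ring

lemma short_bound (N : Seminorm ℝ E) (T : E →ₗ[ℝ] E) (hT : ∀ y, N (T y) = N y) {p : ℝ} (hp : 2 ≤ p)
    (x : E)
    (b : ℕ → ℝ) (hb : b = avB (fun k => N (avA T x (2 ^ k) - avA T x (2 ^ (k + 1)))))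
    (k n m : ℕ) (h1 : 2 ^ k ≤ n) (h2 : n < m) (h3 : m < 2 ^ (k + 1)) :
    N (avA T x n - avA T x m) ^ p ≤ 60 ^ p * (((m : ℝ) - n) / 2 ^ k * b (k + 1) ^ p) := by
  have near := near_bound N T hT x b hb
  set a := (fun k => N (avA T x (2 ^ k) - avA T x (2 ^ (k + 1)))) with haa
  have ha : ∀ k, 0 ≤ a k := fun k => apply_nonneg N _
  have hb0 : ∀ k, 0 ≤ b k := fun k => hb ▸ avB_nonneg ha k
  have hab : a k ≤ b k := hb ▸ avB_ge ha k
  have hst : b k ≤ 4 / 3 * b (k + 1) := hb ▸ avB_step ha k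
  have hpk : 0 < 2 ^ k := by positivity
  have hn0 : 0 < n := by omega
  obtain ⟨r, rfl⟩ := Nat.exists_eq_add_of_lt h2
  obtain ⟨r, rfl, hr0⟩ : ∃ r', r + 1 = r' ∧ 0 < r' := ⟨r + 1, rfl, by omega⟩
  rw [add_assoc] at *
  set r' := r + 1 with hr'
  clear_value r'
  have hrk : r' < 2 ^ k := by rw [pow_succ] at h3; omega
  have hl : Nat.log 2 r' ≤ k := by
    have := (Nat.log_lt_iff_lt_pow (by norm_num) hr0.ne').2 hrk
    omega
  obtain ⟨d, hd⟩ := Nat.exists_eq_add_of_le hl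
  have hrl : r' < 2 ^ (Nat.log 2 r' + 1) := Nat.lt_pow_succ_log_self (by norm_num) r'
  have hlogn : Nat.log 2 n = k := Nat.log_eq_of_pow_le_of_lt_pow h1 (by omega)
  have hlog2n : Nat.log 2 (2 * n) = k + 1 :=
    Nat.log_eq_of_pow_le_of_lt_pow (by rw [pow_succ]; omega) (by rw [pow_succ]; omega)
  have n1 := near k d r' hr0 hd.symm
  have n2 := near k 0 n hn0 (by omega)
  have n3 := near (k + 1) 0 (2 * n) (by omega) (by omega)
  simp only [pow_zero, one_mul] at n2 n3
  have t2 : N (avA T x n - (T ^ n) (avA T x n)) = 2 * N (avA T x n - avA T x (2 * n)) := by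
    rw [avA_double T x _ hn0, map_smul_eq_mul]; simp
  have t3 : N ((T ^ n) (avA T x n) - (T ^ n) (avA T x r')) = N (avA T x n - avA T x r') := by
    rw [← map_sub, N_pow hT]
  have u1 := N_tri N (avA T x n) ((T ^ n) (avA T x n)) ((T ^ n) (avA T x r'))
  have u2 := N_tri N (avA T x n) (avA T x (2 ^ k)) (avA T x (2 * n))
  have u3 := N_tri N (avA T x (2 ^ k)) (avA T x (2 ^ (k + 1))) (avA T x (2 * n))
  have u4 := N_tri N (avA T x n) (avA T x (2 ^ k)) (avA T x r')
  rw [map_sub_rev N (avA T x (2 ^ (k + 1)))] at u3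
  rw [map_sub_rev N (avA T x (2 ^ k)) (avA T x r')] at u4
  change _ ≤ a k + _ at u3
  have hq : (1 : ℝ) ≤ (4 / 3) ^ d := one_le_pow₀ (by norm_num)
  have u5 : N (avA T x n - (T ^ n) (avA T x r')) ≤ (4 / 3) ^ d * (40 * b (k + 1)) := by
    have w1 : (4 / 3 : ℝ) ^ d * (5 * b k) ≤ (4 / 3) ^ d * (5 * (4 / 3 * b (k + 1))) := by gcongr
    have w2 : b (k + 1) ≤ (4 / 3) ^ d * b (k + 1) := by nlinarith [hb0 (k + 1)]
    linarith [hb0 (k + 1)]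
  have hm0 : (0 : ℝ) < (n : ℝ) + r' := by positivity
  have hkn : (2 : ℝ) ^ k ≤ (n : ℝ) := by exact_mod_cast h1
  have hrr : (0 : ℝ) ≤ r' := by positivity
  have u6 : N (avA T x n - avA T x (n + r')) ≤ 60 * (√(r' / (n + r')) * b (k + 1)) := by
    rw [avA_sub T x n r' hn0, map_smul_eq_mul, Real.norm_of_nonneg (by positivity)]
    have v1 := num3 (r := r') (m := (n : ℝ) + r') (k := k) (l := Nat.log 2 r') (d := d) (by positivity)
      (by exact_mod_cast hrl.le) (by linarith) hd.symm
    have v2 : (0 : ℝ) ≤ r' / (n + r') := by positivity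
    have := mul_le_mul_of_nonneg_left u5 v2
    have := mul_le_mul_of_nonneg_right v1 (show 0 ≤ 40 * b (k + 1) by linarith [hb0 (k + 1)])
    linarith
  have hle1 : (r' : ℝ) / (n + r') ≤ 1 := by rw [div_le_one hm0]; linarith
  have h00 : (0 : ℝ) ≤ (r' : ℝ) / (n + r') := by positivity
  calc N (avA T x n - avA T x (n + r')) ^ p ≤ (60 * (√(r' / (n + r')) * b (k + 1))) ^ p :=
        Real.rpow_le_rpow (apply_nonneg N _) u6 (by linarith)
    _ = 60 ^ p * (√(r' / (n + r')) ^ p * b (k + 1) ^ p) := by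
        rw [Real.mul_rpow (by norm_num) (mul_nonneg (Real.sqrt_nonneg _) (hb0 _)),
          Real.mul_rpow (Real.sqrt_nonneg _) (hb0 _)]
    _ ≤ 60 ^ p * (((n + r' : ℕ) - n : ℝ) / 2 ^ k * b (k + 1) ^ p) := by
        have z1 : √((r' : ℝ) / (n + r')) ^ p ≤ r' / (n + r') := by
          have := Real.rpow_le_rpow_of_exponent_ge_of_imp (Real.sqrt_nonneg ((r' : ℝ) / (n + r')))
            (Real.sqrt_le_one.2 hle1) hp (by intro _ h; linarith)
          refine this.trans (le_of_eq ?_)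
          rw [Real.rpow_two, Real.sq_sqrt h00]
        have z2 : (r' : ℝ) / (n + r') ≤ ((n + r' : ℕ) - n : ℝ) / 2 ^ k := by
          push_cast
          rw [add_sub_cancel_left]
          gcongr
          linarith
        have z3 := Real.rpow_nonneg (hb0 (k + 1)) p
        have := z1.trans z2
        gcongr
lemma rpow3 {u v w p : ℝ} (hu : 0 ≤ u) (hv : 0 ≤ v) (hw : 0 ≤ w) (hp : 0 ≤ p) :
    (u + v + w) ^ p ≤ 3 ^ p * (u ^ p + v ^ p + w ^ p) := by
  have hu' := Real.rpow_nonneg hu p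
  have hv' := Real.rpow_nonneg hv p
  have hw' := Real.rpow_nonneg hw p
  have key : ∀ t : ℝ, 0 ≤ t → u + v + w ≤ 3 * t → t ^ p ≤ u ^ p + v ^ p + w ^ p →
      (u + v + w) ^ p ≤ 3 ^ p * (u ^ p + v ^ p + w ^ p) := by
    intro t ht h1 h2
    calc (u + v + w) ^ p ≤ (3 * t) ^ p := Real.rpow_le_rpow (by linarith) h1 hp
      _ = 3 ^ p * t ^ p := Real.mul_rpow (by norm_num) ht
      _ ≤ _ := by gcongr
  rcases le_total u v with h | h
  · rcases le_total v w with h' | h'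
    · exact key w hw (by linarith) (by linarith)
    · exact key v hv (by linarith) (by linarith)
  · rcases le_total u w with h' | h'
    · exact key w hw (by linarith) (by linarith)
    · exact key u hu (by linarith) (by linarith)

theorem abstract_bound (N : Seminorm ℝ E) (T : E →ₗ[ℝ] E) (hT : ∀ y, N (T y) = N y) {p : ℝ}
    (hp : 2 ≤ p)
    (hC : ∀ y z, N ((1 / 2 : ℝ) • (y + z)) ^ p + N ((1 / 2 : ℝ) • (y - z)) ^ p ≤
      (N y ^ p + N z ^ p) / 2) (x : E) (L : ℕ) (n : ℕ → ℕ) (hn : StrictMono n) (hn0 : ∀ i, 0 < n i) :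
    ∑ i ∈ Finset.range L, N (avA T x (n i) - avA T x (n (i + 1))) ^ p ≤
      (2 * 84 ^ p * (8 * 4 ^ p + 1)) * N x ^ p := by
  obtain ⟨b, hb⟩ : ∃ b : ℕ → ℝ, b = avB (fun k => N (avA T x (2 ^ k) - avA T x (2 ^ (k + 1)))) :=
    ⟨_, rfl⟩
  have long := long_bound N T hT hp hC x b hb
  have short := short_bound N T hT hp x b hb
  have g := g_bound N T hT x b hb
  have hsum : ∀ K, ∑ k ∈ Finset.range K, b k ^ p ≤ 4 * 4 ^ p * N x ^ p := by
    intro K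
    have hx0 : 0 ≤ N x ^ p := Real.rpow_nonneg (apply_nonneg N _) _
    cases K with
    | zero => simp; positivity
    | succ K =>
    have h1 := avB_sum (a := fun k => N (avA T x (2 ^ k) - avA T x (2 ^ (k + 1))))
      (fun k => apply_nonneg N _) (p := p) (by linarith) K
    rw [← hb] at h1
    have h2 : ∑ k ∈ Finset.range (K + 1), N (avA T x (2 ^ k) - avA T x (2 ^ (k + 1))) ^ p ≤
        ∑ k ∈ Finset.range (K + 1), (N (avA T x (2 ^ k)) ^ p - N (avA T x (2 ^ (k + 1))) ^ p) := by
      refine Finset.sum_le_sum fun k _ => ?_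
      have hpk : 0 < 2 ^ k := by positivity
      have c := hC (avA T x (2 ^ k)) ((T ^ (2 ^ k)) (avA T x (2 ^ k)))
      rw [← avA_mid T x _ hpk, avA_double T x _ hpk, smul_smul, N_pow hT, ← pow_succ'] at c
      norm_num at c
      linarith
    rw [Finset.sum_range_sub'] at h2
    have h3 : avA T x (2 ^ 0) = x := by simp [avA]
    rw [h3] at h2
    have h4 : 0 ≤ N (avA T x (2 ^ (K + 1))) ^ p := Real.rpow_nonneg (apply_nonneg N _) _
    have h5 : 0 ≤ b K ^ p := Real.rpow_nonneg (hb ▸ avB_nonneg (fun k => apply_nonneg N _) K) _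
    have h6 := mul_le_mul_of_nonneg_left h2 (show (0 : ℝ) ≤ 4 ^ p by positivity)
    have h7 := mul_nonneg (show (0 : ℝ) ≤ 4 ^ p by positivity) h4
    linarith
  have hanti : ∀ k d, N (avA T x (2 ^ (k + d))) ^ p ≤ N (avA T x (2 ^ k)) ^ p := by
    intro k d
    obtain ⟨u, hu, hu2, -⟩ := long k d
    have h1 : 0 ≤ (2 : ℝ) ^ p * (N (avA T x (2 ^ k)) ^ p - N (avA T x (2 ^ (k + d))) ^ p) :=
      (Real.rpow_nonneg hu p).trans hu2
    have := nonneg_of_mul_nonneg_right h1 (show (0 : ℝ) < 2 ^ p by positivity)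
    linarith
  have hb0 : ∀ k, 0 ≤ b k := fun k => hb ▸ avB_nonneg (fun k => apply_nonneg N _) k
  have hbp : ∀ k, 0 ≤ b k ^ p := fun k => Real.rpow_nonneg (hb0 k) p
  have hst : ∀ k, b k ≤ 4 / 3 * b (k + 1) := fun k => hb ▸ avB_step (fun k => apply_nonneg N _) k
  clear hb
  -- potentials
  let G : ℕ → ℝ := fun n => ∑ s ∈ Finset.range (Nat.log 2 n + 1), b s ^ p
  let H : ℕ → ℝ := fun n => ∑ s ∈ Finset.range (Nat.log 2 n), b (s + 1) ^ p +
    ((n : ℝ) - 2 ^ Nat.log 2 n) / 2 ^ Nat.log 2 n * b (Nat.log 2 n + 1) ^ p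
  let V : ℕ → ℝ := fun n => N (avA T x (2 ^ Nat.log 2 n)) ^ p
  have hHup : ∀ n, 0 < n → H n ≤ ∑ s ∈ Finset.range (Nat.log 2 n + 1), b (s + 1) ^ p := by
    intro n hn
    rw [Finset.sum_range_succ]
    have h2 : n < 2 ^ (Nat.log 2 n + 1) := Nat.lt_pow_succ_log_self (by norm_num) n
    have h3 : (n : ℝ) ≤ 2 ^ (Nat.log 2 n + 1) := by exact_mod_cast h2.le
    have : ((n : ℝ) - 2 ^ Nat.log 2 n) / 2 ^ Nat.log 2 n ≤ 1 := by
      rw [div_le_one (by positivity)]; rw [pow_succ] at h3; linarith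
    have := mul_le_mul_of_nonneg_right this (hbp (Nat.log 2 n + 1))
    simp only [H]; linarith
  have hHlow : ∀ n, 0 < n → ∑ s ∈ Finset.range (Nat.log 2 n), b (s + 1) ^ p ≤ H n := by
    intro n hn
    have h3 : (2 : ℝ) ^ (Nat.log 2 n) ≤ n := by exact_mod_cast Nat.pow_log_le_self 2 hn.ne'
    have : 0 ≤ ((n : ℝ) - 2 ^ Nat.log 2 n) / 2 ^ Nat.log 2 n :=
      div_nonneg (by linarith) (by positivity)
    have := mul_nonneg this (hbp (Nat.log 2 n + 1))
    simp only [H]; linarith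
  have step : ∀ n m, 0 < n → n < m → N (avA T x n - avA T x m) ^ p ≤
      2 * 84 ^ p * ((H m + G m - V m) - (H n + G n - V n)) := by
    intro n m hn hnm
    have hlog : Nat.log 2 n ≤ Nat.log 2 m := Nat.log_mono_right hnm.le
    have h84 : (0 : ℝ) < 84 ^ p := by positivity
    rcases hlog.eq_or_lt with heq | hlt
    · have s1 := short (Nat.log 2 n) n m (Nat.pow_log_le_self 2 hn.ne') hnm
        (by rw [heq]; exact Nat.lt_pow_succ_log_self (by norm_num) m)
      have e : (H m + G m - V m) - (H n + G n - V n) =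
          ((m : ℝ) - n) / 2 ^ Nat.log 2 n * b (Nat.log 2 n + 1) ^ p := by
        simp only [H, G, V, ← heq]; ring
      rw [e]
      refine s1.trans ?_
      have h0 : 0 ≤ ((m : ℝ) - n) / 2 ^ Nat.log 2 n * b (Nat.log 2 n + 1) ^ p := by
        have : (n : ℝ) ≤ m := by exact_mod_cast hnm.le
        exact mul_nonneg (div_nonneg (by linarith) (by positivity)) (hbp _)
      refine mul_le_mul_of_nonneg_right ?_ h0
      have : (60 : ℝ) ^ p ≤ 84 ^ p := Real.rpow_le_rpow (by norm_num) (by norm_num) (by linarith)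
      linarith
    · obtain ⟨d, hd⟩ := Nat.exists_eq_add_of_le hlog
      obtain ⟨u, hu0, hu, hu2⟩ := long (Nat.log 2 n) d
      rw [← hd] at hu hu2
      have g1 := g n hn
      have g2 := g m (by omega)
      have t1 := N_tri N (avA T x n) (avA T x (2 ^ Nat.log 2 n)) (avA T x m)
      have t2 := N_tri N (avA T x (2 ^ Nat.log 2 n)) (avA T x (2 ^ Nat.log 2 m)) (avA T x m)
      rw [map_sub_rev N (avA T x (2 ^ Nat.log 2 m))] at t2
      have hs := hst (Nat.log 2 n)
      have t3 : N (avA T x n - avA T x m) ≤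
          u + 28 * b (Nat.log 2 n + 1) + 28 * b (Nat.log 2 m) := by
        linarith [hb0 (Nat.log 2 n + 1)]
      have t4 := Real.rpow_le_rpow (apply_nonneg N _) t3 (show 0 ≤ p by linarith)
      have t5 := rpow3 hu0 (show 0 ≤ 28 * b (Nat.log 2 n + 1) by linarith [hb0 (Nat.log 2 n + 1)])
        (show 0 ≤ 28 * b (Nat.log 2 m) by linarith [hb0 (Nat.log 2 m)]) (show 0 ≤ p by linarith)
      rw [Real.mul_rpow (by norm_num) (hb0 _), Real.mul_rpow (by norm_num) (hb0 _)] at t5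
      have hG : ∀ s, Nat.log 2 n < s → s ≤ Nat.log 2 m → b s ^ p ≤ G m - G n := by
        intro s h1 h2
        simp only [G]
        rw [← Finset.sum_Ico_eq_sub _ (by omega : Nat.log 2 n + 1 ≤ Nat.log 2 m + 1)]
        exact Finset.single_le_sum (f := fun s => b s ^ p) (fun i _ => hbp i)
          (Finset.mem_Ico.2 ⟨h1, by omega⟩)
      have G1 := hG _ (Nat.lt_succ_self _) hlt
      have G2 := hG _ hlt le_rfl
      have hH : H n ≤ H m := by
        refine (hHup n hn).trans (le_trans ?_ (hHlow m (by omega)))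
        exact Finset.sum_le_sum_of_subset_of_nonneg (Finset.range_mono hlt) (fun i _ _ => hbp _)
      have hV : 0 ≤ V n - V m := by
        have := hanti (Nat.log 2 n) d
        rw [← hd] at this
        simp only [V]; linarith
      change _ ≤ 2 ^ p * (V n - V m) at hu
      have e84 : (84 : ℝ) ^ p = 3 ^ p * 28 ^ p := by
        rw [← Real.mul_rpow (by norm_num) (by norm_num)]; norm_num
      have h28 : (2 : ℝ) ^ p ≤ 28 ^ p := Real.rpow_le_rpow (by norm_num) (by norm_num) (by linarith)
      have h280 : (0 : ℝ) < 28 ^ p := by positivity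
      have w1 : u ^ p ≤ 28 ^ p * (V n - V m) := hu.trans (mul_le_mul_of_nonneg_right h28 hV)
      have w2 := mul_le_mul_of_nonneg_left G1 h280.le
      have w3 := mul_le_mul_of_nonneg_left G2 h280.le
      have w4 := mul_nonneg h280.le hV
      have w5 := mul_nonneg h280.le (sub_nonneg.2 hH)
      have w6 : u ^ p + 28 ^ p * b (Nat.log 2 n + 1) ^ p + 28 ^ p * b (Nat.log 2 m) ^ p ≤
          2 * 28 ^ p * ((H m + G m - V m) - (H n + G n - V n)) := by
        simp only [Nat.succ_eq_add_one] at w2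
        linarith
      have w7 := mul_le_mul_of_nonneg_left w6 (show (0 : ℝ) ≤ 3 ^ p by positivity)
      refine t4.trans (t5.trans (w7.trans (le_of_eq ?_)))
      rw [e84]; ring
  have tot : ∑ i ∈ Finset.range L, N (avA T x (n i) - avA T x (n (i + 1))) ^ p ≤
      ∑ i ∈ Finset.range L, 2 * 84 ^ p * ((H (n (i + 1)) + G (n (i + 1)) - V (n (i + 1))) -
        (H (n i) + G (n i) - V (n i))) :=
    Finset.sum_le_sum fun i _ => step _ _ (hn0 i) (hn (Nat.lt_succ_self i))
  rw [← Finset.mul_sum, Finset.sum_range_sub (fun i => H (n i) + G (n i) - V (n i))] at tot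
  refine tot.trans ?_
  rw [mul_assoc (2 * 84 ^ p : ℝ)]
  refine mul_le_mul_of_nonneg_left ?_ (by positivity)
  have f1 : H (n L) ≤ 4 * 4 ^ p * N x ^ p := by
    refine (hHup _ (hn0 L)).trans (le_trans ?_ (hsum (Nat.log 2 (n L) + 1 + 1)))
    rw [Finset.sum_range_succ' (fun s => b s ^ p)]
    linarith [hbp 0]
  have f2 : G (n L) ≤ 4 * 4 ^ p * N x ^ p := hsum _
  have f3 : 0 ≤ V (n L) := Real.rpow_nonneg (apply_nonneg N _) _
  have f4 : 0 ≤ H (n 0) := le_trans (Finset.sum_nonneg fun i _ => hbp _) (hHlow _ (hn0 0))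
  have f5 : 0 ≤ G (n 0) := Finset.sum_nonneg fun i _ => hbp _
  have f6 : V (n 0) ≤ N x ^ p := by
    have := hanti 0 (Nat.log 2 (n 0))
    have h3 : avA T x (2 ^ 0) = x := by simp [avA]
    rw [h3, zero_add] at this
    exact this
  linarith
end Abstract

section Renorm
variable {E : Type*} [NormedAddCommGroup E] [NormedSpace ℝ E]

noncomputable def avP (p : ℝ) (T : E →ₗ[ℝ] E) (L : ℕ) (x : E) : ℝ :=
  ((L : ℝ) + 1)⁻¹ * ∑ j ∈ Finset.range (L + 1), ‖(T ^ j) x‖ ^ p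

lemma avP_nonneg (p : ℝ) (T : E →ₗ[ℝ] E) (L : ℕ) (x : E) : 0 ≤ avP p T L x := by
  unfold avP
  exact mul_nonneg (by positivity) (Finset.sum_nonneg fun i _ => Real.rpow_nonneg (norm_nonneg _) _)

lemma avP_const (L : ℕ) (c : ℝ) :
    ((L : ℝ) + 1)⁻¹ * ∑ _j ∈ Finset.range (L + 1), c = c := by
  have : (L : ℝ) + 1 ≠ 0 := by positivity
  rw [Finset.sum_const, Finset.card_range, nsmul_eq_mul]; push_cast
  field_simp

lemma exists_renorm {p : ℝ} (hp : 2 ≤ p) (T : E →ₗ[ℝ] E) (K : ℝ) (hK0 : 0 ≤ K)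
    (h1 : ∀ j x, ‖(T ^ j) x‖ ≤ K * ‖x‖) (h2 : ∀ j x, ‖x‖ ≤ K * ‖(T ^ j) x‖)
    (hC : ∀ y z : E, ‖(1 / 2 : ℝ) • (y + z)‖ ^ p + ‖(1 / 2 : ℝ) • (y - z)‖ ^ p ≤
      (‖y‖ ^ p + ‖z‖ ^ p) / 2) :
    ∃ N : Seminorm ℝ E, (∀ y, N (T y) = N y) ∧ (∀ x, N x ≤ K * ‖x‖) ∧ (∀ x, ‖x‖ ≤ K * N x) ∧
      ∀ y z, N ((1 / 2 : ℝ) • (y + z)) ^ p + N ((1 / 2 : ℝ) • (y - z)) ^ p ≤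
      (N y ^ p + N z ^ p) / 2 := by
  have hp0 : 0 < p := by linarith
  let U : Ultrafilter ℕ := Filter.hyperfilter ℕ
  have hU : (U : Filter ℕ) ≤ Filter.atTop := by
    rw [← Nat.cofinite_eq_atTop]; exact Filter.hyperfilter_le_cofinite
  have hup : ∀ L x, avP p T L x ≤ (K * ‖x‖) ^ p := by
    intro L x
    rw [← avP_const L ((K * ‖x‖) ^ p), avP]
    gcongr with j
    exact h1 j x
  have hlow : ∀ L x, ‖x‖ ^ p ≤ K ^ p * avP p T L x := by
    intro L x
    rw [← avP_const L (‖x‖ ^ p), avP, mul_left_comm]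
    refine mul_le_mul_of_nonneg_left ?_ (by positivity)
    rw [Finset.mul_sum]
    refine Finset.sum_le_sum fun j _ => ?_
    rw [← Real.mul_rpow hK0 (norm_nonneg _)]
    exact Real.rpow_le_rpow (norm_nonneg _) (h2 j x) hp0.le
  have hex : ∀ x, ∃ l, 0 ≤ l ∧ Filter.Tendsto (fun L => avP p T L x) U (nhds l) := by
    intro x
    have hc : IsCompact (Set.Icc (0 : ℝ) ((K * ‖x‖) ^ p)) := isCompact_Icc
    obtain ⟨l, hl, hl2⟩ := hc.ultrafilter_le_nhds (U.map (fun L => avP p T L x)) (by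
      rw [Filter.le_principal_iff]
      exact Filter.mem_map.2 (Filter.Eventually.of_forall fun L => ⟨avP_nonneg _ _ _ _, hup L x⟩))
    exact ⟨l, hl.1, hl2⟩
  choose Q hQ0 hQ using hex
  have hQ' : ∀ x, Filter.Tendsto (fun L => avP p T L x ^ (1 / p)) U (nhds (Q x ^ (1 / p))) :=
    fun x => (hQ x).rpow_const (Or.inr (by positivity))
  have hadd : ∀ x y, Q (x + y) ^ (1 / p) ≤ Q x ^ (1 / p) + Q y ^ (1 / p) := by
    intro x y
    refine le_of_tendsto_of_tendsto' (hQ' (x + y)) ((hQ' x).add (hQ' y)) fun L => ?_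
    have hL : (0 : ℝ) ≤ ((L : ℝ) + 1)⁻¹ := by positivity
    simp only [avP]
    rw [Real.mul_rpow hL (Finset.sum_nonneg fun i _ => Real.rpow_nonneg (norm_nonneg _) _),
      Real.mul_rpow hL (Finset.sum_nonneg fun i _ => Real.rpow_nonneg (norm_nonneg _) _),
      Real.mul_rpow hL (Finset.sum_nonneg fun i _ => Real.rpow_nonneg (norm_nonneg _) _), ← mul_add]
    refine mul_le_mul_of_nonneg_left ?_ (Real.rpow_nonneg hL _)
    refine le_trans ?_ (Real.Lp_add_le_of_nonneg (p := p) (Finset.range (L + 1))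
      (by linarith) (fun i _ => norm_nonneg ((T ^ i) x)) (fun i _ => norm_nonneg ((T ^ i) y)))
    refine Real.rpow_le_rpow (Finset.sum_nonneg fun i _ => Real.rpow_nonneg (norm_nonneg _) _) ?_
      (by positivity)
    refine Finset.sum_le_sum fun i _ => Real.rpow_le_rpow (norm_nonneg _) ?_ hp0.le
    rw [map_add]; exact norm_add_le _ _
  have hsmul : ∀ (c : ℝ) x, Q (c • x) ^ (1 / p) = ‖c‖ * Q x ^ (1 / p) := by
    intro c x
    refine tendsto_nhds_unique (hQ' (c • x)) ?_
    refine ((hQ' x).const_mul ‖c‖).congr fun L => ?_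
    have : avP p T L (c • x) = ‖c‖ ^ p * avP p T L x := by
      simp only [avP, map_smul, norm_smul, Real.mul_rpow (norm_nonneg _) (norm_nonneg _),
        ← Finset.mul_sum]
      ring
    rw [this, Real.mul_rpow (Real.rpow_nonneg (norm_nonneg _) _) (avP_nonneg _ _ _ _),
      ← Real.rpow_mul (norm_nonneg _), mul_one_div_cancel hp0.ne', Real.rpow_one]
  have hNp : ∀ x, (Q x ^ (1 / p)) ^ p = Q x := by
    intro x
    rw [← Real.rpow_mul (hQ0 x), one_div_mul_cancel hp0.ne', Real.rpow_one]
  refine ⟨Seminorm.of (fun x => Q x ^ (1 / p)) hadd hsmul, ?_, ?_, ?_, ?_⟩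
  · intro y
    change Q (T y) ^ (1 / p) = Q y ^ (1 / p)
    congr 1
    refine tendsto_nhds_unique (hQ (T y)) ?_
    have h0 : Filter.Tendsto (fun L : ℕ => ((L : ℝ) + 1)⁻¹ * (‖(T ^ (L + 1)) y‖ ^ p - ‖y‖ ^ p))
        Filter.atTop (nhds 0) := by
      have hz : Filter.Tendsto (fun L : ℕ => ((L : ℝ) + 1)⁻¹ * ((K * ‖y‖) ^ p + ‖y‖ ^ p))
          Filter.atTop (nhds 0) := by
        have := (tendsto_one_div_add_atTop_nhds_zero_nat (𝕜 := ℝ)).mul_const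
          ((K * ‖y‖) ^ p + ‖y‖ ^ p)
        simpa using this
      refine squeeze_zero_norm (fun L => ?_) hz
      rw [norm_mul, Real.norm_of_nonneg (show (0 : ℝ) ≤ ((L : ℝ) + 1)⁻¹ by positivity)]
      refine mul_le_mul_of_nonneg_left ?_ (by positivity)
      rw [Real.norm_eq_abs]
      have a1 := Real.rpow_le_rpow (norm_nonneg _) (h1 (L + 1) y) hp0.le
      have a2 := Real.rpow_nonneg (norm_nonneg ((T ^ (L + 1)) y)) p
      have a3 := Real.rpow_nonneg (norm_nonneg y) p
      rw [abs_le]; constructor <;> linarith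
    have h3 := (hQ y).add (h0.mono_left hU)
    rw [add_zero] at h3
    refine h3.congr fun L => ?_
    simp only [avP, ← mul_add]
    congr 1
    rw [Finset.sum_range_succ', Finset.sum_range_succ (fun j => ‖(T ^ j) (T y)‖ ^ p)]
    simp only [pow_succ, pow_zero, Module.End.mul_apply, Module.End.one_apply]
    ring
  · intro x
    change Q x ^ (1 / p) ≤ K * ‖x‖
    have : Q x ≤ (K * ‖x‖) ^ p := le_of_tendsto' (hQ x) fun L => hup L x
    have h3 := Real.rpow_le_rpow (hQ0 x) this (show 0 ≤ 1 / p by positivity)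
    rwa [← Real.rpow_mul (by positivity), mul_one_div_cancel hp0.ne', Real.rpow_one] at h3
  · intro x
    change ‖x‖ ≤ K * Q x ^ (1 / p)
    have : ‖x‖ ^ p ≤ K ^ p * Q x := ge_of_tendsto' ((hQ x).const_mul (K ^ p)) fun L => hlow L x
    have h3 := Real.rpow_le_rpow (by positivity) this (show 0 ≤ 1 / p by positivity)
    rwa [← Real.rpow_mul (by positivity), mul_one_div_cancel hp0.ne', Real.rpow_one,
      Real.mul_rpow (by positivity) (hQ0 x), ← Real.rpow_mul (by positivity),
      mul_one_div_cancel hp0.ne', Real.rpow_one] at h3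
  · intro y z
    change (Q _ ^ (1 / p)) ^ p + (Q _ ^ (1 / p)) ^ p ≤ ((Q _ ^ (1 / p)) ^ p + (Q _ ^ (1 / p)) ^ p) / 2
    rw [hNp, hNp, hNp, hNp]
    refine le_of_tendsto_of_tendsto' ((hQ _).add (hQ _)) (((hQ y).add (hQ z)).div_const 2) fun L => ?_
    simp only [avP, ← mul_add, mul_div_assoc]
    refine mul_le_mul_of_nonneg_left ?_ (by positivity)
    rw [← Finset.sum_add_distrib, ← Finset.sum_add_distrib, Finset.sum_div]
    refine Finset.sum_le_sum fun j _ => ?_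
    simpa only [map_smul, map_add, map_sub] using hC ((T ^ j) y) ((T ^ j) z)
end Renorm

lemma clarkson_scalar {p : ℝ} (hp : 2 ≤ p) (a b : ℂ) :
    ‖(1 / 2 : ℝ) • (a + b)‖ ^ p + ‖(1 / 2 : ℝ) • (a - b)‖ ^ p ≤ (‖a‖ ^ p + ‖b‖ ^ p) / 2 := by
  have sq : ∀ t : ℝ, 0 ≤ t → t ^ p = (t ^ 2) ^ (p / 2) := by
    intro t ht
    rw [← Real.rpow_natCast, ← Real.rpow_mul ht]; congr 1; push_cast; ring
  rw [sq _ (norm_nonneg _), sq _ (norm_nonneg _), sq ‖a‖ (norm_nonneg _), sq ‖b‖ (norm_nonneg _)]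
  have h1 := Real.add_rpow_le_rpow_add (sq_nonneg ‖(1 / 2 : ℝ) • (a + b)‖)
    (sq_nonneg ‖(1 / 2 : ℝ) • (a - b)‖) (show 1 ≤ p / 2 by linarith)
  refine h1.trans ?_
  have h2 := parallelogram_law_with_norm ℝ a b
  have h3 : ‖(1 / 2 : ℝ) • (a + b)‖ ^ 2 + ‖(1 / 2 : ℝ) • (a - b)‖ ^ 2 =
      (1 / 2) * ‖a‖ ^ 2 + (1 / 2) * ‖b‖ ^ 2 := by
    rw [norm_smul, norm_smul, Real.norm_of_nonneg (by norm_num)]; nlinarith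
  rw [h3]
  have h4 := (convexOn_rpow (show 1 ≤ p / 2 by linarith)).2 (Set.mem_Ici.2 (sq_nonneg ‖a‖))
    (Set.mem_Ici.2 (sq_nonneg ‖b‖)) (show (0 : ℝ) ≤ 1 / 2 by norm_num)
    (show (0 : ℝ) ≤ 1 / 2 by norm_num) (by norm_num)
  simp only [smul_eq_mul] at h4
  linarith

lemma Lp_norm_rpow {X : Type*} [MeasurableSpace X] {μ : Measure X} {p : ℝ≥0∞} [Fact (1 ≤ p)]
    (hp' : p ≠ ∞) (f : Lp ℂ p μ) : ‖f‖ ^ p.toReal = ∫ t, ‖f t‖ ^ p.toReal ∂μ := by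
  have hp0 : p ≠ 0 := (lt_of_lt_of_le one_pos (Fact.out : 1 ≤ p)).ne'
  have hpp : 0 < p.toReal := ENNReal.toReal_pos hp0 hp'
  rw [Lp.norm_def, MemLp.eLpNorm_eq_integral_rpow_norm hp0 hp' (Lp.memLp f),
    ENNReal.toReal_ofReal (by positivity), ← Real.rpow_mul (by positivity),
    inv_mul_cancel₀ hpp.ne', Real.rpow_one]

lemma clarkson_Lp {X : Type*} [MeasurableSpace X] {μ : Measure X} {p : ℝ≥0∞} [Fact (1 ≤ p)]
    (hp : 2 ≤ p) (hp' : p ≠ ∞) (f g : Lp ℂ p μ) :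
    ‖(1 / 2 : ℝ) • (f + g)‖ ^ p.toReal + ‖(1 / 2 : ℝ) • (f - g)‖ ^ p.toReal ≤
      (‖f‖ ^ p.toReal + ‖g‖ ^ p.toReal) / 2 := by
  have hp0 : p ≠ 0 := (lt_of_lt_of_le one_pos (Fact.out : 1 ≤ p)).ne'
  have hp2 : 2 ≤ p.toReal := by
    simpa using (ENNReal.toReal_le_toReal (by norm_num) hp').2 hp
  have hi : ∀ h : Lp ℂ p μ, Integrable (fun t => ‖h t‖ ^ p.toReal) μ :=
    fun h => (Lp.memLp h).integrable_norm_rpow hp0 hp'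
  simp only [Lp_norm_rpow hp']
  rw [← integral_add (hi _) (hi _), ← integral_add (hi _) (hi _), ← integral_div]
  refine integral_mono_ae ((hi _).add (hi _)) (((hi _).add (hi _)).div_const 2) ?_
  filter_upwards [Lp.coeFn_smul (1 / 2 : ℝ) (f + g), Lp.coeFn_smul (1 / 2 : ℝ) (f - g),
    Lp.coeFn_add f g, Lp.coeFn_sub f g] with t e1 e2 e3 e4
  have := clarkson_scalar hp2 (f t) (g t)
  simp only [e1, e2, Pi.smul_apply, e3, e4, Pi.add_apply, Pi.sub_apply]
  exact this

/-- Commutative strengthening of the Avigad–Rute inequality for `2 ≤ p < ∞`: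
`p`-variation bound for ergodic averages of an invertible power bounded operator. -/
theorem avigad_rute_strengthening
    (p : ℝ≥0∞) [Fact (1 ≤ p)] (hp : 2 ≤ p) (hp' : p ≠ ∞) (K : ℝ) :
    ∃ C : ℝ, 0 < C ∧
      ∀ (X : Type) [MeasurableSpace X] (μ : Measure X) [SigmaFinite μ]
        (T : Lp ℂ p μ ≃L[ℂ] Lp ℂ p μ),
        (∀ k : ℤ, ‖((T ^ k : Lp ℂ p μ ≃L[ℂ] Lp ℂ p μ) : Lp ℂ p μ →L[ℂ] Lp ℂ p μ)‖ ≤ K) →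
        ∀ (N : ℕ) (n : ℕ → ℕ), StrictMono n → (∀ i, 0 < n i) →
        ∀ x : Lp ℂ p μ,
          ∑ i ∈ Finset.range N,
              ‖ergAvg (T : Lp ℂ p μ →L[ℂ] Lp ℂ p μ) (n i) x -
                ergAvg (T : Lp ℂ p μ →L[ℂ] Lp ℂ p μ) (n (i + 1)) x‖ ^ p.toReal
            ≤ C ^ p.toReal * ‖x‖ ^ p.toReal := by
  have hp2 : 2 ≤ p.toReal := by
    simpa using (ENNReal.toReal_le_toReal (by norm_num) hp').2 hp
  set q := p.toReal with hq
  have hq0 : 0 < q := by linarith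
  set D : ℝ := 2 * 84 ^ q * (8 * 4 ^ q + 1) with hD
  have hD0 : 0 < D := by positivity
  refine ⟨(|K| + 1) * (|K| + 1) * D ^ (1 / q), by positivity, ?_⟩
  intro X _ μ _ T hK N n hn hn0 x
  set K' : ℝ := |K| + 1 with hK'
  have hK'0 : 0 ≤ K' := by positivity
  let S : Lp ℂ p μ →ₗ[ℝ] Lp ℂ p μ :=
    ((T : Lp ℂ p μ →L[ℂ] Lp ℂ p μ) : Lp ℂ p μ →ₗ[ℂ] Lp ℂ p μ).restrictScalars ℝ
  have hS : ∀ (j : ℕ) y, (S ^ j) y = ((T : Lp ℂ p μ →L[ℂ] Lp ℂ p μ) ^ j) y := by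
    intro j
    induction j with
    | zero => intro y; rfl
    | succ j ih =>
      intro y
      rw [pow_succ', pow_succ']
      change S ((S ^ j) y) = T (((T : Lp ℂ p μ →L[ℂ] Lp ℂ p μ) ^ j) y)
      rw [ih]; rfl
  have hST : ∀ (j : ℕ) y, (S ^ j) y = (T ^ j : Lp ℂ p μ ≃L[ℂ] Lp ℂ p μ) y := by
    intro j
    induction j with
    | zero => intro y; rfl
    | succ j ih =>
      intro y
      rw [pow_succ', pow_succ']
      change S ((S ^ j) y) = T ((T ^ j : Lp ℂ p μ ≃L[ℂ] Lp ℂ p μ) y)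
      rw [ih]; rfl
  have hT : ∀ (k : ℤ) y, ‖(T ^ k : Lp ℂ p μ ≃L[ℂ] Lp ℂ p μ) y‖ ≤ K' * ‖y‖ := by
    intro k y
    have h1 := ContinuousLinearMap.le_opNorm
      ((T ^ k : Lp ℂ p μ ≃L[ℂ] Lp ℂ p μ) : Lp ℂ p μ →L[ℂ] Lp ℂ p μ) y
    have h2 := hK k
    have h3 : K ≤ K' := by have := le_abs_self K; linarith
    exact h1.trans (mul_le_mul_of_nonneg_right (h2.trans h3) (norm_nonneg y))
  obtain ⟨M, hM1, hM2, hM3, hM4⟩ := exists_renorm hp2 S K' hK'0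
    (fun j y => by rw [hST, ← zpow_natCast]; exact hT _ y)
    (fun j y => by
      have h := hT (-(j : ℤ)) ((S ^ j) y)
      have e : (T ^ (-(j : ℤ)) : Lp ℂ p μ ≃L[ℂ] Lp ℂ p μ) ((S ^ j) y) = y := by
        rw [hST, ← zpow_natCast]
        change (T ^ (-(j : ℤ)) * T ^ (j : ℤ) : Lp ℂ p μ ≃L[ℂ] Lp ℂ p μ) y = y
        rw [← zpow_add, neg_add_cancel, zpow_zero]; rfl
      rwa [e] at h)
    (clarkson_Lp hp hp')
  have key := abstract_bound M S hM1 hp2 hM4 x N (fun i => n i + 1)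
    (fun i j h => Nat.add_lt_add_right (hn h) 1) (fun i => Nat.succ_pos _)
  have hA : ∀ m, ergAvg (T : Lp ℂ p μ →L[ℂ] Lp ℂ p μ) m x = avA S x (m + 1) := by
    intro m
    simp only [ergAvg, avA, _root_.smul_apply, _root_.sum_apply, hS]
    rw [← algebraMap_smul ℂ (((m + 1 : ℕ) : ℝ)⁻¹)]
    congr 1
    simp
  simp only [hA]
  have hx := apply_nonneg M x
  calc ∑ i ∈ Finset.range N, ‖avA S x (n i + 1) - avA S x (n (i + 1) + 1)‖ ^ q
      ≤ ∑ i ∈ Finset.range N, K' ^ q * M (avA S x (n i + 1) - avA S x (n (i + 1) + 1)) ^ q := by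
        refine Finset.sum_le_sum fun i _ => ?_
        rw [← Real.mul_rpow hK'0 (apply_nonneg M _)]
        exact Real.rpow_le_rpow (norm_nonneg _) (hM3 _) hq0.le
    _ ≤ K' ^ q * (D * M x ^ q) := by
        rw [← Finset.mul_sum]
        exact mul_le_mul_of_nonneg_left key (by positivity)
    _ ≤ K' ^ q * (D * (K' * ‖x‖) ^ q) := by
        have := Real.rpow_le_rpow hx (hM2 x) hq0.le
        gcongr
    _ = (K' * K' * D ^ (1 / q)) ^ q * ‖x‖ ^ q := by
        rw [Real.mul_rpow hK'0 (norm_nonneg _),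
          Real.mul_rpow (mul_nonneg hK'0 hK'0) (Real.rpow_nonneg hD0.le _),
          Real.mul_rpow hK'0 hK'0, ← Real.rpow_mul hD0.le,
          one_div_mul_cancel hq0.ne', Real.rpow_one]
        ring
end
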